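/- arXiv:2405.16733 — 9 statements merged into one kernel-verified Lean document; each statement's English description precedes it below -/
import Mathlib

section
/- Let n ≥ 2 and let f : S^{n-1} → ℝ be a continuous function on the unit sphere of ℝ^n. Then there exist n unit vectors p_1, …, p_n in ℝ^n with ⟨p_i, p_j⟩ = -1/n for all i ≠ j, and a constant f_0 ∈ ℝ, such that f(p_1) = f(p_2) = ⋯ = f(p_n) = f_0. -/
open RealInnerProductSpace

namespace Knaster

/-! ### Chains of words -/

section Chains

variable {K : Type*} [CommRing K] {X Y Z : Type*}

/-- Chains: formal linear combinations of words in the letters `X`. -/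
abbrev Chain (K : Type*) [CommRing K] (X : Type*) := List X →₀ K

/-- Prepend a letter to every word of a chain. -/
noncomputable def cons (x : X) : Chain K X →ₗ[K] Chain K X :=
  Finsupp.lmapDomain K K (List.cons x)

@[simp] lemma cons_single (x : X) (w : List X) (k : K) :
    cons x (Finsupp.single w k) = Finsupp.single (x :: w) k := by
  simp [cons]

/-- The augmented simplicial boundary of a word. -/
noncomputable def bdWord (K : Type*) [CommRing K] {X : Type*} : List X → Chain K X
  | [] => 0
  | x :: w => Finsupp.single w 1 - cons x (bdWord K w)

/-- The augmented simplicial boundary of a chain. -/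
noncomputable def bd : Chain K X →ₗ[K] Chain K X :=
  Finsupp.linearCombination K (bdWord K)

@[simp] lemma bd_single_nil (k : K) : bd (Finsupp.single ([] : List X) k) = 0 := by
  simp [bd, bdWord]

lemma bd_cons (x : X) (c : Chain K X) : bd (cons x c) = c - cons x (bd c) := by
  induction c using Finsupp.induction_linear with
  | zero => simp
  | add c d hc hd => simp only [map_add, hc, hd]; abel
  | single w k => simp [bd, bdWord, smul_sub]

lemma bd_bd (c : Chain K X) : bd (bd c) = 0 := by
  induction c using Finsupp.induction_linear with
  | zero => simp
  | add c d hc hd => simp [hc, hd]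
  | single w k =>
    induction w with
    | nil => simp
    | cons x w ih => rw [← cons_single, bd_cons, map_sub, bd_cons, ih]; simp

/-- Apply a map to all letters of a chain. -/
noncomputable def mapC (f : X → Y) : Chain K X →ₗ[K] Chain K Y :=
  Finsupp.lmapDomain K K (List.map f)

@[simp] lemma mapC_single (f : X → Y) (w : List X) (k : K) :
    mapC f (Finsupp.single w k) = Finsupp.single (w.map f) k := by
  simp [mapC]

lemma mapC_cons (f : X → Y) (x : X) (c : Chain K X) :
    mapC f (cons x c) = cons (f x) (mapC f c) := by
  induction c using Finsupp.induction_linear with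
  | zero => simp
  | add c d hc hd => simp [hc, hd]
  | single w k => simp

lemma mapC_mapC (f : X → Y) (g : Y → Z) (c : Chain K X) :
    mapC g (mapC f c) = mapC (g ∘ f) c := by
  induction c using Finsupp.induction_linear with
  | zero => simp
  | add c d hc hd => simp [hc, hd]
  | single w k => simp

lemma mapC_id (c : Chain K X) : mapC id c = c := by
  induction c using Finsupp.induction_linear with
  | zero => simp
  | add c d hc hd => simp [hc, hd]
  | single w k => simp

lemma bd_mapC (f : X → Y) (c : Chain K X) : bd (mapC f c) = mapC f (bd c) := by
  induction c using Finsupp.induction_linear with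
  | zero => simp
  | add c d hc hd => simp [hc, hd]
  | single w k =>
    induction w with
    | nil => simp
    | cons x w ih => rw [← cons_single, mapC_cons, bd_cons, ih, bd_cons, map_sub, mapC_cons]

/-- The prism on a word, interpolating between its images under `f` and `g`. -/
noncomputable def prismWord (K : Type*) [CommRing K] (f g : X → Y) : List X → Chain K Y
  | [] => 0
  | x :: w => Finsupp.single (f x :: g x :: w.map g) 1 - cons (f x) (prismWord K f g w)

/-- The prism operator, a chain homotopy between `mapC f` and `mapC g`. -/
noncomputable def prism (f g : X → Y) : Chain K X →ₗ[K] Chain K Y :=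
  Finsupp.linearCombination K (prismWord K f g)

@[simp] lemma prism_single_nil (f g : X → Y) (k : K) :
    prism f g (Finsupp.single ([] : List X) k) = 0 := by
  simp [prism, prismWord]

lemma prism_single (f g : X → Y) (w : List X) (k : K) :
    prism f g (Finsupp.single w k) = k • prismWord K f g w := by
  simp [prism]

lemma prism_cons (f g : X → Y) (x : X) (c : Chain K X) :
    prism f g (cons x c) = cons (f x) (cons (g x) (mapC g c)) - cons (f x) (prism f g c) := by
  induction c using Finsupp.induction_linear with
  | zero => simp
  | add c d hc hd => simp only [map_add, hc, hd]; abel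
  | single w k => simp [prism, prismWord, smul_sub]

lemma bd_prism_add (f g : X → Y) (c : Chain K X) :
    bd (prism f g c) + prism f g (bd c) = mapC g c - mapC f c := by
  induction c using Finsupp.induction_linear with
  | zero => simp
  | add c d hc hd =>
    simp only [map_add]
    rw [add_sub_add_comm, ← hc, ← hd]; abel
  | single w k =>
    induction w with
    | nil => simp
    | cons x w ih =>
      rw [← cons_single]
      simp only [prism_cons, bd_cons, map_sub, mapC_cons, bd_mapC]
      have key := congrArg (cons (f x)) ih
      simp only [map_add, map_sub] at key
      linear_combination (norm := module) key

lemma prism_mapC {W : Type*} (e : W → X) (f g : X → Y) (c : Chain K W) :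
    prism f g (mapC e c) = prism (f ∘ e) (g ∘ e) c := by
  induction c using Finsupp.induction_linear with
  | zero => simp
  | add c d hc hd => simp [hc, hd]
  | single w k =>
    induction w with
    | nil => simp
    | cons x w ih =>
      rw [← cons_single, mapC_cons, prism_cons, prism_cons, ih, mapC_mapC]; rfl

lemma mapC_prism (e : Y → Z) (f g : X → Y) (c : Chain K X) :
    mapC e (prism f g c) = prism (e ∘ f) (e ∘ g) c := by
  induction c using Finsupp.induction_linear with
  | zero => simp
  | add c d hc hd => simp [hc, hd]
  | single w k =>
    induction w with
    | nil => simp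
    | cons x w ih =>
      rw [← cons_single, prism_cons, prism_cons, map_sub, mapC_cons, mapC_cons, mapC_cons, ih,
        mapC_mapC]; rfl

end Chains

section Support

variable {K : Type*} [CommRing K] {X Y : Type*}

lemma map_mem_of_mem_supported {N : Type*} [AddCommGroup N] [Module K N] {s : Set (List X)}
    (L : Chain K X →ₗ[K] N) (S : Submodule K N)
    (h : ∀ w ∈ s, L (Finsupp.single w 1) ∈ S) {c : Chain K X}
    (hc : c ∈ Finsupp.supported K K s) : L c ∈ S := by
  rw [Finsupp.supported_eq_span_single] at hc
  induction hc using Submodule.span_induction with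
  | mem x hx =>
    obtain ⟨w, hw, rfl⟩ := hx
    exact h w hw
  | zero => simp
  | add x y _ _ hx hy => rw [map_add]; exact S.add_mem hx hy
  | smul a x _ hx => rw [map_smul]; exact S.smul_mem a hx

/-- The chains all of whose letters lie in `A`. -/
def chainsIn (K : Type*) [CommRing K] {X : Type*} (A : Set X) : Submodule K (Chain K X) :=
  Finsupp.supported K K {w | ∀ x ∈ w, x ∈ A}

lemma single_mem_chainsIn {A : Set X} {w : List X} (hw : ∀ x ∈ w, x ∈ A) (k : K) :
    Finsupp.single w k ∈ chainsIn K A :=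
  Finsupp.single_mem_supported K k hw

lemma cons_mem_chainsIn {A : Set X} {x : X} (hx : x ∈ A) {c : Chain K X}
    (hc : c ∈ chainsIn K A) : cons x c ∈ chainsIn K A := by
  refine map_mem_of_mem_supported (cons x) _ (fun w hw => ?_) hc
  rw [cons_single]
  exact single_mem_chainsIn (by simpa [hx] using hw) 1

lemma bdWord_mem_chainsIn {A : Set X} {w : List X} (hw : ∀ x ∈ w, x ∈ A) :
    bdWord K w ∈ chainsIn K A := by
  induction w with
  | nil => exact Submodule.zero_mem _
  | cons x w ih =>
    have h : ∀ y ∈ w, y ∈ A := fun y hy => hw y (List.mem_cons_of_mem _ hy)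
    exact Submodule.sub_mem _ (single_mem_chainsIn h 1)
      (cons_mem_chainsIn (hw x (List.mem_cons_self ..)) (ih h))

lemma prismWord_mem_chainsIn {A : Set X} {B : Set Y} {f g : X → Y}
    (hf : ∀ x ∈ A, f x ∈ B) (hg : ∀ x ∈ A, g x ∈ B) {w : List X} (hw : ∀ x ∈ w, x ∈ A) :
    prismWord K f g w ∈ chainsIn K B := by
  induction w with
  | nil => exact Submodule.zero_mem _
  | cons x w ih =>
    have h : ∀ y ∈ w, y ∈ A := fun y hy => hw y (List.mem_cons_of_mem _ hy)
    have hx := hw x (List.mem_cons_self ..)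
    refine Submodule.sub_mem _ (single_mem_chainsIn ?_ 1) (cons_mem_chainsIn (hf x hx) (ih h))
    intro y hy
    rcases List.mem_cons.1 hy with rfl | hy
    · exact hf x hx
    rcases List.mem_cons.1 hy with rfl | hy
    · exact hg x hx
    obtain ⟨z, hz, rfl⟩ := List.mem_map.1 hy
    exact hg z (h z hz)

end Support

section Small

variable {K : Type*} [CommRing K] {X : Type*} [PseudoMetricSpace X]

/-- Words whose letters are pairwise at distance less than `ε`. -/
def SmallWord (ε : ℝ) (w : List X) : Prop := ∀ x ∈ w, ∀ y ∈ w, dist x y < ε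

/-- The chains supported on words with pairwise `ε`-close letters. -/
def small (K : Type*) [CommRing K] (X : Type*) [PseudoMetricSpace X] (ε : ℝ) :
    Submodule K (Chain K X) :=
  Finsupp.supported K K {w | SmallWord ε w}

lemma chainsIn_le_small {A : Set X} {ε : ℝ} (hA : ∀ x ∈ A, ∀ y ∈ A, dist x y < ε) :
    chainsIn K A ≤ small K X ε :=
  Finsupp.supported_mono fun _ hw x hx y hy => hA x (hw x hx) y (hw y hy)

lemma bd_mem_small {ε : ℝ} {c : Chain K X} (hc : c ∈ small K X ε) : bd c ∈ small K X ε := by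
  refine map_mem_of_mem_supported bd _ (fun w hw => ?_) hc
  have : bd (Finsupp.single w (1 : K)) = bdWord K w := by simp [bd]
  rw [this]
  exact chainsIn_le_small (A := {x | x ∈ w}) hw (bdWord_mem_chainsIn fun x hx => hx)

lemma mapC_mem_small {f : X → X} (hf : ∀ x y, dist (f x) (f y) = dist x y) {ε : ℝ}
    {c : Chain K X} (hc : c ∈ small K X ε) : mapC f c ∈ small K X ε := by
  refine map_mem_of_mem_supported (mapC f) _ (fun w hw => ?_) hc
  rw [mapC_single]
  refine Finsupp.single_mem_supported K 1 fun x hx y hy => ?_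
  obtain ⟨x', hx', rfl⟩ := List.mem_map.1 hx
  obtain ⟨y', hy', rfl⟩ := List.mem_map.1 hy
  rw [hf]
  exact hw x' hx' y' hy'

lemma prism_mem_small {f g : X → X} {ε η : ℝ} (hη : 0 ≤ η)
    (hf : ∀ x y, dist (f x) (f y) = dist x y) (hg : ∀ x y, dist (g x) (g y) = dist x y)
    (hfg : ∀ x, dist (f x) (g x) ≤ η) {c : Chain K X} (hc : c ∈ small K X ε) :
    prism f g c ∈ small K X (ε + η) := by
  refine map_mem_of_mem_supported (prism f g) _ (fun w hw => ?_) hc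
  rw [prism_single, one_smul]
  refine chainsIn_le_small (A := {y | ∃ x ∈ w, y = f x ∨ y = g x}) ?_
    (prismWord_mem_chainsIn (A := {x | x ∈ w}) (B := {y | ∃ x ∈ w, y = f x ∨ y = g x})
      (fun x (hx : x ∈ w) => ⟨x, hx, Or.inl rfl⟩)
      (fun x (hx : x ∈ w) => ⟨x, hx, Or.inr rfl⟩) (fun x hx => hx))
  rintro _ ⟨x, hx, h⟩ _ ⟨y, hy, h'⟩
  have h1 := hw x hx y hy
  have h2 := hf x y
  have h3 := hg x y
  have h4 := hfg x
  have h5 := hfg y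
  have h6 := dist_triangle (f x) (f y) (g y)
  have h7 := dist_triangle (g x) (g y) (f y)
  rw [dist_comm (g y)] at h7
  rcases h with rfl | rfl <;> rcases h' with rfl | rfl <;> linarith

lemma exists_slack {ε : ℝ} (hε : 0 < ε) {c : Chain K X} (hc : c ∈ small K X ε) :
    ∃ ε' < ε, c ∈ small K X ε' := by
  have hfin : ∀ s : Finset (List X × X × X),
      (∀ q ∈ s, dist q.2.1 q.2.2 < ε) → ∃ ε' < ε, ∀ q ∈ s, dist q.2.1 q.2.2 < ε' := by
    intro s hs
    classical
    induction s using Finset.induction_on with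
    | empty => exact ⟨0, hε, by simp⟩
    | insert a s _ ih =>
      obtain ⟨e, he, h⟩ := ih fun q hq => hs q (Finset.mem_insert_of_mem hq)
      obtain ⟨e', h1, h2⟩ := exists_between (hs a (Finset.mem_insert_self ..))
      refine ⟨max e e', max_lt he h2, fun q hq => ?_⟩
      rcases Finset.mem_insert.1 hq with rfl | hq
      · exact lt_max_of_lt_right h1
      · exact lt_max_of_lt_left (h q hq)
  classical
  obtain ⟨e, he, h⟩ := hfin (c.support.biUnion fun w =>
      (w.toFinset ×ˢ w.toFinset).image fun q => (w, q)) (by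
    intro q hq
    simp only [Finset.mem_biUnion, Finset.mem_image, Finset.mem_product, List.mem_toFinset] at hq
    obtain ⟨w, hw, q, ⟨h1, h2⟩, rfl⟩ := hq
    exact (Finsupp.mem_supported K c).1 hc hw _ h1 _ h2)
  refine ⟨e, he, (Finsupp.mem_supported K c).2 fun w hw x hx y hy => h (w, x, y) ?_⟩
  simp only [Finset.mem_biUnion, Finset.mem_image, Finset.mem_product, List.mem_toFinset]
  exact ⟨w, hw, (x, y), ⟨hx, hy⟩, rfl⟩

end Small

/-- Any two points are joined by chains of arbitrarily small steps. -/
def ChainConnected (X : Type*) [PseudoMetricSpace X] : Prop :=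
  ∀ ε > 0, ∀ x y : X, Relation.ReflTransGen (fun a b => dist a b < ε) x y

section Translation

variable {K : Type*} [CommRing K] {H : Type*} [Group H]

/-- Right translation of chains on a group. -/
noncomputable def rt (u : H) : Chain K H →ₗ[K] Chain K H := mapC (· * u)

lemma rt_rt (u v : H) (c : Chain K H) : rt v (rt u c) = rt (u * v) c := by
  rw [rt, rt, mapC_mapC]
  congr 2
  funext x
  simp [mul_assoc]

lemma rt_one (c : Chain K H) : rt 1 c = c := by
  have : (fun x : H => x * 1) = id := by funext x; simp
  rw [rt, this, mapC_id]

lemma bd_rt (u : H) (c : Chain K H) : bd (rt u c) = rt u (bd c) := bd_mapC _ c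

lemma rt_single_nil (u : H) (k : K) :
    rt u (Finsupp.single ([] : List H) k) = Finsupp.single [] k := by
  simp [rt]

variable [PseudoMetricSpace H] [IsIsometricSMul Hᵐᵒᵖ H]

lemma rt_mem_small (u : H) {ε : ℝ} {c : Chain K H} (hc : c ∈ small K H ε) :
    rt u c ∈ small K H ε :=
  mapC_mem_small (fun x y => dist_mul_right x y u) hc

lemma exists_bd_eq_rt_sub [IsIsometricSMul H H] (hH : ChainConnected H) {ε : ℝ} (hε : 0 < ε)
    {z : Chain K H}
    (hz : z ∈ small K H ε)
    (hz' : ∀ u v : H, prism (· * u) (· * v) (bd z) = 0) (u : H) :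
    ∃ b ∈ small K H ε, bd b = rt u z - z := by
  obtain ⟨ε', hε', hz1⟩ := exists_slack hε hz
  have h := hH (ε - ε') (by linarith) 1 u
  induction h with
  | refl => exact ⟨0, Submodule.zero_mem _, by simp [rt_one]⟩
  | @tail v w _ hvw ih =>
    obtain ⟨b, hb, hb'⟩ := ih
    refine ⟨b + prism (· * v) (· * w) z, Submodule.add_mem _ hb ?_, ?_⟩
    · have := prism_mem_small (f := (· * v)) (g := (· * w)) (η := ε - ε') (by linarith)
        (fun x y => dist_mul_right x y v) (fun x y => dist_mul_right x y w)
        (fun x => by rw [dist_mul_left]; exact hvw.le) hz1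
      rwa [add_sub_cancel] at this
    · have := bd_prism_add (· * v) (· * w) z
      rw [hz' v w, add_zero] at this
      rw [map_add, hb', this, rt, rt]
      abel

end Translation

section Total

variable {K : Type*} [CommRing K] {H : Type*} [Group H]

/-- The norm (even columns) and the difference (odd columns) of the cyclic resolution of the
group generated by `γ`. -/
noncomputable def horiz (p : ℕ) (γ : H) (s : ℕ) : Chain K H →ₗ[K] Chain K H :=
  if Even s then ∑ i ∈ Finset.range p, rt (γ ^ i) else rt γ - LinearMap.id

/-- The total differential of the double complex with columns indexed by `ℕ`. -/
noncomputable def totalD (p : ℕ) (γ : H) : (ℕ → Chain K H) →ₗ[K] (ℕ → Chain K H) :=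
  LinearMap.pi fun s =>
    ((-1 : K) ^ s) • (bd ∘ₗ LinearMap.proj s) + horiz p γ (s + 1) ∘ₗ LinearMap.proj (s + 1)

lemma totalD_apply (p : ℕ) (γ : H) (Z : ℕ → Chain K H) (s : ℕ) :
    totalD p γ Z s = (-1 : K) ^ s • bd (Z s) + horiz p γ (s + 1) (Z (s + 1)) := rfl

/-- The action of an element `ν` normalizing `γ` on column `s`. -/
noncomputable def twist (γ ν : H) (a s : ℕ) : Chain K H →ₗ[K] Chain K H :=
  if Even s then (a : K) ^ (s / 2) • rt ν
  else (a : K) ^ (s / 2) • ∑ k ∈ Finset.range a, rt (ν * γ ^ k)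

/-- The eigenvalue of `twist` on the homology of column `s`. -/
def twistEigenvalue (K : Type*) [CommRing K] (a s : ℕ) : K := (a : K) ^ ((s + 1) / 2)

/-- Apply `twist` minus a scalar in every column. -/
noncomputable def twistSub (γ ν : H) (a : ℕ) (l : K) : (ℕ → Chain K H) →ₗ[K] (ℕ → Chain K H) :=
  LinearMap.pi fun s => (twist γ ν a s - l • LinearMap.id) ∘ₗ LinearMap.proj s

lemma twistSub_apply (γ ν : H) (a : ℕ) (l : K) (Z : ℕ → Chain K H) (s : ℕ) :
    twistSub γ ν a l Z s = twist γ ν a s (Z s) - l • Z s := rfl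

lemma bd_horiz (p : ℕ) (γ : H) (s : ℕ) (c : Chain K H) :
    bd (horiz p γ s c) = horiz p γ s (bd c) := by
  unfold horiz
  split_ifs
  · simp [LinearMap.sum_apply, bd_rt]
  · simp [bd_rt]

lemma bd_twist (γ ν : H) (a s : ℕ) (c : Chain K H) :
    bd (twist γ ν a s c) = twist γ ν a s (bd c) := by
  unfold twist
  split_ifs
  · simp [bd_rt]
  · simp [LinearMap.sum_apply, bd_rt]

lemma sum_range_natCast {p : ℕ} [NeZero p] {M : Type*} [AddCommMonoid M] (F : ZMod p → M) :
    ∑ i ∈ Finset.range p, F i = ∑ x, F x :=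
  Finset.sum_nbij' (fun i => (i : ZMod p)) ZMod.val (by simp)
    (fun x _ => by simpa using ZMod.val_lt x)
    (fun i hi => ZMod.val_cast_of_lt (Finset.mem_range.1 hi)) (by simp) (by simp)

lemma sum_rt_pow_affine {p : ℕ} [Fact p.Prime] {γ : H} (hγ : γ ^ p = 1) {a : ℕ}
    (ha : (a : ZMod p) ≠ 0) (c : Chain K H) (u : H) (k : ℕ) :
    ∑ i ∈ Finset.range p, rt (u * γ ^ (a * i + k)) c
      = ∑ i ∈ Finset.range p, rt (u * γ ^ i) c := by
  have hF : ∀ n : ℕ, rt (u * γ ^ n) c = rt (u * γ ^ (n : ZMod p).val) c := fun n => by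
    rw [ZMod.val_natCast, ← pow_eq_pow_mod n hγ]
  rw [Finset.sum_congr rfl fun i _ => hF (a * i + k), Finset.sum_congr rfl fun i _ => hF i,
    sum_range_natCast fun x : ZMod p => rt (u * γ ^ x.val) c]
  push_cast
  rw [sum_range_natCast fun x : ZMod p => rt (u * γ ^ ((a : ZMod p) * x + k).val) c]
  exact Function.Bijective.sum_comp
    ((Equiv.addRight (k : ZMod p)).bijective.comp (mulLeft_bijective₀ _ ha))
    fun x : ZMod p => rt (u * γ ^ x.val) c

lemma horiz_horiz {p : ℕ} [Fact p.Prime] {γ : H} (hγ : γ ^ p = 1) (s : ℕ) (c : Chain K H) :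
    horiz p γ s (horiz p γ (s + 1) c) = 0 := by
  have h := sum_rt_pow_affine hγ (a := 1) (by simp) c 1 1
  simp only [one_mul] at h
  unfold horiz
  by_cases hs : Even s
  · have hs' : ¬ Even (s + 1) := by simpa [Nat.even_add_one] using hs
    rw [if_pos hs, if_neg hs']
    simp only [LinearMap.sum_apply, LinearMap.sub_apply, LinearMap.id_apply, map_sub, rt_rt]
    rw [sub_eq_zero, ← h]
    refine Finset.sum_congr rfl fun i _ => ?_
    rw [pow_succ' γ]
  · have hs' : Even (s + 1) := by simpa [Nat.even_add_one] using hs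
    rw [if_neg hs, if_pos hs']
    simp only [LinearMap.sum_apply, LinearMap.sub_apply, LinearMap.id_apply, map_sum, rt_rt]
    rw [Finset.sum_sub_distrib, sub_eq_zero, ← h]
    refine Finset.sum_congr rfl fun i _ => ?_
    rw [pow_succ γ]

lemma totalD_totalD {p : ℕ} [Fact p.Prime] {γ : H} (hγ : γ ^ p = 1) (Z : ℕ → Chain K H) :
    totalD p γ (totalD p γ Z) = 0 := by
  funext s
  simp only [totalD_apply, map_add, map_smul, bd_bd, bd_horiz, horiz_horiz hγ, pow_succ]
  simp

lemma horiz_twist {p : ℕ} [Fact p.Prime] {γ ν : H} (hγ : γ ^ p = 1) {a : ℕ}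
    (ha : (a : ZMod p) ≠ 0) (hν : γ * ν = ν * γ ^ a) (s : ℕ) (c : Chain K H) :
    horiz p γ (s + 1) (twist γ ν a (s + 1) c) = twist γ ν a s (horiz p γ (s + 1) c) := by
  have hν' : ∀ i : ℕ, γ ^ i * ν = ν * γ ^ (a * i) := by
    intro i
    induction i with
    | zero => simp
    | succ i ih => rw [pow_succ, mul_assoc, hν, ← mul_assoc, ih, mul_assoc, ← pow_add]; ring_nf
  unfold horiz twist
  by_cases hs : Even s
  · obtain ⟨i, rfl⟩ := hs
    have hs' : ¬ Even (i + i + 1) := by simp [Nat.even_add_one]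
    have hs2 : Even (i + i) := ⟨i, rfl⟩
    rw [if_neg hs', if_neg hs', if_pos hs2, show (i + i + 1) / 2 = i by omega,
      show (i + i) / 2 = i by omega]
    simp only [LinearMap.sum_apply, LinearMap.sub_apply, LinearMap.id_apply, map_sub,
      map_sum, map_smul, LinearMap.smul_apply, rt_rt, ← smul_sub, mul_assoc, ← pow_succ]
    congr 1
    rw [hν, Finset.sum_range_sub (fun k => rt (ν * γ ^ k) c)]
    simp
  · have hs1 : Even (s + 1) := by simpa [Nat.even_add_one] using hs
    obtain ⟨i, rfl⟩ := Nat.not_even_iff_odd.1 hs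
    rw [if_pos hs1, if_pos hs1, if_neg hs, show (2 * i + 1 + 1) / 2 = i + 1 by omega,
      show (2 * i + 1) / 2 = i by omega]
    simp only [LinearMap.sum_apply, map_sum, map_smul, LinearMap.smul_apply, rt_rt,
      ← Finset.smul_sum, pow_succ, mul_smul]
    congr 1
    simp only [← mul_assoc, hν']
    simp only [mul_assoc, ← pow_add]
    rw [Finset.sum_comm, Finset.sum_congr rfl fun k _ => sum_rt_pow_affine hγ ha c ν k]
    simp [Nat.cast_smul_eq_nsmul]

lemma twistSub_totalD {p : ℕ} [Fact p.Prime] {γ ν : H} (hγ : γ ^ p = 1) {a : ℕ}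
    (ha : (a : ZMod p) ≠ 0) (hν : γ * ν = ν * γ ^ a) (l : K) (Z : ℕ → Chain K H) :
    totalD p γ (twistSub γ ν a l Z) = twistSub γ ν a l (totalD p γ Z) := by
  funext s
  simp only [totalD_apply, twistSub_apply, map_add, map_sub, map_smul, horiz_twist hγ ha hν,
    bd_twist]
  module

/-- Composition of the operators `twistSub` for the eigenvalues of the columns below `k`. -/
noncomputable def twistProd (γ ν : H) (a : ℕ) : ℕ → (ℕ → Chain K H) →ₗ[K] (ℕ → Chain K H)
  | 0 => LinearMap.id
  | k + 1 => twistProd γ ν a k ∘ₗ twistSub γ ν a (twistEigenvalue K a k)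

lemma twistProd_totalD {p : ℕ} [Fact p.Prime] {γ ν : H} (hγ : γ ^ p = 1) {a : ℕ}
    (ha : (a : ZMod p) ≠ 0) (hν : γ * ν = ν * γ ^ a) (k : ℕ) (Z : ℕ → Chain K H) :
    totalD p γ (twistProd γ ν a k Z) = twistProd γ ν a k (totalD p γ Z) := by
  induction k generalizing Z with
  | zero => rfl
  | succ k ih =>
    rw [twistProd, LinearMap.comp_apply, LinearMap.comp_apply, ih, twistSub_totalD hγ ha hν]

lemma twistProd_apply_eq_zero (γ ν : H) (a k : ℕ) {Z : ℕ → Chain K H} {s : ℕ} (h : Z s = 0) :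
    twistProd γ ν a k Z s = 0 := by
  induction k generalizing Z with
  | zero => exact h
  | succ k ih => exact ih (by rw [twistSub_apply, h, map_zero, smul_zero, sub_zero])

variable [PseudoMetricSpace H] [IsIsometricSMul Hᵐᵒᵖ H]

lemma horiz_mem_small (p : ℕ) (γ : H) (s : ℕ) {ε : ℝ} {c : Chain K H} (hc : c ∈ small K H ε) :
    horiz p γ s c ∈ small K H ε := by
  unfold horiz
  split_ifs
  · rw [LinearMap.sum_apply]
    exact Submodule.sum_mem _ fun i _ => rt_mem_small _ hc
  · exact Submodule.sub_mem _ (rt_mem_small _ hc) hc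

lemma twist_mem_small (γ ν : H) (a s : ℕ) {ε : ℝ} {c : Chain K H} (hc : c ∈ small K H ε) :
    twist γ ν a s c ∈ small K H ε := by
  unfold twist
  split_ifs
  · exact Submodule.smul_mem _ _ (rt_mem_small _ hc)
  · rw [LinearMap.smul_apply, LinearMap.sum_apply]
    exact Submodule.smul_mem _ _ (Submodule.sum_mem _ fun i _ => rt_mem_small _ hc)

lemma totalD_mem_small (p : ℕ) (γ : H) {ε : ℝ} {Z : ℕ → Chain K H}
    (hZ : ∀ s, Z s ∈ small K H ε) (s : ℕ) : totalD p γ Z s ∈ small K H ε :=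
  Submodule.add_mem _ (Submodule.smul_mem _ _ (bd_mem_small (hZ s)))
    (horiz_mem_small _ _ _ (hZ _))

lemma twistSub_mem_small (γ ν : H) (a : ℕ) (l : K) {ε : ℝ} {Z : ℕ → Chain K H}
    (hZ : ∀ s, Z s ∈ small K H ε) (s : ℕ) : twistSub γ ν a l Z s ∈ small K H ε :=
  Submodule.sub_mem _ (twist_mem_small _ _ _ _ (hZ s)) (Submodule.smul_mem _ _ (hZ s))

lemma twistProd_mem_small (γ ν : H) (a k : ℕ) {ε : ℝ} {Z : ℕ → Chain K H}
    (hZ : ∀ s, Z s ∈ small K H ε) (s : ℕ) : twistProd γ ν a k Z s ∈ small K H ε := by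
  induction k generalizing Z with
  | zero => exact hZ s
  | succ k ih => exact ih (twistSub_mem_small γ ν a _ hZ)

lemma exists_bd_eq_twist_sub [IsIsometricSMul H H] (hH : ChainConnected H) {ε : ℝ} (hε : 0 < ε)
    (γ ν : H) (a s : ℕ) {z : Chain K H} (hz : z ∈ small K H ε) (hz' : bd z = 0) :
    ∃ b ∈ small K H ε, bd b = twist γ ν a s z - twistEigenvalue K a s • z := by
  have h := fun u => exists_bd_eq_rt_sub hH hε hz (fun _ _ => by simp [hz']) u
  choose b hb hb' using h
  by_cases hs : Even s
  · refine ⟨(a : K) ^ (s / 2) • b ν, Submodule.smul_mem _ _ (hb ν), ?_⟩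
    rw [map_smul, hb', twist, if_pos hs, twistEigenvalue,
      show (s + 1) / 2 = s / 2 by obtain ⟨i, rfl⟩ := hs; omega, smul_sub]
    rfl
  · refine ⟨(a : K) ^ (s / 2) • ∑ k ∈ Finset.range a, b (ν * γ ^ k),
      Submodule.smul_mem _ _ (Submodule.sum_mem _ fun k _ => hb _), ?_⟩
    rw [map_smul, map_sum, Finset.sum_congr rfl fun k _ => hb' (ν * γ ^ k), twist, if_neg hs,
      twistEigenvalue, show (s + 1) / 2 = s / 2 + 1 by
        obtain ⟨i, rfl⟩ := Nat.not_even_iff_odd.1 hs; omega, Finset.sum_sub_distrib, smul_sub,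
      LinearMap.smul_apply, LinearMap.sum_apply, pow_succ, mul_smul]
    simp [Nat.cast_smul_eq_nsmul]

lemma exists_totalD_eq_twistProd [IsIsometricSMul H H] (hH : ChainConnected H) {ε : ℝ}
    (hε : 0 < ε) {p : ℕ} [Fact p.Prime] {γ ν : H} (hγ : γ ^ p = 1) {a : ℕ}
    (ha : (a : ZMod p) ≠ 0) (hν : γ * ν = ν * γ ^ a) (k : ℕ) {Z : ℕ → Chain K H}
    (hZ : ∀ s, Z s ∈ small K H ε) (hk : ∀ s, k ≤ s → Z s = 0) (hD : totalD p γ Z = 0) :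
    ∃ y : ℕ → Chain K H, (∀ s, y s ∈ small K H ε) ∧ (∀ s, k ≤ s → y s = 0) ∧
      totalD p γ y = twistProd γ ν a k Z := by
  induction k generalizing Z with
  | zero =>
    refine ⟨0, fun s => Submodule.zero_mem _, fun s _ => rfl, ?_⟩
    have : Z = 0 := funext fun s => hk s (Nat.zero_le s)
    rw [this, map_zero, map_zero]
  | succ k ih =>
    have hbd : bd (Z k) = 0 := by
      have := congrFun hD k
      rw [totalD_apply, hk (k + 1) le_rfl, map_zero, add_zero, Pi.zero_apply] at this
      have h2 := congrArg (fun c => (-1 : K) ^ k • c) this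
      simpa [smul_smul, ← mul_pow] using h2
    obtain ⟨b, hb, hb'⟩ := exists_bd_eq_twist_sub hH hε γ ν a k (hZ k) hbd
    set y₀ : ℕ → Chain K H := Pi.single k ((-1 : K) ^ k • b) with hy₀
    have hy₀s : ∀ s, y₀ s ∈ small K H ε := by
      intro s
      by_cases hs : s = k
      · subst hs
        simpa [hy₀] using Submodule.smul_mem _ _ hb
      · simp [hy₀, hs]
    obtain ⟨y, hy, hyk, hy'⟩ := ih (Z := twistSub γ ν a (twistEigenvalue K a k) Z - totalD p γ y₀)
      (fun s => Submodule.sub_mem _ (twistSub_mem_small _ _ _ _ hZ s)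
        (totalD_mem_small _ _ hy₀s s)) (by
        intro s hs
        rw [Pi.sub_apply, twistSub_apply, totalD_apply]
        rcases hs.eq_or_lt with rfl | hs
        · simp [hy₀, smul_smul, ← mul_pow, hb']
        · simp [hy₀, hk s hs, hs.ne', (hs.trans (Nat.lt_succ_self s)).ne'])
      (by rw [map_sub, totalD_totalD hγ, twistSub_totalD hγ ha hν, hD, map_zero, sub_zero])
    refine ⟨y + twistProd γ ν a k y₀,
      fun s => Submodule.add_mem _ (hy s) (twistProd_mem_small _ _ _ _ hy₀s s), fun s hs => ?_, ?_⟩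
    · rw [Pi.add_apply, hyk s (by omega), twistProd_apply_eq_zero _ _ _ _
        (by rw [hy₀, Pi.single_eq_of_ne (by omega)]), add_zero]
    rw [map_add, hy', twistProd_totalD hγ ha hν, map_sub, sub_add_cancel]
    rfl

end Total

section TotalCycle

variable {H : Type*} [Group H] {p : ℕ} [Fact p.Prime]

lemma exists_twistProd_single_nil (γ ν : H) {a r : ℕ}
    (har : ∀ k < r, (a : ZMod p) ^ r ≠ (a : ZMod p) ^ k) (k : ℕ) (hk : k < 2 * r) {x : ZMod p}
    (hx : x ≠ 0) :
    ∃ y : ZMod p, y ≠ 0 ∧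
      twistProd γ ν a k (Pi.single (2 * r) (Finsupp.single ([] : List H) x))
        = Pi.single (2 * r) (Finsupp.single [] y) := by
  induction k generalizing x with
  | zero => exact ⟨x, hx, rfl⟩
  | succ k ih =>
    obtain ⟨y, hy, h⟩ := ih (by omega)
      (x := ((a : ZMod p) ^ r - (a : ZMod p) ^ ((k + 1) / 2)) * x)
      (mul_ne_zero (sub_ne_zero.2 (har _ (by omega))) hx)
    refine ⟨y, hy, ?_⟩
    rw [← h, twistProd, LinearMap.comp_apply]
    congr 1
    funext s
    rw [twistSub_apply]
    by_cases hs : s = 2 * r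
    · subst hs
      have he : Even (2 * r) := even_two_mul r
      simp [twist, he, twistEigenvalue, rt_single_nil, sub_mul]
    · simp [hs]

theorem exists_total_cycle [PseudoMetricSpace H] [IsIsometricSMul Hᵐᵒᵖ H] [IsIsometricSMul H H]
    (hH : ChainConnected H) {ε : ℝ} (hε : 0 < ε) {γ ν : H} (hγ : γ ^ p = 1) {a r : ℕ}
    (ha : (a : ZMod p) ≠ 0) (hν : γ * ν = ν * γ ^ a) (hr : 0 < r)
    (har : ∀ k < r, (a : ZMod p) ^ r ≠ (a : ZMod p) ^ k) :
    ∃ T : ℕ → Chain (ZMod p) H, (∀ s, T s ∈ small (ZMod p) H ε) ∧ T (2 * r + 1) = 0 ∧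
      ∃ y : ZMod p, y ≠ 0 ∧ totalD p γ T = Pi.single (2 * r) (Finsupp.single [] y) := by
  obtain ⟨m, hm⟩ : ∃ m, 2 * r = m + 2 := ⟨2 * r - 2, by omega⟩
  have hme : Even (m + 2) := hm ▸ even_two_mul r
  have hmo : ¬ Even (m + 1) := Nat.even_add_one.1 hme
  set c : Chain (ZMod p) H := Finsupp.single [1] 1 with hc
  have hcs : c ∈ small (ZMod p) H ε :=
    Finsupp.single_mem_supported _ _ (by intro x hx y hy; simp_all)
  have hcb : bd c = Finsupp.single [] 1 := by
    rw [hc, ← cons_single, bd_cons]; simp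
  have h := fun u => exists_bd_eq_rt_sub hH hε hcs (fun _ _ => by simp [hcb]) u
  choose b hb hb' using h
  set B := ∑ i ∈ Finset.range p, b (γ ^ i) with hB
  have hBs : B ∈ small (ZMod p) H ε := Submodule.sum_mem _ fun i _ => hb _
  have hBb : bd B = horiz p γ (m + 2) c := by
    rw [hB, map_sum, Finset.sum_congr rfl fun i _ => hb' _, Finset.sum_sub_distrib, horiz,
      if_pos hme, LinearMap.sum_apply, Finset.sum_const, Finset.card_range,
      ← Nat.cast_smul_eq_nsmul (ZMod p)]
    simp
  set W : ℕ → Chain (ZMod p) H := Pi.single (m + 2) c + Pi.single (m + 1) B with hW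
  have hWs : ∀ s, W s ∈ small (ZMod p) H ε := by
    intro s
    rw [hW]
    refine Submodule.add_mem _ ?_ ?_
    · by_cases hs : s = m + 2
      · subst hs; simpa using hcs
      · simp [hs]
    · by_cases hs : s = m + 1
      · subst hs; simpa using hBs
      · simp [hs]
  set e : ℕ → Chain (ZMod p) H := Pi.single (2 * r) (Finsupp.single [] 1) with he
  have hes : ∀ s, e s ∈ small (ZMod p) H ε := by
    intro s
    by_cases hs : s = 2 * r
    · subst hs
      rw [he, Pi.single_eq_same]
      exact Finsupp.single_mem_supported _ _ (by intro x hx; simp at hx)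
    · simp [he, hs]
  have hDe : totalD p γ e = 0 := by
    funext s
    rw [totalD_apply, he]
    by_cases hs : s + 1 = 2 * r
    · have h1 : s ≠ 2 * r := by omega
      have h2 : Even (2 * r) := even_two_mul r
      rw [hs]
      simp [h1, horiz, h2, LinearMap.sum_apply, rt_single_nil]
    · by_cases h1 : s = 2 * r
      · subst h1; simp
      · simp [hs, h1]
  have hpar : (-1 : ZMod p) ^ (m + 1) = -1 :=
    Odd.neg_one_pow (Nat.not_even_iff_odd.1 hmo)
  obtain ⟨y, hy, hyk, hy'⟩ := exists_totalD_eq_twistProd hH hε hγ ha hν (m + 1)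
    (Z := totalD p γ W - e) (fun s => Submodule.sub_mem _ (totalD_mem_small _ _ hWs s) (hes s))
    (by
      intro s hs
      rw [Pi.sub_apply, totalD_apply, hW, he, hm]
      rcases hs.eq_or_lt with rfl | hs
      · simp [hpar, hBb]
      rcases (Nat.succ_le_of_lt hs).eq_or_lt with rfl | hs
      · simp [hcb, hme.neg_one_pow]
      · have h1 : s ≠ m + 2 := by simp at hs; omega
        have h2 : s ≠ m + 1 := by simp at hs; omega
        have h3 : s ≠ m := by simp at hs; omega
        simp [h1, h2, h3])
    (by rw [map_sub, totalD_totalD hγ, hDe, sub_zero])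
  obtain ⟨x, hx, hx'⟩ := exists_twistProd_single_nil γ ν har (m + 1) (by omega) one_ne_zero
  refine ⟨twistProd γ ν a (m + 1) W - y,
    fun s => Submodule.sub_mem _ (twistProd_mem_small _ _ _ _ hWs s) (hy s), ?_, x, hx, ?_⟩
  · rw [Pi.sub_apply, hyk _ (by omega), twistProd_apply_eq_zero _ _ _ _ (by simp [hW, hm]),
      sub_zero]
  rw [map_sub, hy', twistProd_totalD hγ ha hν, map_sub, sub_sub_cancel, hx']

end TotalCycle

section Exterior

variable {p : ℕ} [Fact p.Prime]

/-- The exterior algebra on generators indexed by `ZMod p`, over the field `ZMod p`. -/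
abbrev Ext (p : ℕ) := ExteriorAlgebra (ZMod p) (ZMod p → ZMod p)

/-- The generators of `Ext p`. -/
noncomputable def gen (k : ZMod p) : Ext p := ExteriorAlgebra.ι (ZMod p) (Pi.single k 1)

/-- The derivation of `Ext p` sending every generator to `1`. -/
noncomputable def dE : Ext p →ₗ[ZMod p] Ext p :=
  CliffordAlgebra.contractLeft (Q := 0) (∑ k : ZMod p, LinearMap.proj k)

lemma dE_ι_mul (v : ZMod p → ZMod p) (x : Ext p) :
    dE (ExteriorAlgebra.ι (ZMod p) v * x)
      = (∑ k, v k) • x - ExteriorAlgebra.ι (ZMod p) v * dE x := by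
  rw [dE, ExteriorAlgebra.ι, CliffordAlgebra.contractLeft_ι_mul]
  simp [LinearMap.sum_apply]

lemma dE_one : dE (1 : Ext p) = 0 :=
  CliffordAlgebra.contractLeft_one _ _

lemma dE_gen_mul (k : ZMod p) (x : Ext p) : dE (gen k * x) = x - gen k * dE x := by
  rw [gen, dE_ι_mul]
  simp

/-- The cyclic shift of the generators of `Ext p`. -/
noncomputable def shiftE : Ext p →ₐ[ZMod p] Ext p :=
  ExteriorAlgebra.map (LinearMap.funLeft (ZMod p) (ZMod p) (· + 1))

lemma shiftE_gen (k : ZMod p) : shiftE (gen k) = gen (k - 1) := by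
  rw [gen, shiftE, ExteriorAlgebra.map_apply_ι, gen]
  congr 1
  funext x
  rw [LinearMap.funLeft_apply, Pi.single_apply, Pi.single_apply]
  simp [eq_sub_iff_add_eq]

/-- The determinant as an alternating map in `n` variables, zero unless `n = p`. -/
noncomputable def topForm (p : ℕ) [Fact p.Prime] (n : ℕ) :
    (ZMod p → ZMod p) [⋀^Fin n]→ₗ[ZMod p] ZMod p :=
  if h : Fintype.card (ZMod p) = n then
    (Pi.basisFun (ZMod p) (ZMod p)).det.domDomCongr (Fintype.equivFinOfCardEq h)
  else 0

/-- The top-degree coefficient of an element of `Ext p`. -/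
noncomputable def top : Ext p →ₗ[ZMod p] ZMod p :=
  ExteriorAlgebra.liftAlternating (topForm p)

lemma top_ιMulti {n : ℕ} (v : Fin n → ZMod p → ZMod p) :
    top (ExteriorAlgebra.ιMulti (ZMod p) n v) = topForm p n v :=
  ExteriorAlgebra.liftAlternating_apply_ιMulti _ _

lemma topForm_of_ne {n : ℕ} (h : n ≠ p) : topForm p n = 0 := by
  rw [topForm, dif_neg (by rw [ZMod.card]; exact h.symm)]

lemma prod_map_ι_eq_ιMulti (l : List (ZMod p → ZMod p)) :
    (l.map (ExteriorAlgebra.ι (ZMod p))).prod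
      = ExteriorAlgebra.ιMulti (ZMod p) l.length l.get := by
  rw [ExteriorAlgebra.ιMulti_apply]
  congr 1
  conv_lhs => rw [← List.ofFn_get l]
  rw [List.map_ofFn]
  rfl

lemma dE_prod_mem (l : List (ZMod p → ZMod p)) :
    dE (l.map (ExteriorAlgebra.ι (ZMod p))).prod ∈ Submodule.span (ZMod p)
      {x : Ext p | ∃ l' : List (ZMod p → ZMod p), l'.length + 1 = l.length ∧
        (l'.map (ExteriorAlgebra.ι (ZMod p))).prod = x} := by
  induction l with
  | nil =>
    simp [dE_one]
  | cons v l ih =>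
    rw [List.map_cons, List.prod_cons, dE_ι_mul]
    refine Submodule.sub_mem _ (Submodule.smul_mem _ _ (Submodule.subset_span ⟨l, rfl, rfl⟩)) ?_
    have := Submodule.mem_map_of_mem (f := LinearMap.mulLeft (ZMod p)
      (ExteriorAlgebra.ι (ZMod p) v)) ih
    rw [Submodule.map_span, LinearMap.mulLeft_apply] at this
    refine Submodule.span_mono ?_ this
    rintro _ ⟨_, ⟨l', hl', rfl⟩, rfl⟩
    exact ⟨v :: l', by simp [hl'], by simp⟩

lemma top_dE (x : Ext p) : top (dE x) = 0 := by
  suffices h : top ∘ₗ dE = (0 : Ext p →ₗ[ZMod p] ZMod p) from LinearMap.congr_fun h x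
  refine ExteriorAlgebra.lhom_ext fun n => ?_
  ext v
  change top (dE (ExteriorAlgebra.ιMulti (ZMod p) n v)) = 0
  by_cases hn : n = p + 1
  · have : ExteriorAlgebra.ιMulti (ZMod p) n v = 0 := by
      refine AlternatingMap.map_linearDependent _ _ fun h => ?_
      have := h.fintype_card_le_finrank
      simp [hn, ZMod.card] at this
    rw [this, map_zero, map_zero]
  · obtain ⟨l, hl, hlv⟩ : ∃ l : List (ZMod p → ZMod p), l.length = n ∧
        (l.map (ExteriorAlgebra.ι (ZMod p))).prod = ExteriorAlgebra.ιMulti (ZMod p) n v :=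
      ⟨List.ofFn v, by simp, by rw [ExteriorAlgebra.ιMulti_apply, List.map_ofFn]; rfl⟩
    rw [← hlv]
    refine (Submodule.span_le (p := LinearMap.ker top)).2 ?_ (dE_prod_mem l)
    rintro _ ⟨l', hl', rfl⟩
    have hne : l'.length ≠ p := by omega
    rw [SetLike.mem_coe, LinearMap.mem_ker, prod_map_ι_eq_ιMulti, top_ιMulti, topForm_of_ne hne]
    rfl

lemma top_shiftE (x : Ext p) : top (shiftE x) = top x := by
  suffices h : top ∘ₗ shiftE.toLinearMap = (top : Ext p →ₗ[ZMod p] ZMod p) from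
    LinearMap.congr_fun h x
  refine ExteriorAlgebra.lhom_ext fun n => ?_
  ext v
  change top (shiftE (ExteriorAlgebra.ιMulti (ZMod p) n v))
    = top (ExteriorAlgebra.ιMulti (ZMod p) n v)
  rw [shiftE, ExteriorAlgebra.map_apply_ιMulti, top_ιMulti, top_ιMulti]
  by_cases hn : n = p
  · have hn' : Fintype.card (ZMod p) = n := by rw [ZMod.card, hn]
    rw [topForm, dif_pos hn', AlternatingMap.domDomCongr_apply, AlternatingMap.domDomCongr_apply]
    set f := LinearMap.funLeft (ZMod p) (ZMod p) (· + (1 : ZMod p)) with hf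
    have hfk : ∀ k : ℕ, f ^ k = LinearMap.funLeft (ZMod p) (ZMod p) (· + (k : ZMod p)) := by
      intro k
      induction k with
      | zero => ext; simp
      | succ k ih =>
        rw [pow_succ, ih]
        ext
        simp [hf, LinearMap.funLeft_apply, add_assoc]
    have hdet : LinearMap.det f = 1 := by
      have h1 : f ^ p = 1 := by rw [hfk]; ext; simp [LinearMap.funLeft_apply]
      rw [← ZMod.pow_card (LinearMap.det f), ← map_pow, h1, map_one]
    have := Module.Basis.det_comp (Pi.basisFun (ZMod p) (ZMod p)) f
      (fun i => v (Fintype.equivFinOfCardEq hn' i))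
    rw [hdet, one_mul] at this
    exact this
  · rw [topForm_of_ne hn]; rfl

/-- The evaluation of chains of words in the letters `ZMod p` in the exterior algebra. -/
noncomputable def wordE : Chain (ZMod p) (ZMod p) →ₗ[ZMod p] Ext p :=
  Finsupp.linearCombination (ZMod p) fun w => (w.map gen).prod

lemma wordE_single (w : List (ZMod p)) (k : ZMod p) :
    wordE (Finsupp.single w k) = k • (w.map gen).prod := by
  simp [wordE]

lemma wordE_cons (k : ZMod p) (c : Chain (ZMod p) (ZMod p)) :
    wordE (cons k c) = gen k * wordE c := by
  induction c using Finsupp.induction_linear with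
  | zero => simp
  | add c d hc hd => simp [hc, hd, mul_add]
  | single w k => simp [wordE_single]

lemma wordE_bd (c : Chain (ZMod p) (ZMod p)) : wordE (bd c) = dE (wordE c) := by
  induction c using Finsupp.induction_linear with
  | zero => simp
  | add c d hc hd => simp [hc, hd]
  | single w k =>
    induction w with
    | nil => simp [wordE_single, dE_one]
    | cons x w ih => rw [← cons_single, bd_cons, map_sub, wordE_cons, ih, wordE_cons, dE_gen_mul]

lemma wordE_shift (c : Chain (ZMod p) (ZMod p)) :
    wordE (mapC (· - 1) c) = shiftE (wordE c) := by
  induction c using Finsupp.induction_linear with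
  | zero => simp
  | add c d hc hd => simp [hc, hd]
  | single w k =>
    induction w with
    | nil => simp [wordE_single]
    | cons x w ih => rw [← cons_single, mapC_cons, wordE_cons, ih, wordE_cons, map_mul, shiftE_gen]

/-- Only words using all letters have a top-degree component. -/
lemma mem_of_top_wordE_ne_zero {w : List (ZMod p)}
    (h : top (wordE (Finsupp.single w (1 : ZMod p))) ≠ 0) (k : ZMod p) : k ∈ w := by
  by_contra hk
  apply h
  set l : List (ZMod p → ZMod p) := w.map fun k => Pi.single k 1 with hl
  have hw : w.map gen = l.map (ExteriorAlgebra.ι (ZMod p)) := by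
    rw [hl, List.map_map]; rfl
  rw [wordE_single, one_smul, hw, prod_map_ι_eq_ιMulti, top_ιMulti, topForm]
  split_ifs with hn
  · rw [AlternatingMap.domDomCongr_apply, Module.Basis.det_apply]
    refine Matrix.det_eq_zero_of_row_eq_zero k fun j => ?_
    have : ∀ v ∈ l, v k = 0 := by
      intro v hv
      obtain ⟨k', hk', rfl⟩ := List.mem_map.1 hv
      exact Pi.single_eq_of_ne (by rintro rfl; exact hk hk') 1
    exact this _ (List.get_mem _ _)
  · rfl

end Exterior

section Zigzag

variable {p : ℕ} [Fact p.Prime]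

lemma prod_map_gen_eq_ιMulti (w : List (ZMod p)) :
    (w.map gen).prod = ExteriorAlgebra.ιMulti (ZMod p)
      (w.map fun k => (Pi.single k 1 : ZMod p → ZMod p)).length
      (w.map fun k => (Pi.single k 1 : ZMod p → ZMod p)).get := by
  rw [← prod_map_ι_eq_ιMulti, List.map_map]
  rfl

lemma prod_map_gen_of_not_nodup {w : List (ZMod p)} (hw : ¬ w.Nodup) :
    (w.map gen).prod = 0 := by
  rw [prod_map_gen_eq_ιMulti]
  refine AlternatingMap.map_eq_zero_of_not_injective _ _ fun h => hw ?_
  exact List.Nodup.of_map _ (List.nodup_iff_injective_get.2 h)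

lemma top_prod_map_gen_ne_zero {w : List (ZMod p)} (hw : w.Nodup) (hl : w.length = p) :
    top (w.map gen).prod ≠ 0 := by
  set v := w.map fun k => (Pi.single k 1 : ZMod p → ZMod p) with hv
  have hn : Fintype.card (ZMod p) = v.length := by rw [ZMod.card, hv, List.length_map, hl]
  have hvw : v.length = w.length := by rw [hv, List.length_map]
  rw [prod_map_gen_eq_ιMulti, top_ιMulti, topForm, dif_pos hn, AlternatingMap.domDomCongr_apply]
  have hinj : Function.Injective fun i => w.get (Fin.cast hvw (Fintype.equivFinOfCardEq hn i)) :=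
    (List.nodup_iff_injective_get.1 hw).comp ((Fin.cast_injective hvw).comp (Equiv.injective _))
  set σ : Equiv.Perm (ZMod p) :=
    Equiv.ofBijective _ (Finite.injective_iff_bijective.1 hinj) with hσ
  have h1 : v.get ∘ Fintype.equivFinOfCardEq hn = Pi.basisFun (ZMod p) (ZMod p) ∘ σ := by
    funext i
    simp [hv, hσ]
  rw [h1, AlternatingMap.map_perm, Module.Basis.det_self]
  rcases Int.units_eq_one_or (Equiv.Perm.sign σ) with h | h <;> simp [h]

lemma commute_gen_mul_gen (i j k : ZMod p) : Commute (gen i * gen j) (gen k) := by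
  have h := fun a b : ZMod p => ExteriorAlgebra.ι_add_mul_swap (R := ZMod p)
    (Pi.single a 1 : ZMod p → ZMod p) (Pi.single b 1)
  have h' : ∀ a b : ZMod p, gen a * gen b = - (gen b * gen a) :=
    fun a b => eq_neg_of_add_eq_zero_left (h a b)
  change gen i * gen j * gen k = gen k * (gen i * gen j)
  rw [mul_assoc, h' j k, mul_neg, ← mul_assoc, h' i k, neg_mul, neg_neg, mul_assoc]

/-- The invariant quadratic element of `Ext p`. -/
noncomputable def quad (p : ℕ) [Fact p.Prime] : Ext p := ∑ k : ZMod p, gen k * gen (k + 1)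

lemma dE_quad_mul (x : Ext p) : dE (quad p * x) = quad p * dE x := by
  have h : ∀ k : ZMod p, dE (gen k * gen (k + 1) * x)
      = gen (k + 1) * x - gen k * x + gen k * gen (k + 1) * dE x := fun k => by
    rw [mul_assoc, dE_gen_mul, dE_gen_mul, mul_sub, mul_assoc]
    abel
  rw [quad, Finset.sum_mul, map_sum, Finset.sum_congr rfl fun k _ => h k,
    Finset.sum_add_distrib, Finset.sum_sub_distrib, Finset.sum_mul]
  have := Equiv.sum_comp (Equiv.addRight (1 : ZMod p)) fun k => gen k * x
  simp only [Equiv.coe_addRight] at this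
  rw [this, sub_self, zero_add]

lemma dE_quad_pow_mul (i : ℕ) (x : Ext p) : dE (quad p ^ i * x) = quad p ^ i * dE x := by
  induction i generalizing x with
  | zero => simp
  | succ i ih => rw [pow_succ, mul_assoc, ih, dE_quad_mul, mul_assoc]

lemma shiftE_quad : shiftE (quad p) = quad p := by
  rw [quad, map_sum]
  simp only [map_mul, shiftE_gen]
  rw [← Equiv.sum_comp (Equiv.subRight (1 : ZMod p)) fun k => gen k * gen (k + 1)]
  refine Finset.sum_congr rfl fun k _ => ?_
  simp

lemma top_quad_pow_mul (i : ℕ) (x : Ext p) :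
    top (quad p ^ i * x) = top (quad p ^ i * (gen 0 * dE x)) := by
  have h := top_dE (quad p ^ i * (gen 0 * x))
  rw [dE_quad_pow_mul, dE_gen_mul, mul_sub, map_sub] at h
  exact sub_eq_zero.1 h

lemma top_quad_pow_mul_sub (i : ℕ) (x : Ext p) :
    top (quad p ^ i * (gen 0 * x)) - top (quad p ^ i * (gen 1 * x))
      = top (quad p ^ i * (gen 0 * (gen 1 * dE x))) := by
  have h := top_dE (quad p ^ i * (gen 0 * (gen 1 * x)))
  rw [dE_quad_pow_mul, dE_gen_mul, dE_gen_mul] at h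
  simp only [mul_sub, map_sub] at h
  linear_combination -h

variable {H : Type*}

/-- The evaluation in `Ext p` of chains whose letters are labelled by `ℓ`. -/
noncomputable def labelE (ℓ : H → ZMod p) : Chain (ZMod p) H →ₗ[ZMod p] Ext p :=
  wordE ∘ₗ mapC ℓ

lemma labelE_bd (ℓ : H → ZMod p) (c : Chain (ZMod p) H) :
    labelE ℓ (bd c) = dE (labelE ℓ c) := by
  rw [labelE, LinearMap.comp_apply, ← bd_mapC, wordE_bd]
  rfl

variable [Group H]

lemma labelE_rt {γ : H} {ℓ : H → ZMod p} (hℓ : ∀ h, ℓ (h * γ) = ℓ h - 1)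
    (c : Chain (ZMod p) H) : labelE ℓ (rt γ c) = shiftE (labelE ℓ c) := by
  rw [labelE, LinearMap.comp_apply, rt, mapC_mapC,
    show ℓ ∘ (· * γ) = (· - 1) ∘ ℓ from funext hℓ, ← mapC_mapC, wordE_shift]
  rfl

lemma top_quad_pow_mul_labelE_rt_pow {γ : H} {ℓ : H → ZMod p} (hℓ : ∀ h, ℓ (h * γ) = ℓ h - 1)
    (i j : ℕ) (a b : ZMod p) (c : Chain (ZMod p) H) :
    top (quad p ^ i * (gen a * (gen b * labelE ℓ (rt (γ ^ j) c))))
      = top (quad p ^ i * (gen (a + (j : ZMod p)) * (gen (b + (j : ZMod p)) * labelE ℓ c))) := by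
  induction j generalizing a b with
  | zero => simp [rt_one]
  | succ j ih =>
    rw [pow_succ, ← rt_rt, labelE_rt hℓ]
    have h : quad p ^ i * (gen a * (gen b * shiftE (labelE ℓ (rt (γ ^ j) c))))
        = shiftE (quad p ^ i * (gen (a + 1) * (gen (b + 1) * labelE ℓ (rt (γ ^ j) c)))) := by
      simp [shiftE_gen, shiftE_quad]
    rw [h, top_shiftE, ih]
    push_cast
    ring_nf

lemma top_labelE_step {γ : H} {ℓ : H → ZMod p} (hℓ : ∀ h, ℓ (h * γ) = ℓ h - 1)
    {T : ℕ → Chain (ZMod p) H} {i : ℕ} (h0 : totalD p γ T (2 * i) = 0)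
    (h1 : totalD p γ T (2 * i + 1) = 0) :
    top (quad p ^ i * labelE ℓ (T (2 * i)))
      = top (quad p ^ (i + 1) * labelE ℓ (T (2 * (i + 1)))) := by
  have he : Even (2 * i) := even_two_mul i
  have ho : ¬ Even (2 * i + 1) := by simp
  have he' : Even (2 * i + 1 + 1) := by simp [Nat.even_add_one]
  rw [totalD_apply, he.neg_one_pow, one_smul, horiz, if_neg ho] at h0
  rw [totalD_apply, Odd.neg_one_pow ⟨i, rfl⟩, horiz, if_pos he'] at h1
  have h0' : bd (T (2 * i)) = T (2 * i + 1) - rt γ (T (2 * i + 1)) := by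
    rw [eq_neg_of_add_eq_zero_left h0, LinearMap.sub_apply, LinearMap.id_apply, neg_sub]
  have h1' : bd (T (2 * i + 1)) = ∑ j ∈ Finset.range p, rt (γ ^ j) (T (2 * (i + 1))) := by
    have := eq_neg_of_add_eq_zero_left h1
    rw [neg_smul, one_smul, neg_inj, LinearMap.sum_apply] at this
    exact this
  have hs : quad p ^ i * (gen 0 * shiftE (labelE ℓ (T (2 * i + 1))))
      = shiftE (quad p ^ i * (gen 1 * labelE ℓ (T (2 * i + 1)))) := by
    simp [shiftE_gen, shiftE_quad]
  rw [top_quad_pow_mul, ← labelE_bd, h0', map_sub, labelE_rt hℓ, mul_sub, mul_sub, map_sub, hs,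
    top_shiftE, top_quad_pow_mul_sub, ← labelE_bd, h1', map_sum, Finset.mul_sum, Finset.mul_sum,
    Finset.mul_sum, map_sum,
    Finset.sum_congr rfl fun j _ => top_quad_pow_mul_labelE_rt_pow hℓ i j 0 1 _,
    pow_succ, mul_assoc]
  simp_rw [zero_add, add_comm (1 : ZMod p)]
  conv_rhs => rw [quad, Finset.sum_mul, Finset.mul_sum, map_sum, ← sum_range_natCast]
  refine Finset.sum_congr rfl fun j _ => ?_
  rw [mul_assoc, quad]

lemma top_labelE_eq {γ : H} {ℓ : H → ZMod p} (hℓ : ∀ h, ℓ (h * γ) = ℓ h - 1)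
    {T : ℕ → Chain (ZMod p) H} {r : ℕ} {y : ZMod p}
    (hT : totalD p γ T = Pi.single (2 * r) (Finsupp.single [] y)) (hT' : T (2 * r + 1) = 0) :
    top (labelE ℓ (T 0)) = y * top (quad p ^ r * gen 0) := by
  have h : ∀ i ≤ r, top (labelE ℓ (T 0)) = top (quad p ^ i * labelE ℓ (T (2 * i))) := by
    intro i hi
    induction i with
    | zero => simp
    | succ i ih =>
      rw [ih (by omega), top_labelE_step hℓ]
      · rw [hT, Pi.single_eq_of_ne (by omega)]
      · rw [hT, Pi.single_eq_of_ne (by omega)]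
  have hb : bd (T (2 * r)) = Finsupp.single [] y := by
    have := congrFun hT (2 * r)
    rwa [totalD_apply, hT', map_zero, add_zero, (even_two_mul r).neg_one_pow, one_smul,
      Pi.single_eq_same] at this
  rw [h r le_rfl, top_quad_pow_mul, ← labelE_bd, hb, labelE, LinearMap.comp_apply, mapC_single,
    wordE_single]
  simp

lemma add_pow_succ_of_mul_self_eq_zero {R : Type*} [Ring R] [Algebra (ZMod p) R] {a b : R}
    (h : Commute a b) (hb : b * b = 0) (n : ℕ) :
    (a + b) ^ (n + 1) = a ^ (n + 1) + ((n : ZMod p) + 1) • (a ^ n * b) := by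
  induction n with
  | zero => simp
  | succ n ih =>
    have h1 : a ^ n * b * a = a ^ (n + 1) * b := by rw [mul_assoc, ← h.eq, ← mul_assoc, pow_succ]
    have h2 : a ^ n * b * b = 0 := by rw [mul_assoc, hb, mul_zero]
    rw [pow_succ, ih, mul_add, add_mul, add_mul, smul_mul_assoc, smul_mul_assoc, h1, h2, smul_zero,
      add_zero, ← pow_succ, add_assoc]
    push_cast
    module

lemma quad_pow_mul_gen {r : ℕ} (hp : p = 2 * r + 1) :
    quad p ^ r * gen 0
      = (r.factorial : ZMod p) • (((List.range (2 * r + 1)).map Nat.cast).map gen).prod := by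
  set A : ℕ → Ext p := fun n =>
    ∑ i ∈ Finset.range (2 * n), gen (i : ZMod p) * gen ((i : ZMod p) + 1)
    with hA
  have hcomm : ∀ (n : ℕ) (x : ℕ) , Commute (A n) (gen (x : ZMod p)) := fun n x => by
    rw [hA]
    exact Commute.sum_left _ _ _ fun i _ => commute_gen_mul_gen _ _ _
  set Q : ℕ → Ext p := fun n =>
    (((List.range (2 * n + 1)).map (Nat.cast : ℕ → ZMod p)).map gen).prod
    with hQ
  have hdup : ∀ n i j : ℕ, j < 2 * n + 1 → gen (i : ZMod p) * gen (j : ZMod p) * Q n = 0 := by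
    intro n i j hj
    have := prod_map_gen_of_not_nodup (w := (i : ZMod p) :: (j : ZMod p) ::
      (List.range (2 * n + 1)).map (Nat.cast : ℕ → ZMod p)) (by
        intro h
        exact (List.nodup_cons.1 (List.nodup_cons.1 h).2).1
          (List.mem_map.2 ⟨j, List.mem_range.2 hj, rfl⟩))
    simpa [hQ, mul_assoc] using this
  have hAQ : ∀ n, A n * Q n = 0 := fun n => by
    simp only [hA, Finset.sum_mul]
    refine Finset.sum_eq_zero fun i hi => ?_
    have := hdup n i (i + 1) (by have := Finset.mem_range.1 hi; omega)
    push_cast at this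
    exact this
  have hpow : ∀ n, A n ^ n * gen 0 = (n.factorial : ZMod p) • Q n := by
    intro n
    induction n with
    | zero => simp [hQ]
    | succ n ih =>
      set b := gen ((2 * n : ℕ) : ZMod p) * gen ((2 * n + 1 : ℕ) : ZMod p)
        + gen ((2 * n + 1 : ℕ) : ZMod p) * gen ((2 * n + 2 : ℕ) : ZMod p) with hb
      have hAb : A (n + 1) = A n + b := by
        simp only [hA, hb, mul_add, mul_one]
        rw [Finset.sum_range_succ, Finset.sum_range_succ, add_assoc]
        push_cast
        ring_nf
      have hbb : b * b = 0 := by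
        have h : ∀ i j k l : ℕ, (i = k ∨ i = l ∨ j = k ∨ j = l) →
            gen (i : ZMod p) * gen (j : ZMod p) * (gen (k : ZMod p) * gen (l : ZMod p)) = 0 := by
          intro i j k l h
          have := prod_map_gen_of_not_nodup
            (w := [(i : ZMod p), (j : ZMod p), (k : ZMod p), (l : ZMod p)]) (by
              rcases h with rfl | rfl | rfl | rfl <;> simp)
          simpa [mul_assoc] using this
        rw [hb, add_mul, mul_add, mul_add, h _ _ _ _ (by simp), h _ _ _ _ (by simp),
          h _ _ _ _ (by simp), h _ _ _ _ (by simp)]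
        simp
      have hcb : Commute (A n) b :=
        ((hcomm n _).mul_right (hcomm n _)).add_right ((hcomm n _).mul_right (hcomm n _))
      have hQs : Q (n + 1) = Q n * (gen ((2 * n + 1 : ℕ) : ZMod p)
          * gen ((2 * n + 2 : ℕ) : ZMod p)) := by
        simp only [hQ]
        rw [show 2 * (n + 1) + 1 = 2 * n + 1 + 1 + 1 by ring, List.range_succ, List.range_succ]
        simp
      have hcQ : ∀ i j : ℕ, Commute (gen (i : ZMod p) * gen (j : ZMod p)) (Q n) := by
        intro i j
        refine Commute.list_prod_right _ _ fun x hx => ?_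
        obtain ⟨k, -, rfl⟩ := List.mem_map.1 hx
        exact commute_gen_mul_gen _ _ _
      have hbQ : b * Q n = Q (n + 1) := by
        have h := prod_map_gen_of_not_nodup (w := ((2 * n : ℕ) : ZMod p) ::
          ((2 * n + 1 : ℕ) : ZMod p) :: (List.range (2 * n + 1)).map (Nat.cast : ℕ → ZMod p)) (by
            intro h
            exact (List.nodup_cons.1 h).1
              (List.mem_cons_of_mem _ (List.mem_map.2 ⟨2 * n, by simp, rfl⟩)))
        have h' : gen ((2 * n : ℕ) : ZMod p) * gen ((2 * n + 1 : ℕ) : ZMod p) * Q n = 0 := by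
          simpa only [hQ, List.map_cons, List.prod_cons, mul_assoc] using h
        rw [hb, add_mul, h', zero_add, (hcQ _ _).eq, hQs]
      rw [hAb, add_pow_succ_of_mul_self_eq_zero (p := p) hcb hbb, add_mul, pow_succ', mul_assoc, ih,
        mul_smul_comm, hAQ, smul_zero, zero_add, smul_mul_assoc, mul_assoc, ← mul_assoc,
        (hcb.pow_left n).eq, mul_assoc, ih, mul_smul_comm, hbQ, smul_smul, Nat.factorial_succ]
      push_cast
      rfl
  have hq : quad p = A r + gen ((2 * r : ℕ) : ZMod p) * gen 0 := by
    have h2 : ((2 * r : ℕ) : ZMod p) + 1 = 0 := by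
      rw [← Nat.cast_succ, Nat.succ_eq_add_one, ← hp, ZMod.natCast_self]
    rw [quad, ← sum_range_natCast, ← h2]
    have hr : Finset.range p = Finset.range (2 * r + 1) := congrArg _ hp
    rw [hr, Finset.sum_range_succ]
  have hqn : ∀ n, quad p ^ n * gen 0 = A r ^ n * gen 0 := by
    intro n
    induction n with
    | zero => simp
    | succ n ih =>
      have h0 : gen ((2 * r : ℕ) : ZMod p) * gen 0 * gen (0 : ZMod p) = 0 := by
        have := prod_map_gen_of_not_nodup (w := [((2 * r : ℕ) : ZMod p), 0, 0]) (by simp)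
        simpa [mul_assoc] using this
      have hc : Commute (gen ((2 * r : ℕ) : ZMod p) * gen 0) (A r ^ n) := by
        refine Commute.pow_right (Commute.sum_right _ _ _ fun i _ => ?_) n
        exact (commute_gen_mul_gen _ _ _).mul_right (commute_gen_mul_gen _ _ _)
      rw [pow_succ', mul_assoc, ih, hq, add_mul, ← mul_assoc (gen _ * gen _), hc.eq,
        mul_assoc _ _ (gen 0),
        h0, mul_zero, add_zero, ← mul_assoc, ← pow_succ']
  rw [hqn, hpow]

lemma top_quad_pow_mul_gen_ne_zero {r : ℕ} (hp : p = 2 * r + 1) :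
    top (quad p ^ r * gen 0) ≠ 0 := by
  rw [quad_pow_mul_gen hp, map_smul, smul_eq_mul]
  refine mul_ne_zero ?_ (top_prod_map_gen_ne_zero ?_ (by simp [hp]))
  · rw [Ne, ZMod.natCast_eq_zero_iff, (Fact.out : p.Prime).dvd_factorial]
    omega
  · refine List.Nodup.map_on (fun x hx y hy h => ?_) List.nodup_range
    rw [List.mem_range] at hx hy
    rw [ZMod.natCast_eq_natCast_iff'] at h
    rwa [Nat.mod_eq_of_lt (by omega), Nat.mod_eq_of_lt (by omega)] at h

end Zigzag

section Restrict

variable {K : Type*} [CommRing K] {X : Type*}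

open Classical in
/-- Keep the words of a chain whose first letter lies in `S`. -/
noncomputable def restr (S : Set X) : Chain K X →ₗ[K] Chain K X :=
  Finsupp.linearCombination K fun w =>
    if ∃ x ∈ w.head?, x ∈ S then Finsupp.single w 1 else 0

lemma restr_single_nil (S : Set X) (k : K) : restr S (Finsupp.single [] k) = 0 := by
  simp [restr]

lemma restr_single_of_mem {S : Set X} {x : X} (hx : x ∈ S) (w : List X) (k : K) :
    restr S (Finsupp.single (x :: w) k) = Finsupp.single (x :: w) k := by
  simp [restr, hx]

lemma restr_single_of_notMem {S : Set X} {x : X} (hx : x ∉ S) (w : List X) (k : K) :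
    restr S (Finsupp.single (x :: w) k) = 0 := by
  simp [restr, hx]

lemma restr_cons_of_mem {S : Set X} {x : X} (hx : x ∈ S) (c : Chain K X) :
    restr S (cons x c) = cons x c := by
  induction c using Finsupp.induction_linear with
  | zero => simp
  | add c d hc hd => simp [hc, hd]
  | single w k => rw [cons_single, restr_single_of_mem hx]

lemma restr_cons_of_notMem {S : Set X} {x : X} (hx : x ∉ S) (c : Chain K X) :
    restr S (cons x c) = 0 := by
  induction c using Finsupp.induction_linear with
  | zero => simp
  | add c d hc hd => simp [hc, hd]
  | single w k => rw [cons_single, restr_single_of_notMem hx]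

variable {N : Type*} [AddCommGroup N] [Module K N] (Φ : Chain K X →ₗ[K] N)

lemma map_eq_of_mem_supported {s : Set (List X)} {Φ Ψ : Chain K X →ₗ[K] N}
    (h : ∀ w ∈ s, Φ (Finsupp.single w 1) = Ψ (Finsupp.single w 1)) {c : Chain K X}
    (hc : c ∈ Finsupp.supported K K s) : Φ c = Ψ c := by
  have := map_mem_of_mem_supported (Φ - Ψ) ⊥ (fun w hw => by simp [h w hw]) hc
  simpa [sub_eq_zero] using this

lemma map_bd_restr {s : Set (List X)} {S : Set X} (h0 : Φ (Finsupp.single [] 1) = 0)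
    (h : ∀ x x' w, x :: x' :: w ∈ s → Φ (Finsupp.single (x' :: w) 1) ≠ 0 → (x ∈ S ↔ x' ∈ S))
    {c : Chain K X} (hc : c ∈ Finsupp.supported K K s) :
    Φ (bd (restr S c)) = Φ (restr S (bd c)) := by
  refine map_eq_of_mem_supported (Φ := Φ ∘ₗ bd ∘ₗ restr S) (Ψ := Φ ∘ₗ restr S ∘ₗ bd)
    (fun w hw => ?_) hc
  simp only [LinearMap.comp_apply]
  rcases w with _ | ⟨x, _ | ⟨x', w⟩⟩
  · simp [restr_single_nil]
  · by_cases hx : x ∈ S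
    · rw [restr_single_of_mem hx, ← cons_single, bd_cons]
      simp [restr_single_nil, h0]
    · rw [restr_single_of_notMem hx, ← cons_single, bd_cons]
      simp [restr_single_nil]
  · by_cases hx : x ∈ S
    · rw [restr_single_of_mem hx, ← cons_single, bd_cons, map_sub (restr (K := K) S),
        restr_cons_of_mem hx,
        map_sub, map_sub]
      congr 1
      by_cases hx' : x' ∈ S
      · rw [restr_single_of_mem hx']
      · rw [restr_single_of_notMem hx', map_zero]
        by_contra h1
        exact hx' ((h _ _ _ hw h1).1 hx)
    · rw [restr_single_of_notMem hx, ← cons_single, bd_cons, map_sub (restr (K := K) S),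
        restr_cons_of_notMem hx, map_zero, map_zero, sub_zero]
      by_cases hx' : x' ∈ S
      · rw [restr_single_of_mem hx']
        by_contra h1
        exact hx ((h _ _ _ hw (Ne.symm h1)).2 hx')
      · rw [restr_single_of_notMem hx', map_zero]

lemma map_restr_congr {s : Set (List X)} {S S' : Set X}
    (h : ∀ x w, x :: w ∈ s → Φ (Finsupp.single (x :: w) 1) ≠ 0 → (x ∈ S ↔ x ∈ S'))
    {c : Chain K X} (hc : c ∈ Finsupp.supported K K s) :
    Φ (restr S c) = Φ (restr S' c) := by
  refine map_eq_of_mem_supported (Φ := Φ ∘ₗ restr S) (Ψ := Φ ∘ₗ restr S')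
    (fun w hw => ?_) hc
  simp only [LinearMap.comp_apply]
  rcases w with _ | ⟨x, w⟩
  · simp [restr_single_nil]
  · by_cases h1 : Φ (Finsupp.single (x :: w) 1) = 0
    · by_cases hx : x ∈ S <;> by_cases hx' : x ∈ S' <;>
        simp [restr_single_of_mem, restr_single_of_notMem, hx, hx', h1]
    · by_cases hx : x ∈ S
      · rw [restr_single_of_mem hx, restr_single_of_mem ((h _ _ hw h1).1 hx)]
      · rw [restr_single_of_notMem hx, restr_single_of_notMem (mt (h _ _ hw h1).2 hx)]

lemma exists_map_restr_ne_zero (r : Setoid X) (h0 : Φ (Finsupp.single [] 1) = 0)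
    {c : Chain K X} (hc : Φ c ≠ 0) : ∃ x, Φ (restr {y | r x y} c) ≠ 0 := by
  classical
  have hsum : ∀ Ψ : Chain K X →ₗ[K] N,
      Ψ c = ∑ w ∈ c.support, c w • Ψ (Finsupp.single w 1) := fun Ψ => by
    conv_lhs => rw [← Finsupp.sum_single c, Finsupp.sum, map_sum]
    refine Finset.sum_congr rfl fun w _ => ?_
    rw [← map_smul, Finsupp.smul_single, smul_eq_mul, mul_one]
  rw [hsum Φ, ← Finset.sum_fiberwise_of_maps_to (t := c.support.image fun w =>
    w.head?.map (Quotient.mk r)) (fun w hw => Finset.mem_image_of_mem _ hw)] at hc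
  obtain ⟨q, -, hq⟩ := Finset.exists_ne_zero_of_sum_ne_zero hc
  rcases q with _ | q
  · refine absurd (Finset.sum_eq_zero fun w hw => ?_) hq
    have := (Finset.mem_filter.1 hw).2
    rw [Option.map_eq_none_iff, List.head?_eq_none_iff] at this
    rw [this, h0, smul_zero]
  · obtain ⟨x, rfl⟩ := Quotient.exists_rep q
    refine ⟨x, ?_⟩
    rw [← LinearMap.comp_apply, hsum (Φ ∘ₗ restr {y | r x y})]
    rw [Finset.sum_filter] at hq
    convert hq using 2 with w _
    rw [LinearMap.comp_apply]
    rcases w with _ | ⟨y, w⟩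
    · simp [restr_single_nil]
    · have hiff : (List.head? (y :: w)).map (Quotient.mk r) = some (Quotient.mk r x) ↔ r x y := by
        simp only [List.head?_cons, Option.map_some, Option.some.injEq]
        rw [Quotient.eq]
        exact ⟨fun h => r.symm h, fun h => r.symm h⟩
      by_cases hxy : r x y
      · rw [if_pos (hiff.2 hxy), restr_single_of_mem (by exact hxy)]
      · rw [if_neg (mt hiff.1 hxy), restr_single_of_notMem (by exact hxy), map_zero, smul_zero]

end Restrict

section Homotopy

variable {p : ℕ} [Fact p.Prime] {H : Type*}

lemma top_wordE_eq_zero_of_mem_chainsIn {A : Set (ZMod p)} {k : ZMod p} (hk : k ∉ A)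
    {c : Chain (ZMod p) (ZMod p)} (hc : c ∈ chainsIn (ZMod p) A) : top (wordE c) = 0 := by
  refine map_mem_of_mem_supported (top ∘ₗ wordE) ⊥ (fun w hw => ?_) hc
  by_contra h
  exact hk (hw k (mem_of_top_wordE_ne_zero h k))

lemma exists_of_top_prism_ne_zero {ℓ ℓ' : H → ZMod p} {w : List H}
    (h : top (wordE (prism ℓ ℓ' (Finsupp.single w (1 : ZMod p)))) ≠ 0) (k : ZMod p) :
    ∃ x ∈ w, ℓ x = k ∨ ℓ' x = k := by
  by_contra! hk
  refine h (top_wordE_eq_zero_of_mem_chainsIn (A := {k}ᶜ) (k := k) (by simp) ?_)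
  rw [prism_single, one_smul]
  exact prismWord_mem_chainsIn (A := {x | x ∈ w}) (fun x hx => (hk x hx).1)
    (fun x hx => (hk x hx).2) fun x hx => hx

lemma exists_of_top_labelE_ne_zero {ℓ : H → ZMod p} {w : List H}
    (h : top (labelE ℓ (Finsupp.single w (1 : ZMod p))) ≠ 0) (k : ZMod p) :
    ∃ x ∈ w, ℓ x = k := by
  rw [labelE, LinearMap.comp_apply, mapC_single] at h
  exact List.mem_map.1 (mem_of_top_wordE_ne_zero h k)

lemma top_one : top (1 : Ext p) = 0 := by
  have := top_dE (gen (0 : ZMod p))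
  rwa [← mul_one (gen 0), dE_gen_mul, dE_one, mul_zero, sub_zero] at this

lemma top_labelE_single_nil (ℓ : H → ZMod p) (k : ZMod p) :
    top (labelE ℓ (Finsupp.single [] k)) = 0 := by
  rw [labelE, LinearMap.comp_apply, mapC_single, wordE_single]
  simp [top_one]

/-- A family of equivariantly selectable labels has an equivariant selection. -/
lemma exists_equivariant_label [Group H] {γ : H} (hγ : orderOf γ = p) {M : H → ZMod p → Prop}
    (hM : ∀ h k, M h k → M (h * γ) (k - 1)) (hex : ∀ h, ∃ k, M h k) :
    ∃ ℓ : H → ZMod p, (∀ h, M h (ℓ h)) ∧ ∀ h, ℓ (h * γ) = ℓ h - 1 := by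
  classical
  choose k₀ hk₀ using hex
  set o : H → H := fun h => (QuotientGroup.mk (s := Subgroup.zpowers γ) h).out with ho
  have hn : ∀ h, ∃ n : ℕ, h = o h * γ ^ n := fun h => by
    obtain ⟨g, hg⟩ := QuotientGroup.mk_out_eq_mul (Subgroup.zpowers γ) h
    obtain ⟨z, hz⟩ := g.2
    have hfin : IsOfFinOrder γ := orderOf_pos_iff.1 (hγ ▸ (Fact.out : p.Prime).pos)
    have hmem : g.1⁻¹ ∈ Subgroup.zpowers γ := Subgroup.inv_mem _ g.2
    obtain ⟨n, hn⟩ := (hfin.mem_powers_iff_mem_zpowers.2 hmem)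
    refine ⟨n, ?_⟩
    change γ ^ n = _ at hn
    rw [hn, ho]
    simp only
    rw [hg, mul_inv_cancel_right]
  choose n hn using hn
  have hMn : ∀ (m : ℕ) h k, M h k → M (h * γ ^ m) (k - m) := by
    intro m h k hk
    induction m with
    | zero => simpa using hk
    | succ m ih =>
      have := hM _ _ ih
      rw [mul_assoc, ← pow_succ] at this
      convert this using 1
      push_cast
      ring
  refine ⟨fun h => k₀ (o h) - n h, fun h => ?_, fun h => ?_⟩
  · have := hMn (n h) (o h) _ (hk₀ _)
    rwa [← hn h] at this
  · have hoγ : o (h * γ) = o h := by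
      simp only [ho]
      congr 1
      exact QuotientGroup.mk_mul_of_mem h (Subgroup.mem_zpowers γ)
    have h1 : γ ^ n (h * γ) = γ ^ (n h + 1) := by
      have h2 := hn (h * γ)
      rw [hoγ] at h2
      have h3 : o h * γ ^ (n h + 1) = h * γ := by rw [pow_succ, ← mul_assoc, ← hn h]
      exact mul_left_cancel (h2.symm.trans h3.symm)
    rw [pow_eq_pow_iff_modEq, hγ, ← ZMod.natCast_eq_natCast_iff] at h1
    simp only [hoγ, h1]
    push_cast
    ring

variable [PseudoMetricSpace H]

lemma top_labelE_restr_congr {ℓ : H → ZMod p} {ρ : ℝ} {T₀ : Chain (ZMod p) H}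
    (hT₀ : T₀ ∈ small (ZMod p) H ρ) {A S S' : Set H}
    (hcov : ∀ w : List H, SmallWord ρ w → (∀ k, ∃ x ∈ w, ℓ x = k) → ∀ x ∈ w, x ∈ A)
    (hSS' : ∀ h ∈ A, h ∈ S ↔ h ∈ S') :
    top (labelE ℓ (restr S T₀)) = top (labelE ℓ (restr S' T₀)) :=
  map_restr_congr (top ∘ₗ labelE ℓ)
    (fun x w hw h => hSS' x (hcov _ hw (exists_of_top_labelE_ne_zero h) x (by simp))) hT₀

lemma top_labelE_restr_empty {ℓ : H → ZMod p} {ρ : ℝ} {T₀ : Chain (ZMod p) H}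
    (hT₀ : T₀ ∈ small (ZMod p) H ρ) {A S : Set H}
    (hcov : ∀ w : List H, SmallWord ρ w → (∀ k, ∃ x ∈ w, ℓ x = k) → ∀ x ∈ w, x ∈ A)
    (hS : ∀ h ∈ A, h ∉ S) : top (labelE ℓ (restr S T₀)) = 0 := by
  refine map_eq_of_mem_supported (Φ := (top ∘ₗ labelE ℓ) ∘ₗ restr S) (Ψ := 0)
    (fun w hw => ?_) hT₀
  simp only [LinearMap.comp_apply, LinearMap.zero_apply]
  rcases w with _ | ⟨x, w⟩
  · simp [restr_single_nil]
  · by_cases hx : x ∈ S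
    · rw [restr_single_of_mem hx]
      by_contra h
      exact hS x (hcov _ hw (exists_of_top_labelE_ne_zero h) x (by simp)) hx
    · simp [restr_single_of_notMem hx]

variable [Group H]

/-- Invariance of the restricted degree under a change of labels. -/
lemma top_labelE_restr_eq {γ : H} {ℓ ℓ' : H → ZMod p} (hℓ : ∀ h, ℓ (h * γ) = ℓ h - 1)
    (hℓ' : ∀ h, ℓ' (h * γ) = ℓ' h - 1) {ρ : ℝ} {T₀ T₁ : Chain (ZMod p) H}
    (hT₀ : T₀ ∈ small (ZMod p) H ρ) (hT₁ : T₁ ∈ small (ZMod p) H ρ)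
    (hbd : bd T₀ = T₁ - rt γ T₁) {A S : Set H}
    (hcov : ∀ w : List H, SmallWord ρ w → (∀ k, ∃ x ∈ w, ℓ x = k ∨ ℓ' x = k) → ∀ x ∈ w, x ∈ A)
    (hstep : ∀ h ∈ A, ∀ h' ∈ A, dist h h' < ρ → (h ∈ S ↔ h' ∈ S))
    (hshift : ∀ h ∈ A, h ∈ S ↔ h * γ ∈ S) :
    top (labelE ℓ (restr S T₀)) = top (labelE ℓ' (restr S T₀)) := by
  set Φ : Chain (ZMod p) H →ₗ[ZMod p] ZMod p := top ∘ₗ wordE ∘ₗ prism ℓ ℓ' with hΦ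
  have h0 : Φ (Finsupp.single [] 1) = 0 := by simp [hΦ]
  have hΦA : ∀ w : List H, SmallWord ρ w → Φ (Finsupp.single w 1) ≠ 0 → ∀ x ∈ w, x ∈ A :=
    fun w hw h => hcov w hw (exists_of_top_prism_ne_zero h)
  have hΦγ : ∀ c, Φ (rt γ c) = Φ c := fun c => by
    simp only [hΦ, LinearMap.comp_apply, rt]
    rw [prism_mapC, show ℓ ∘ (· * γ) = (· - 1) ∘ ℓ from funext hℓ,
      show ℓ' ∘ (· * γ) = (· - 1) ∘ ℓ' from funext hℓ', ← mapC_prism, wordE_shift, top_shiftE]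
  have h1 : Φ (bd (restr S T₀)) = Φ (restr S (bd T₀)) := by
    refine map_bd_restr Φ h0 (fun x x' w hw h => ?_) hT₀
    have hc : ∀ y ∈ x :: x' :: w, y ∈ A := hcov _ hw fun k => by
      obtain ⟨y, hy, h⟩ := exists_of_top_prism_ne_zero h k
      exact ⟨y, List.mem_cons_of_mem _ hy, h⟩
    exact hstep _ (hc _ (by simp)) _ (hc _ (by simp)) (hw _ (by simp) _ (by simp))
  have h2 : Φ (restr S (rt γ T₁)) = Φ (restr S T₁) := by
    refine map_eq_of_mem_supported (Φ := Φ ∘ₗ restr S ∘ₗ rt γ) (Ψ := Φ ∘ₗ restr S)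
      (fun w hw => ?_) hT₁
    simp only [LinearMap.comp_apply]
    rcases w with _ | ⟨x, w⟩
    · simp [restr_single_nil, rt_single_nil]
    · have h3 : rt γ (Finsupp.single (x :: w) (1 : ZMod p))
          = Finsupp.single (x * γ :: w.map (· * γ)) 1 := by simp [rt]
      by_cases h : Φ (Finsupp.single (x :: w) 1) = 0
      · have h' : Φ (Finsupp.single (x * γ :: w.map (· * γ)) 1) = 0 := by rw [← h3, hΦγ, h]
        rw [h3]
        by_cases hx : x ∈ S <;> by_cases hx' : x * γ ∈ S <;>
          simp [restr_single_of_mem, restr_single_of_notMem, hx, hx', h, h']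
      · have hx := hshift x (hΦA _ hw h x (by simp))
        rw [h3]
        by_cases hxS : x ∈ S
        · rw [restr_single_of_mem (hx.1 hxS), restr_single_of_mem hxS, ← h3, hΦγ]
        · rw [restr_single_of_notMem (mt hx.2 hxS), restr_single_of_notMem hxS]
  have h3 := congrArg (fun c => top (wordE c)) (bd_prism_add ℓ ℓ' (restr S T₀))
  simp only [map_add, map_sub] at h3
  rw [wordE_bd, top_dE, zero_add] at h3
  have h4 : Φ (bd (restr S T₀)) = 0 := by
    rw [h1, hbd, map_sub, map_sub, h2, sub_self]
  exact (sub_eq_zero.1 (h3.symm.trans h4)).symm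

end Homotopy

section Gap

variable {p : ℕ} {G H : Type*} {F : ZMod p → G × H → ℝ} {η ρ : ℝ}

/-- The points at which a family of functions is nearly constant. -/
def NearlyConst (F : ZMod p → G × H → ℝ) (η : ℝ) (z : G × H) : Prop :=
  ∀ k k', |F k z - F k' z| ≤ 2 * η

section

variable [PseudoMetricSpace G] [PseudoMetricSpace H]

/-- Nearly constant points at distance less than `ρ`. -/
def Step (F : ZMod p → G × H → ℝ) (η ρ : ℝ) (z z' : G × H) : Prop :=
  NearlyConst F η z ∧ NearlyConst F η z' ∧ dist z.1 z'.1 + dist z.2 z'.2 < ρ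

lemma Step.symm {z z' : G × H} (h : Step F η ρ z z') :
    Step F η ρ z' z :=
  ⟨h.2.1, h.1, by rw [dist_comm z'.1, dist_comm z'.2]; exact h.2.2⟩

lemma nearlyConst_of_reflTransGen {z z' : G × H}
    (h : Relation.ReflTransGen (Step F η ρ) z z') (hz : NearlyConst F η z) :
    NearlyConst F η z' := by
  rcases Relation.ReflTransGen.cases_tail h with rfl | ⟨_, _, h⟩
  · exact hz
  · exact h.2.1

lemma reflTransGen_symm {z z' : G × H}
    (h : Relation.ReflTransGen (Step F η ρ) z z') : Relation.ReflTransGen (Step F η ρ) z' z := by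
  induction h with
  | refl => exact .refl
  | tail _ h ih => exact .head h.symm ih

/-- Small words with full label sets consist of nearly constant points. -/
lemma nearlyConst_of_cover (huc : ∀ k b h b' h', dist b b' + dist h h' < 2 * ρ →
      |F k (b, h) - F k (b', h')| < η) {ℓ : G → H → ZMod p}
    (hℓ : ∀ b h k, F k (b, h) ≤ F (ℓ b h) (b, h)) (hρ : 0 < ρ) {b b' : G} (hb : dist b b' < ρ)
    {w : List H} (hw : SmallWord ρ w) (hk : ∀ k, ∃ x ∈ w, ℓ b x = k ∨ ℓ b' x = k) :
    ∀ x ∈ w, NearlyConst F η (b, x) ∧ NearlyConst F η (b', x) := by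
  have key : ∀ c, (c = b ∨ c = b') → ∀ x ∈ w, ∀ k k', F k' (c, x) ≤ F k (c, x) + 2 * η := by
    intro c hc x hx k k'
    obtain ⟨y, hy, hyk⟩ := hk k
    obtain ⟨d, hd, hdk⟩ : ∃ d, (d = b ∨ d = b') ∧ ℓ d y = k := by
      rcases hyk with h | h
      · exact ⟨b, .inl rfl, h⟩
      · exact ⟨b', .inr rfl, h⟩
    have hcd : dist c d < ρ := by
      rcases hc with rfl | rfl <;> rcases hd with rfl | rfl <;>
        first | assumption | (rw [dist_self]; exact hρ) | (rw [dist_comm]; assumption)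
    have hd : dist c d + dist x y < 2 * ρ := by
      have := hw x hx y hy
      linarith
    have h1 := abs_lt.1 (huc k' _ _ _ _ hd)
    have h2 := abs_lt.1 (huc k _ _ _ _ hd)
    have h3 := hℓ d y k'
    rw [hdk] at h3
    linarith
  intro x hx
  constructor
  · intro k k'
    have h1 := key b (.inl rfl) x hx k k'
    have h2 := key b (.inl rfl) x hx k' k
    rw [abs_le]; constructor <;> linarith
  · intro k k'
    have h1 := key b' (.inr rfl) x hx k k'
    have h2 := key b' (.inr rfl) x hx k' k
    rw [abs_le]; constructor <;> linarith

end

variable [Group H] {γ : H}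

lemma apply_mul_pow (hF : ∀ k b h, F k (b, h * γ) = F (k + 1) (b, h)) (k : ZMod p) (b : G) (h : H)
    (i : ℕ) :
    F k (b, h * γ ^ i) = F (k + i) (b, h) := by
  induction i generalizing k with
  | zero => simp
  | succ i ih =>
    rw [pow_succ, ← mul_assoc, hF, ih]
    push_cast
    ring_nf

lemma NearlyConst.mul_pow (hF : ∀ k b h, F k (b, h * γ) = F (k + 1) (b, h)) {z : G × H}
    (hz : NearlyConst F η z)
    (i : ℕ) : NearlyConst F η (z.1, z.2 * γ ^ i) := fun k k' => by
  rw [apply_mul_pow hF, apply_mul_pow hF]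
  exact hz _ _

variable [PseudoMetricSpace G] [PseudoMetricSpace H]

/-- Connectedness by steps, up to powers of `γ`. -/
def Linked (γ : H) (F : ZMod p → G × H → ℝ) (η ρ : ℝ) (z z' : G × H) : Prop :=
  ∃ i : ℕ, Relation.ReflTransGen (Step F η ρ) z (z'.1, z'.2 * γ ^ i)

variable [IsIsometricSMul Hᵐᵒᵖ H]

lemma reflTransGen_mul_pow (hF : ∀ k b h, F k (b, h * γ) = F (k + 1) (b, h)) {z z' : G × H}
    (h : Relation.ReflTransGen (Step F η ρ) z z') (i : ℕ) :
    Relation.ReflTransGen (Step F η ρ) (z.1, z.2 * γ ^ i) (z'.1, z'.2 * γ ^ i) := by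
  induction h with
  | refl => exact .refl
  | tail _ h ih =>
    refine ih.tail ⟨h.1.mul_pow hF i, h.2.1.mul_pow hF i, ?_⟩
    simp only [dist_mul_right]
    exact h.2.2

variable [Fact p.Prime]

lemma linked_equivalence (hF : ∀ k b h, F k (b, h * γ) = F (k + 1) (b, h)) (hγ : γ ^ p = 1) :
    Equivalence (Linked γ F η ρ) where
  refl z := ⟨0, by simpa using Relation.ReflTransGen.refl⟩
  symm := by
    rintro z z' ⟨i, h⟩
    refine ⟨(p - 1) * i, ?_⟩
    have h1 := reflTransGen_mul_pow hF (reflTransGen_symm h) ((p - 1) * i)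
    have h2 : γ ^ i * γ ^ ((p - 1) * i) = 1 := by
      have : i + (p - 1) * i = p * i := by
        obtain ⟨q, hq⟩ := Nat.exists_eq_succ_of_ne_zero (Fact.out : p.Prime).ne_zero
        rw [hq, Nat.succ_sub_one, Nat.succ_mul, add_comm]
      rw [← pow_add, this, pow_mul, hγ, one_pow]
    simpa [mul_assoc, h2] using h1
  trans := by
    rintro z z' z'' ⟨i, h⟩ ⟨j, h'⟩
    refine ⟨j + i, h.trans ?_⟩
    simpa [mul_assoc, pow_add] using reflTransGen_mul_pow hF h' i

lemma Linked.step (hF : ∀ k b h, F k (b, h * γ) = F (k + 1) (b, h)) (hγ : γ ^ p = 1)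
    {z₀ z z' : G × H} (h : Step F η ρ z z') : Linked γ F η ρ z₀ z ↔ Linked γ F η ρ z₀ z' := by
  have he := linked_equivalence (η := η) (ρ := ρ) hF hγ
  have h1 : Linked γ F η ρ z z' := ⟨0, by simpa using Relation.ReflTransGen.single h⟩
  exact ⟨fun h' => he.trans h' h1, fun h' => he.trans h' (he.symm h1)⟩

lemma Linked.mul (hF : ∀ k b h, F k (b, h * γ) = F (k + 1) (b, h)) (hγ : γ ^ p = 1)
    {z₀ : G × H} (b : G) (h : H) :
    Linked γ F η ρ z₀ (b, h) ↔ Linked γ F η ρ z₀ (b, h * γ) := by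
  have he := linked_equivalence (η := η) (ρ := ρ) hF hγ
  have h1 : Linked γ F η ρ (b, h * γ) (b, h) := ⟨1, by simpa using Relation.ReflTransGen.refl⟩
  exact ⟨fun h' => he.trans h' (he.symm h1), fun h' => he.trans h' h1⟩

/-- If all equivariant labels have nonzero degree, then a nearly equivariant map `β` cannot
keep the values of the family away from each other. -/
theorem false_of_gap (hG : ChainConnected G) (g₀ : G) (hγ : orderOf γ = p) (hρ : 0 < ρ)
    {T₀ T₁ : Chain (ZMod p) H} (hT₀ : T₀ ∈ small (ZMod p) H ρ) (hT₁ : T₁ ∈ small (ZMod p) H ρ)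
    (hbd : bd T₀ = T₁ - rt γ T₁)
    (hdeg : ∀ ℓ : H → ZMod p, (∀ h, ℓ (h * γ) = ℓ h - 1) → top (labelE ℓ T₀) ≠ 0)
    (hF : ∀ k b h, F k (b, h * γ) = F (k + 1) (b, h))
    (huc : ∀ k b h b' h', dist b b' + dist h h' < 2 * ρ → |F k (b, h) - F k (b', h')| < η)
    {C : ℝ} (hC : ∀ z, |F 0 z| ≤ C) {β : G × H → G}
    (hβ : ∀ z z', dist (β z) (β z') ≤ dist z.1 z'.1 + dist z.2 z'.2)
    (hgap : ∀ z h, NearlyConst F η z → NearlyConst F η (β z, h) →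
      10 * η < |F 0 (β z, h) - F 0 z|) : False := by
  have hγp : γ ^ p = 1 := hγ ▸ pow_orderOf_eq_one γ
  have hη : 0 < η := by
    have := huc 0 g₀ 1 g₀ 1 (by simpa using hρ)
    simpa using this
  have hlab : ∀ b : G, ∃ ℓ : H → ZMod p, (∀ h, ∀ k, F k (b, h) ≤ F (ℓ h) (b, h)) ∧
      ∀ h, ℓ (h * γ) = ℓ h - 1 := fun b => by
    refine exists_equivariant_label hγ (M := fun h k' => ∀ k, F k (b, h) ≤ F k' (b, h)) ?_ ?_
    · intro h k hk k'
      rw [hF, hF, sub_add_cancel]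
      exact hk _
    · intro h
      exact Finite.exists_max fun k => F k (b, h)
  choose ℓ hℓ hℓγ using hlab
  set deg : G → Set H → ZMod p := fun b S => top (labelE (ℓ b) (restr S T₀)) with hdegdef
  have hcov₁ : ∀ b, ∀ w : List H, SmallWord ρ w → (∀ k, ∃ x ∈ w, ℓ b x = k) →
      ∀ x ∈ w, x ∈ {x | NearlyConst F η (b, x)} := fun b w hw hk x hx =>
    (nearlyConst_of_cover huc hℓ hρ (by simpa using hρ) hw (b := b) (b' := b)
      (by simpa using hk) x hx).1
  have hhom : ∀ b b' (S S' : Set H), dist b b' < ρ →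
      (∀ h h', NearlyConst F η (b, h) → NearlyConst F η (b, h') → dist h h' < ρ →
        (h ∈ S ↔ h' ∈ S)) →
      (∀ h, NearlyConst F η (b, h) → NearlyConst F η (b', h) → (h ∈ S ↔ h ∈ S')) →
      (∀ h, NearlyConst F η (b, h) → (h ∈ S ↔ h * γ ∈ S)) → deg b S = deg b' S' := by
    intro b b' S S' hbb' h1 h2 h3
    have hcov : ∀ w : List H, SmallWord ρ w → (∀ k, ∃ x ∈ w, ℓ b x = k ∨ ℓ b' x = k) →
        ∀ x ∈ w, x ∈ {x | NearlyConst F η (b, x) ∧ NearlyConst F η (b', x)} :=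
      fun w hw hk x hx => nearlyConst_of_cover huc hℓ hρ hbb' hw hk x hx
    refine (top_labelE_restr_eq (hℓγ b) (hℓγ b') hT₀ hT₁ hbd hcov
      (fun h hh h' hh' hd => h1 h h' hh.1 hh'.1 hd) (fun h hh => h3 h hh.1)).trans ?_
    exact top_labelE_restr_congr hT₀ (fun w hw hk => hcov w hw fun k => by
      obtain ⟨x, hx, h⟩ := hk k
      exact ⟨x, hx, .inr h⟩) fun h hh => h2 h hh.1 hh.2
  have heq := linked_equivalence (η := η) (ρ := ρ) hF hγp
  obtain ⟨h₀, hh₀⟩ := exists_map_restr_ne_zero (top ∘ₗ labelE (ℓ g₀))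
    (Setoid.comap (fun h => (g₀, h)) ⟨_, heq⟩) (top_labelE_single_nil _ _) (hdeg _ (hℓγ g₀))
  set z₀ : G × H := (g₀, h₀) with hz₀
  set cl : G → Set H := fun b => {h | Linked γ F η ρ z₀ (b, h)} with hcl
  have hcl₀ : deg g₀ (cl g₀) ≠ 0 := hh₀
  have hclstep : ∀ b b', dist b b' < ρ → deg b (cl b) = deg b' (cl b') := fun b b' hbb' => by
    refine hhom b b' _ _ hbb' (fun h h' hh hh' hd => ?_) (fun h hh hh' => ?_) fun h hh => ?_
    · exact Linked.step hF hγp ⟨hh, hh', by simpa using hd⟩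
    · exact Linked.step hF hγp ⟨hh, hh', by simpa using hbb'⟩
    · exact Linked.mul hF hγp b h
  have hclne : ∀ b, deg b (cl b) ≠ 0 := fun b => by
    have h := hG ρ hρ g₀ b
    induction h with
    | refl => exact hcl₀
    | tail _ h ih => rwa [← hclstep _ _ h]
  have hz₀c : NearlyConst F η z₀ := by
    by_contra hcon
    refine hcl₀ (top_labelE_restr_empty hT₀ (hcov₁ g₀) fun h hh hhS => hcon ?_)
    obtain ⟨i, hi⟩ := hhS
    exact nearlyConst_of_reflTransGen (reflTransGen_symm hi)
      (NearlyConst.mul_pow hF (z := (g₀, h)) hh i)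
  set A : Set (G × H) := {z | Relation.ReflTransGen (Step F η ρ) z₀ z} with hA
  have hAc : ∀ z ∈ A, NearlyConst F η z := fun z hz => nearlyConst_of_reflTransGen hz hz₀c
  have hApp : ∀ b h, NearlyConst F η (b, h) → h ∈ cl b →
      ∃ z ∈ A, |F 0 z - F 0 (b, h)| ≤ 2 * η := by
    rintro b h hh ⟨i, hi⟩
    refine ⟨_, hi, ?_⟩
    simp only
    rw [apply_mul_pow hF]
    exact hh _ _
  set V : G × H → Set H := fun z => {h | h ∈ cl (β z) ∧ F 0 z < F 0 (β z, h)} with hV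
  have hsep : ∀ {x y d : ℝ}, 10 * η < |x - y| → |d - (x - y)| ≤ 2 * η + 2 * η →
      (0 < x - y ↔ 0 < d) := by
    intro x y d h1 h2
    rw [abs_le] at h2
    rcases lt_abs.1 h1 with h | h <;> constructor <;> intro _ <;> linarith [h2.1, h2.2]
  have hVstep : ∀ z z', Step F η ρ z z' → deg (β z) (V z) = deg (β z') (V z') := by
    intro z z' hzz'
    have hbb' : dist (β z) (β z') < ρ := (hβ z z').trans_lt hzz'.2.2
    have hzF : |F 0 z - F 0 z'| < η := huc 0 z.1 z.2 z'.1 z'.2 (by linarith [hzz'.2.2])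
    refine hhom _ _ _ _ hbb' (fun h h' hh hh' hd => ?_) (fun h hh hh' => ?_) fun h hh => ?_
    · refine and_congr (Linked.step hF hγp ⟨hh, hh', by simpa using hd⟩) ?_
      rw [← sub_pos, ← sub_pos (b := F 0 z)]
      refine hsep (hgap z h hzz'.1 hh) ?_
      have := huc 0 (β z) h (β z) h' (by simp; linarith)
      rw [abs_lt] at this; rw [abs_le]; constructor <;> linarith
    · refine and_congr (Linked.step hF hγp ⟨hh, hh', by simpa using hbb'⟩) ?_
      rw [← sub_pos, ← sub_pos (b := F 0 z')]
      refine hsep (hgap z h hzz'.1 hh) ?_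
      have := huc 0 (β z) h (β z') h (by simp; linarith)
      rw [abs_lt] at this hzF; rw [abs_le]; constructor <;> linarith
    · refine and_congr (Linked.mul hF hγp _ h) ?_
      rw [← sub_pos, ← sub_pos (b := F 0 z), hF]
      refine hsep (hgap z h hzz'.1 hh) ?_
      have := hh (0 + 1) 0
      rw [abs_le] at this ⊢; constructor <;> linarith
  have hVconst : ∀ z ∈ A, deg (β z) (V z) = deg (β z₀) (V z₀) := fun z hz => by
    induction hz with
    | refl => rfl
    | tail _ h ih => rw [← ih, hVstep _ _ h]
  have hne : (F 0 '' A).Nonempty := ⟨_, z₀, Relation.ReflTransGen.refl, rfl⟩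
  have hbb : BddBelow (F 0 '' A) := ⟨-C, by rintro _ ⟨z, -, rfl⟩; exact (abs_le.1 (hC z)).1⟩
  have hba : BddAbove (F 0 '' A) := ⟨C, by rintro _ ⟨z, -, rfl⟩; exact (abs_le.1 (hC z)).2⟩
  obtain ⟨_, ⟨z, hz, rfl⟩, hzlt⟩ := exists_lt_of_csInf_lt hne
    (lt_add_of_pos_right (sInf (F 0 '' A)) hη)
  obtain ⟨_, ⟨y, hy, rfl⟩, hylt⟩ := exists_lt_of_lt_csSup hne
    (sub_lt_self (sSup (F 0 '' A)) hη)
  have hzV : deg (β z) (V z) = deg (β z) (cl (β z)) := by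
    refine top_labelE_restr_congr hT₀ (hcov₁ _) fun h hh => and_iff_left_of_imp fun hhc => ?_
    obtain ⟨z', hz', h1⟩ := hApp _ _ hh hhc
    have h2 := csInf_le hbb (Set.mem_image_of_mem _ hz')
    have h3 := hgap z h (hAc z hz) hh
    rw [abs_le] at h1
    rcases lt_abs.1 h3 with h | h <;> linarith
  have hyV : deg (β y) (V y) = 0 := by
    refine top_labelE_restr_empty hT₀ (hcov₁ _) fun h hh hhV => ?_
    obtain ⟨z', hz', h1⟩ := hApp _ _ hh hhV.1
    have h2 := le_csSup hba (Set.mem_image_of_mem _ hz')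
    have h3 := hgap y h (hAc y hy) hh
    have h4 := hhV.2
    rw [abs_le] at h1
    rcases lt_abs.1 h3 with h | h <;> linarith
  exact hclne (β z) (hzV ▸ (hVconst z hz).trans ((hVconst y hy).symm.trans hyV))

end Gap

section Approximate

variable {p : ℕ} [Fact p.Prime] {G H J : Type*} [Group G] [Group H]
  [PseudoMetricSpace G] [PseudoMetricSpace H] [IsIsometricSMul Gᵐᵒᵖ G] [IsIsometricSMul G G]
  [IsIsometricSMul Hᵐᵒᵖ H] [IsIsometricSMul H H]

theorem exists_nearly_equal (hG : ChainConnected G) (hH : ChainConnected H) (i : H →* G)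
    (hi : ∀ x y, dist (i x) (i y) = dist x y) {γ ν : H} (hγ : orderOf γ = p) {a r : ℕ}
    (ha : (a : ZMod p) ≠ 0) (hν : γ * ν = ν * γ ^ a) (hr : 0 < r) (hpr : p = 2 * r + 1)
    (har : ∀ k < r, (a : ZMod p) ^ r ≠ (a : ZMod p) ^ k) (w : G)
    {P : ZMod p → G → ℝ} {Q : J → G → ℝ} {σ : J → ZMod p}
    (hPγ : ∀ k g, P k (g * i γ) = P (k + 1) g) (hQi : ∀ j g h, Q j (g * i h) = Q j g)
    (hQw : ∀ j g, Q j (g * w) = P (σ j) g)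
    (huc : ∀ η > 0, ∃ ρ > 0, ∀ k x y, dist x y < ρ → |P k x - P k y| < η)
    {C : ℝ} (hC : ∀ g, |P 0 g| ≤ C) {δ : ℝ} (hδ : 0 < δ) :
    ∃ g, (∀ k, |P k g - P 0 g| ≤ δ) ∧ ∀ j, |Q j g - P 0 g| ≤ δ := by
  by_contra! hcon
  obtain ⟨ρ, hρ, huc⟩ := huc (δ / 20) (by positivity)
  have hγp : γ ^ p = 1 := hγ ▸ pow_orderOf_eq_one γ
  obtain ⟨T, hT, hTr, y, hy, hTy⟩ := exists_total_cycle hH (half_pos hρ) hγp ha hν hr har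
  have hdist : ∀ (b b' : G) (h h' : H),
      dist (b * i h) (b' * i h') ≤ dist b b' + dist h h' := fun b b' h h' => by
    refine (dist_triangle _ (b' * i h) _).trans ?_
    rw [dist_mul_right, dist_mul_left, hi]
  refine false_of_gap (F := fun k z => P k (z.1 * i z.2)) (β := fun z => z.1 * i z.2 * w)
    (η := δ / 20) (C := C) hG 1 hγ (half_pos hρ) (hT 0) (hT 1) ?_ ?_ ?_ ?_ (fun z => hC _) ?_ ?_
  · have := congrFun hTy 0
    rw [totalD_apply, Pi.single_eq_of_ne (by omega), pow_zero, one_smul, horiz, if_neg (by simp),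
      LinearMap.sub_apply, LinearMap.id_apply] at this
    rw [eq_neg_of_add_eq_zero_left this, neg_sub]
  · intro ℓ hℓ
    rw [top_labelE_eq hℓ hTy hTr]
    exact mul_ne_zero hy (top_quad_pow_mul_gen_ne_zero hpr)
  · intro k b h
    simp only
    rw [map_mul, ← mul_assoc, hPγ]
  · intro k b h b' h' hd
    exact huc k _ _ ((hdist _ _ _ _).trans_lt (by linarith))
  · intro z z'
    simp only [dist_mul_right]
    exact hdist _ _ _ _
  · intro z h hz hzh
    by_contra! hle
    obtain ⟨j, hj⟩ := hcon (z.1 * i z.2 * w * i h) fun k => (hzh k 0).trans (by linarith)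
    rw [hQi, hQw] at hj
    have h1 := hz (σ j) 0
    simp only at h1 hle
    rw [abs_le] at h1 hle
    rcases lt_abs.1 hj with h | h <;> linarith

end Approximate

lemma exists_primitive_root {p r : ℕ} [Fact p.Prime] (hpr : p = 2 * r + 1) (hr : 0 < r) :
    ∃ a : ℕ, (a : ZMod p) ≠ 0 ∧ ∀ k < r, (a : ZMod p) ^ r ≠ (a : ZMod p) ^ k := by
  obtain ⟨u, hu⟩ := IsCyclic.exists_generator (α := (ZMod p)ˣ)
  have ho : orderOf u = 2 * r := by
    rw [orderOf_eq_card_of_forall_mem_zpowers hu, Nat.card_eq_fintype_card,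
      ZMod.card_units_eq_totient, Nat.totient_prime Fact.out]
    omega
  refine ⟨(u : ZMod p).val, ?_, fun k hk h => ?_⟩
  · rw [ZMod.natCast_val, ZMod.cast_id]
    exact u.ne_zero
  · rw [ZMod.natCast_val, ZMod.cast_id, ← Units.val_pow_eq_pow_val, ← Units.val_pow_eq_pow_val,
      Units.val_inj] at h
    exact hk.ne (pow_injOn_Iio_orderOf (by simp [ho]; omega) (by simp [ho]; omega) h).symm

lemma ChainConnected.of_continuous {X : Type*} [PseudoMetricSpace X] {f : ℝ → X}
    (hf : Continuous f) {ε : ℝ} (hε : 0 < ε) (s t : ℝ) :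
    Relation.ReflTransGen (fun a b => dist a b < ε) (f s) (f t) := by
  set S : Set ℝ := {t | Relation.ReflTransGen (fun a b => dist a b < ε) (f s) (f t)} with hS
  have hloc : ∀ t, ∀ᶠ t' in nhds t, dist (f t') (f t) < ε := fun t =>
    hf.continuousAt.eventually (Metric.ball_mem_nhds _ hε)
  have ho : IsOpen S := isOpen_iff_mem_nhds.2 fun t ht => by
    filter_upwards [hloc t] with t' ht'
    exact Relation.ReflTransGen.tail ht (by rwa [dist_comm])
  have hc : IsClosed S := by
    rw [← isOpen_compl_iff, isOpen_iff_mem_nhds]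
    intro t ht
    filter_upwards [hloc t] with t' ht' hmem
    exact ht (Relation.ReflTransGen.tail hmem ht')
  have := IsClopen.eq_univ ⟨hc, ho⟩ ⟨s, (Relation.ReflTransGen.refl : s ∈ S)⟩
  exact (this ▸ Set.mem_univ t : t ∈ S)

section Isometries

variable {E : Type*} [NormedAddCommGroup E] [InnerProductSpace ℝ E]

/-- The operator norm distance on linear isometry equivalences. -/
noncomputable instance : PseudoMetricSpace (E ≃ₗᵢ[ℝ] E) :=
  PseudoMetricSpace.induced (fun g => (g.toContinuousLinearEquiv : E →L[ℝ] E)) inferInstance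

lemma dist_isometry_def (g g' : E ≃ₗᵢ[ℝ] E) :
    dist g g' = ‖(g.toContinuousLinearEquiv : E →L[ℝ] E)
      - (g'.toContinuousLinearEquiv : E →L[ℝ] E)‖ :=
  dist_eq_norm (g.toContinuousLinearEquiv : E →L[ℝ] E) g'.toContinuousLinearEquiv

lemma dist_apply_le (g g' : E ≃ₗᵢ[ℝ] E) (x : E) : dist (g x) (g' x) ≤ dist g g' * ‖x‖ := by
  rw [dist_isometry_def, dist_eq_norm]
  exact ContinuousLinearMap.le_opNorm ((g.toContinuousLinearEquiv : E →L[ℝ] E)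
      - (g'.toContinuousLinearEquiv : E →L[ℝ] E)) x

lemma dist_isometry_le {g g' : E ≃ₗᵢ[ℝ] E} {c : ℝ} (hc : 0 ≤ c)
    (h : ∀ x, dist (g x) (g' x) ≤ c * ‖x‖) : dist g g' ≤ c := by
  rw [dist_isometry_def]
  refine ContinuousLinearMap.opNorm_le_bound _ hc fun x => ?_
  have := h x
  rwa [dist_eq_norm] at this

instance : IsIsometricSMul (E ≃ₗᵢ[ℝ] E) (E ≃ₗᵢ[ℝ] E) := by
  have h : ∀ u g g' : E ≃ₗᵢ[ℝ] E, dist (u * g) (u * g') ≤ dist g g' := fun u g g' =>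
    dist_isometry_le dist_nonneg fun x => by
      simpa using dist_apply_le g g' x
  refine ⟨fun u => Isometry.of_dist_eq fun g g' => le_antisymm (h u g g') ?_⟩
  have := h u⁻¹ (u * g) (u * g')
  rwa [inv_mul_cancel_left, inv_mul_cancel_left] at this

instance : IsIsometricSMul (E ≃ₗᵢ[ℝ] E)ᵐᵒᵖ (E ≃ₗᵢ[ℝ] E) := by
  have h : ∀ u g g' : E ≃ₗᵢ[ℝ] E, dist (g * u) (g' * u) ≤ dist g g' := fun u g g' =>
    dist_isometry_le dist_nonneg fun x => by
      simpa using dist_apply_le g g' (u x)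
  refine ⟨fun u => Isometry.of_dist_eq fun g g' => le_antisymm (h u.unop g g') ?_⟩
  have := h u.unop⁻¹ (g * u.unop) (g' * u.unop)
  rwa [mul_inv_cancel_right, mul_inv_cancel_right] at this

instance (S : Subgroup (E ≃ₗᵢ[ℝ] E)) : IsIsometricSMul S S :=
  ⟨fun u => Isometry.of_dist_eq fun g g' => dist_mul_left (u : E ≃ₗᵢ[ℝ] E) g g'⟩

instance (S : Subgroup (E ≃ₗᵢ[ℝ] E)) : IsIsometricSMul Sᵐᵒᵖ S :=
  ⟨fun u => Isometry.of_dist_eq fun g g' =>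
    dist_mul_right (g : E ≃ₗᵢ[ℝ] E) g' (u.unop : E ≃ₗᵢ[ℝ] E)⟩

/-- The reflection in the hyperplane orthogonal to `u`. -/
noncomputable def refl (u : E) : E ≃ₗᵢ[ℝ] E := (ℝ ∙ u)ᗮ.reflection

lemma refl_apply {u : E} (hu : ‖u‖ = 1) (x : E) : refl u x = x - (2 * ⟪u, x⟫) • u := by
  have h := Submodule.reflection_singleton_apply (𝕜 := ℝ) u x
  have h' : (ℝ ∙ u)ᗮ.reflection x = -(ℝ ∙ u).reflection x :=
    Submodule.reflection_orthogonal_apply _ x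
  have h2 : refl u x = -(ℝ ∙ u).reflection x := h'
  rw [h2, h, hu, two_nsmul, ← add_smul]
  simp only [RCLike.ofReal_real_eq_id, id_eq, one_pow, div_one]
  module

lemma refl_neg {u : E} (hu : ‖u‖ = 1) : refl (-u) = refl u := by
  ext x
  rw [refl_apply hu, refl_apply (by rwa [norm_neg]), inner_neg_left]
  module

lemma refl_mul_self (u : E) : refl u * refl u = 1 := by
  exact Submodule.reflection_mul_reflection (ℝ ∙ u)ᗮ

lemma refl_apply_of_inner_eq_zero {u q : E} (hu : ‖u‖ = 1) (h : ⟪u, q⟫ = 0) : refl u q = q := by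
  rw [refl_apply hu, h]; simp

lemma dist_refl_le {u v : E} (hu : ‖u‖ = 1) (hv : ‖v‖ = 1) :
    dist (refl u) (refl v) ≤ 4 * dist u v := by
  refine dist_isometry_le (by positivity) fun x => ?_
  rw [refl_apply hu, refl_apply hv, dist_eq_norm, dist_eq_norm]
  have h : x - (2 * ⟪u, x⟫) • u - (x - (2 * ⟪v, x⟫) • v)
      = (2 * ⟪v - u, x⟫) • u + (2 * ⟪v, x⟫) • (v - u) := by
    rw [inner_sub_left]; module
  rw [h]
  refine (norm_add_le _ _).trans ?_
  rw [norm_smul, norm_smul, hu, norm_mul, norm_mul, norm_sub_rev u v]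
  have h1 := norm_inner_le_norm (𝕜 := ℝ) (v - u) x
  have h2 := norm_inner_le_norm (𝕜 := ℝ) v x
  rw [hv] at h2
  have h3 : ‖(2 : ℝ)‖ = 2 := by norm_num
  rw [h3]
  nlinarith [norm_nonneg (v - u), norm_nonneg x]

/-- The unit vectors orthogonal to `Q`. -/
def unitOrth (Q : Set E) : Set E := {u | ‖u‖ = 1 ∧ ∀ q ∈ Q, ⟪u, q⟫ = 0}

/-- The group generated by products of two reflections fixing `Q`. -/
noncomputable def rotations (Q : Set E) : Subgroup (E ≃ₗᵢ[ℝ] E) :=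
  Subgroup.closure {g | ∃ u ∈ unitOrth Q, ∃ v ∈ unitOrth Q, g = refl u * refl v}

lemma refl_mul_refl_mem {Q : Set E} {u v : E} (hu : u ∈ unitOrth Q) (hv : v ∈ unitOrth Q) :
    refl u * refl v ∈ rotations Q :=
  Subgroup.subset_closure ⟨u, hu, v, hv, rfl⟩

lemma rotations_mono {Q Q' : Set E} (h : Q ⊆ Q') : rotations Q' ≤ rotations Q :=
  Subgroup.closure_mono fun _ ⟨u, hu, v, hv, hg⟩ =>
    ⟨u, ⟨hu.1, fun q hq => hu.2 q (h hq)⟩, v, ⟨hv.1, fun q hq => hv.2 q (h hq)⟩, hg⟩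

lemma rotations_apply {Q : Set E} {g : E ≃ₗᵢ[ℝ] E} (hg : g ∈ rotations Q) {q : E} (hq : q ∈ Q) :
    g q = q := by
  induction hg using Subgroup.closure_induction with
  | mem g hg =>
    obtain ⟨u, hu, v, hv, rfl⟩ := hg
    rw [LinearIsometryEquiv.coe_mul, Function.comp_apply,
      refl_apply_of_inner_eq_zero hv.1 (hv.2 q hq), refl_apply_of_inner_eq_zero hu.1 (hu.2 q hq)]
  | one => rfl
  | mul g g' _ _ h h' => rw [LinearIsometryEquiv.coe_mul, Function.comp_apply, h', h]
  | inv g _ h =>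
    conv_lhs => rw [← h]
    exact g.symm_apply_apply q

lemma exists_path_unitOrth {Q : Set E} {u v : E} (hu : u ∈ unitOrth Q) (hv : v ∈ unitOrth Q)
    (h : 0 ≤ ⟪u, v⟫) :
    ∃ f : ℝ → E, Continuous f ∧ (∀ t, f t ∈ unitOrth Q) ∧ f 0 = u ∧ f 1 = v := by
  set w : ℝ → E := fun t => (1 - t) • u + t • v with hw
  have hw0 : ∀ t, w t ≠ 0 := fun t h0 => by
    have h1 : ‖w t‖ ^ 2 = (1 - t) ^ 2 + 2 * ((1 - t) * t * ⟪u, v⟫) + t ^ 2 := by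
      simp only [hw]
      rw [norm_add_sq_real, norm_smul, norm_smul, hu.1, hv.1, inner_smul_left, inner_smul_right]
      simp
      ring
    rw [h0, norm_zero] at h1
    have h2 : ⟪u, v⟫ ≤ 1 := by
      have := real_inner_le_norm u v
      rwa [hu.1, hv.1, one_mul] at this
    nlinarith [sq_nonneg (1 - 2 * t), mul_nonneg (sub_nonneg.2 h2) (sq_nonneg (1 - 2 * t))]
  have hwc : Continuous w := by fun_prop
  refine ⟨fun t => ‖w t‖⁻¹ • w t, ?_, fun t => ⟨?_, fun q hq => ?_⟩, ?_, ?_⟩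
  · exact (hwc.norm.inv₀ fun t => norm_ne_zero_iff.2 (hw0 t)).smul hwc
  · rw [norm_smul, norm_inv, norm_norm, inv_mul_cancel₀ (norm_ne_zero_iff.2 (hw0 t))]
  · simp only [hw]
    rw [inner_smul_left, inner_add_left, inner_smul_left, inner_smul_left, hu.2 q hq, hv.2 q hq]
    simp
  · simp [hw, hu.1]
  · simp [hw, hv.1]

lemma chainConnected_rotations (Q : Set E) : ChainConnected (rotations Q) := by
  intro ε hε
  have hmul : ∀ z x y : rotations Q, Relation.ReflTransGen (fun a b => dist a b < ε) x y →
      Relation.ReflTransGen (fun a b => dist a b < ε) (z * x) (z * y) := fun z x y h => by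
    induction h with
    | refl => exact .refl
    | tail _ h ih => exact ih.tail (by rwa [dist_mul_left])
  have hsymm : ∀ x y : rotations Q, Relation.ReflTransGen (fun a b => dist a b < ε) x y →
      Relation.ReflTransGen (fun a b => dist a b < ε) y x := fun x y h => by
    induction h with
    | refl => exact .refl
    | tail _ h ih => exact .head (by rwa [dist_comm]) ih
  have hone : ∀ g (hg : g ∈ rotations Q),
      Relation.ReflTransGen (fun a b : rotations Q => dist a b < ε) 1 ⟨g, hg⟩ := by
    intro g hg
    induction hg using Subgroup.closure_induction with
    | mem g hg =>
      obtain ⟨u, hu, v, hv, rfl⟩ := hg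
      obtain ⟨v', hv', hvv', hpos⟩ : ∃ v' ∈ unitOrth Q, refl v = refl v' ∧ 0 ≤ ⟪u, v'⟫ := by
        rcases le_total 0 ⟪u, v⟫ with h | h
        · exact ⟨v, hv, rfl, h⟩
        · exact ⟨-v, ⟨by rw [norm_neg, hv.1], fun q hq => by
            rw [inner_neg_left, hv.2 q hq, neg_zero]⟩,
            (refl_neg hv.1).symm, by rw [inner_neg_right]; linarith⟩
      obtain ⟨f, hf, hfu, hf0, hf1⟩ := exists_path_unitOrth hu hv' hpos
      have hc : Continuous fun t =>
          (⟨refl u * refl (f t), refl_mul_refl_mem hu (hfu t)⟩ : rotations Q) := by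
        refine continuous_iff_continuousAt.2 fun t => tendsto_iff_dist_tendsto_zero.2 ?_
        refine squeeze_zero (fun _ => dist_nonneg)
          (fun s => ?_)
          (by simpa using (tendsto_iff_dist_tendsto_zero.1 (hf.tendsto t)).const_mul 4)
        rw [Subtype.dist_eq]
        simp only [dist_mul_left]
        exact dist_refl_le (hfu s).1 (hfu t).1
      have := ChainConnected.of_continuous hc hε 0 1
      simp only [hf0, hf1, refl_mul_self, ← hvv'] at this
      exact this
    | one => exact .refl
    | mul g g' hg hg' h h' =>
      have := hmul ⟨g, hg⟩ _ _ h'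
      rw [mul_one] at this
      exact h.trans this
    | inv g hg h =>
      have := hmul ⟨g, hg⟩⁻¹ _ _ h
      rw [mul_one, inv_mul_cancel] at this
      exact hsymm _ _ this
  intro x y
  have := hmul x _ _ (hone (x⁻¹ * y : rotations Q) (x⁻¹ * y : rotations Q).2)
  rwa [mul_one, Subtype.coe_eta, mul_inv_cancel_left] at this

/-- Permutations acting by products of reflections act by rotations up to one reflection. -/
lemma map_perm_mem_rotations {κ : Type*} [Fintype κ] [DecidableEq κ] {Q : Set E}
    (φ : Equiv.Perm κ →* (E ≃ₗᵢ[ℝ] E))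
    (hφ : ∀ x y, x ≠ y → ∃ d ∈ unitOrth Q, φ (Equiv.swap x y) = refl d) (σ : Equiv.Perm κ) :
    (Equiv.Perm.sign σ = 1 ∧ φ σ ∈ rotations Q) ∨
      (Equiv.Perm.sign σ = -1 ∧ ∀ s ∈ unitOrth Q, φ σ * refl s ∈ rotations Q) := by
  induction σ using Equiv.Perm.swap_induction_on' with
  | one => exact .inl ⟨by simp, by simp⟩
  | mul_swap σ x y hxy ih =>
    obtain ⟨d, hd, hdφ⟩ := hφ x y hxy
    rcases ih with ⟨h1, h2⟩ | ⟨h1, h2⟩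
    · refine .inr ⟨by simp [h1, hxy], fun s hs => ?_⟩
      rw [map_mul, hdφ, mul_assoc]
      exact Subgroup.mul_mem _ h2 (refl_mul_refl_mem hd hs)
    · refine .inl ⟨by simp [h1, hxy], ?_⟩
      rw [map_mul, hdφ]
      exact h2 d hd

lemma refl_commute {g : E ≃ₗᵢ[ℝ] E} {s : E} (hs : ‖s‖ = 1) (hg : g s = s) :
    Commute g (refl s) := by
  have h : g * refl s = refl s * g := by
    ext x
    simp only [LinearIsometryEquiv.coe_mul, Function.comp_apply]
    rw [refl_apply hs, refl_apply hs, map_sub, map_smul, hg]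
    congr 3
    rw [← g.inner_map_map s x, hg]
  exact h

end Isometries

section Vertices

variable {ι : Type*}

/-- The action of permutations on Euclidean space by permuting coordinates. -/
noncomputable def permIsometry [Fintype ι] :
     Equiv.Perm ι →* (EuclideanSpace ℝ ι ≃ₗᵢ[ℝ] EuclideanSpace ℝ ι) where
  toFun σ := LinearIsometryEquiv.piLpCongrLeft 2 ℝ ℝ σ
  map_one' := by ext; rfl
  map_mul' _ _ := by ext; rfl

lemma permIsometry_apply [Fintype ι] (σ : Equiv.Perm ι) (v : EuclideanSpace ℝ ι) (i : ι) :
    permIsometry σ v i = v (σ.symm i) := rfl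

/-- A symmetric family of vectors in Euclidean space. -/
noncomputable def vertex [DecidableEq ι] (α β : ℝ) (i : ι) : EuclideanSpace ℝ ι :=
  WithLp.toLp 2 fun k => (if k = i then α else 0) + β

lemma vertex_apply [DecidableEq ι] (α β : ℝ) (i k : ι) :
    vertex α β i k = (if k = i then α else 0) + β := rfl

variable [Fintype ι] [DecidableEq ι]

lemma inner_vertex (α β : ℝ) (i : ι) (v : EuclideanSpace ℝ ι) :
    ⟪v, vertex α β i⟫ = α * v i + β * ∑ k, v k := by
  simp [PiLp.inner_apply, vertex_apply, add_mul, Finset.sum_add_distrib, Finset.mul_sum]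

lemma permIsometry_vertex (α β : ℝ) (σ : Equiv.Perm ι) (i : ι) :
    permIsometry σ (vertex α β i) = vertex α β (σ i) := by
  ext k
  simp [permIsometry_apply, vertex_apply, Equiv.symm_apply_eq]

lemma inner_vertex_vertex (α β : ℝ) (i j : ι) :
    ⟪vertex α β i, vertex α β j⟫
      = (if j = i then α ^ 2 else 0) + (2 * α * β + Fintype.card ι * β ^ 2) := by
  simp only [inner_vertex, vertex_apply, Finset.sum_add_distrib, Finset.sum_ite_eq',
    Finset.mem_univ, if_true, Finset.sum_const, Finset.card_univ, nsmul_eq_mul]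
  split_ifs <;> ring

lemma exists_swap_eq_refl (α β : ℝ) {x y : ι} (h : x ≠ y) :
    ∃ d ∈ unitOrth {q | ∃ k, k ≠ x ∧ k ≠ y ∧ q = vertex α β k},
      permIsometry (Equiv.swap x y) = refl d := by
  set d : EuclideanSpace ℝ ι :=
    (√2)⁻¹ • (EuclideanSpace.single x 1 - EuclideanSpace.single y 1) with hd
  have h2 : (√2)⁻¹ * (√2)⁻¹ = (2 : ℝ)⁻¹ := by
    rw [← mul_inv, Real.mul_self_sqrt (by norm_num)]
  have hin : ∀ v : EuclideanSpace ℝ ι, ⟪d, v⟫ = (√2)⁻¹ * (v x - v y) := fun v => by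
    rw [hd, inner_smul_left, inner_sub_left, EuclideanSpace.inner_single_left,
      EuclideanSpace.inner_single_left]
    simp
  have hn : ‖d‖ = 1 := by
    have h1 : ‖d‖ ^ 2 = 1 := by
      rw [← real_inner_self_eq_norm_sq, hin]
      simp only [hd, PiLp.smul_apply, PiLp.sub_apply, PiLp.single_apply, if_true,
        if_neg h, if_neg h.symm, smul_eq_mul]
      linear_combination 2 * h2
    exact (pow_eq_one_iff_of_nonneg (norm_nonneg d) two_ne_zero).1 h1
  refine ⟨d, ⟨hn, ?_⟩, ?_⟩
  · rintro _ ⟨k, hkx, hky, rfl⟩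
    simp [hin, vertex_apply, hkx.symm, hky.symm]
  · ext v k
    rw [permIsometry_apply, refl_apply hn, hin, Equiv.symm_swap]
    simp only [hd, PiLp.smul_apply, PiLp.sub_apply, PiLp.single_apply, smul_eq_mul]
    rcases eq_or_ne k x with rfl | hkx
    · rw [Equiv.swap_apply_left, if_pos rfl, if_neg h]
      linear_combination (2 * (v k - v y)) * h2
    rcases eq_or_ne k y with rfl | hky
    · rw [Equiv.swap_apply_right, if_pos rfl, if_neg h.symm]
      linear_combination (-2 * (v x - v k)) * h2
    · rw [Equiv.swap_apply_of_ne_of_ne hkx hky, if_neg hkx, if_neg hky]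
      ring

/-- Coefficients making `vertex` a family of simplex vertices. -/
lemma exists_simplex_coeffs {N : ℕ} (hN : 0 < N) :
    ∃ α β : ℝ, 0 < α ∧ 0 < N * β + α ∧ 2 * α * β + N * β ^ 2 = -1 / N ∧
      α ^ 2 + (2 * α * β + N * β ^ 2) = 1 := by
  have hN' : (0 : ℝ) < N := by exact_mod_cast hN
  have hs := Real.sq_sqrt (show (0 : ℝ) ≤ 1 + 1 / N by positivity)
  have ht := Real.sq_sqrt (show (0 : ℝ) ≤ 1 / N by positivity)
  set α := √(1 + 1 / (N : ℝ))
  set τ := √(1 / (N : ℝ)) with hτ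
  have hmain : 2 * α * ((τ - α) / N) + N * ((τ - α) / N) ^ 2 = -1 / N := by
    field_simp
    field_simp at hs ht
    nlinarith
  refine ⟨α, (τ - α) / N, Real.sqrt_pos.2 (by positivity), ?_, hmain, ?_⟩
  · rw [mul_div_cancel₀ _ hN'.ne', sub_add_cancel]
    exact Real.sqrt_pos.2 (by positivity)
  · rw [hmain, hs]
    ring

end Vertices

lemma exists_uniform_modulus {E : Type*} [NormedAddCommGroup E] [InnerProductSpace ℝ E]
    [ProperSpace E] {f : E → ℝ} (hf : ContinuousOn f (Metric.sphere 0 1)) {η : ℝ} (hη : 0 < η) :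
    ∃ ρ > 0, ∀ v, ‖v‖ = 1 → ∀ x y : E ≃ₗᵢ[ℝ] E, dist x y < ρ → |f (x v) - f (y v)| < η := by
  have huc := (isCompact_sphere (0 : E) 1).uniformContinuousOn_of_continuous hf
  obtain ⟨ρ, hρ, h⟩ := Metric.uniformContinuousOn_iff.1 huc η hη
  refine ⟨ρ, hρ, fun v hv x y hxy => ?_⟩
  rw [← Real.dist_eq]
  refine h _ (by simp [hv]) _ (by simp [hv]) ((dist_apply_le x y v).trans_lt ?_)
  rwa [hv, mul_one]

lemma addRight_one_pow_self (p : ℕ) : Equiv.addRight (1 : ZMod p) ^ p = 1 :=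
  Equiv.ext fun k => by simp

lemma sign_addRight_one {p : ℕ} [Fact p.Prime] (hp : Odd p) :
    Equiv.Perm.sign (Equiv.addRight (1 : ZMod p)) = 1 := by
  have h1 : Equiv.Perm.sign (Equiv.addRight (1 : ZMod p)) ^ p = 1 := by
    rw [← map_pow, addRight_one_pow_self, map_one]
  rcases Int.units_eq_one_or (Equiv.Perm.sign (Equiv.addRight (1 : ZMod p))) with h2 | h2
  · exact h2
  · rw [h2, hp.neg_one_pow] at h1
    exact absurd h1 (by decide)

theorem exists_nearly_equal_simplex {p r : ℕ} [Fact p.Prime] (hr : 0 < r) (hpr : p = 2 * r + 1)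
    {J : Type*} [Fintype J] [DecidableEq J] (hJ : Fintype.card J ≤ p)
    {f : EuclideanSpace ℝ (J ⊕ ZMod p) → ℝ} (hf : ContinuousOn f (Metric.sphere 0 1))
    {δ : ℝ} (hδ : 0 < δ) :
    ∃ q : J ⊕ ZMod p → EuclideanSpace ℝ (J ⊕ ZMod p), (∀ i, ‖q i‖ = 1) ∧
      (∀ i j, i ≠ j → ⟪q i, q j⟫ = -1 / (Fintype.card (J ⊕ ZMod p) : ℝ)) ∧
      ∀ i, |f (q i) - f (q (.inr 0))| ≤ δ := by
  obtain ⟨α, β, hα, hβ, hαβ, hαβ1⟩ :=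
    exists_simplex_coeffs (N := Fintype.card (J ⊕ ZMod p)) Fintype.card_pos
  set V : J ⊕ ZMod p → EuclideanSpace ℝ (J ⊕ ZMod p) := vertex α β with hV
  have hVV : ∀ i j, i ≠ j → ⟪V i, V j⟫ = -1 / (Fintype.card (J ⊕ ZMod p) : ℝ) := fun i j h => by
    rw [hV, inner_vertex_vertex, if_neg h.symm, zero_add, hαβ]
  have hV1 : ∀ i, ‖V i‖ = 1 := fun i => by
    refine (pow_eq_one_iff_of_nonneg (norm_nonneg _) two_ne_zero).1 ?_
    rw [← real_inner_self_eq_norm_sq, hV, inner_vertex_vertex, if_pos rfl, hαβ1]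
  set Q₀ : Set (EuclideanSpace ℝ (J ⊕ ZMod p)) := Set.range fun j => V (.inl j) with hQ₀
  set φ : Equiv.Perm (ZMod p) →*
      (EuclideanSpace ℝ (J ⊕ ZMod p) ≃ₗᵢ[ℝ] EuclideanSpace ℝ (J ⊕ ZMod p)) :=
    permIsometry.comp ((Equiv.Perm.sumCongrHom J (ZMod p)).comp (MonoidHom.inr _ _)) with hφ
  have hφr : ∀ σ k, φ σ (V (.inr k)) = V (.inr (σ k)) := fun σ k => permIsometry_vertex _ _ _ _
  have hφl : ∀ σ j, φ σ (V (.inl j)) = V (.inl j) := fun σ j => permIsometry_vertex _ _ _ _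
  have hφs : ∀ x y, x ≠ y → ∃ d ∈ unitOrth Q₀, φ (Equiv.swap x y) = refl d := fun x y hxy => by
    obtain ⟨d, hd, h⟩ := exists_swap_eq_refl α β
      (x := (.inr x : J ⊕ ZMod p)) (y := .inr y) (by simpa using hxy)
    refine ⟨d, ⟨hd.1, ?_⟩, ?_⟩
    · rintro _ ⟨j, rfl⟩
      exact hd.2 _ ⟨.inl j, by simp, by simp, rfl⟩
    · rw [← h]
      exact congrArg permIsometry (Equiv.Perm.sumCongr_one_swap x y)
  have hψs : ∀ x y : J ⊕ ZMod p, x ≠ y →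
      ∃ d ∈ unitOrth ∅, permIsometry (Equiv.swap x y) = refl d := fun x y hxy => by
    obtain ⟨d, hd, h⟩ := exists_swap_eq_refl α β hxy
    exact ⟨d, ⟨hd.1, by simp⟩, h⟩
  obtain ⟨s, hs, hφfix⟩ : ∃ s ∈ unitOrth Q₀, ∀ σ, φ σ s = s := by
    set A : ℝ := α + β * Fintype.card J with hA
    set B : ℝ := β * p with hB
    have hA0 : 0 < A := by
      rw [Fintype.card_sum, ZMod.card] at hβ
      push_cast at hβ
      have hp0 : (0 : ℝ) < p := by exact_mod_cast (Fact.out : p.Prime).pos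
      have hj0 : (0 : ℝ) ≤ Fintype.card J := by positivity
      by_contra h
      nlinarith [mul_nonneg hj0 hβ.le, mul_pos hp0 hα]
    set s₀ : EuclideanSpace ℝ (J ⊕ ZMod p) := WithLp.toLp 2 (Sum.elim (fun _ => -B) fun _ => A)
      with hs₀
    have hs0 : s₀ ≠ 0 := fun h => by
      have : s₀ (.inr 0) = 0 := by rw [h]; rfl
      exact hA0.ne' this
    refine ⟨‖s₀‖⁻¹ • s₀, ⟨?_, ?_⟩, fun σ => ?_⟩
    · rw [norm_smul, norm_inv, norm_norm, inv_mul_cancel₀ (norm_ne_zero_iff.2 hs0)]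
    · rintro _ ⟨j, rfl⟩
      have h1 : ⟪s₀, V (.inl j)⟫ = 0 := by
        rw [hV, inner_vertex]
        simp only [hs₀, Fintype.sum_sum_type, Sum.elim_inl, Sum.elim_inr, Finset.sum_const,
          Finset.card_univ, nsmul_eq_mul, ZMod.card]
        rw [hA, hB]
        ring
      rw [inner_smul_left, h1, mul_zero]
    · rw [map_smul]
      congr 1
      ext i
      rcases i with j | k <;> rfl
  have hsV : ∀ j, refl s (V (.inl j)) = V (.inl j) := fun j =>
    refl_apply_of_inner_eq_zero hs.1 (hs.2 _ ⟨j, rfl⟩)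
  obtain ⟨a, ha, har⟩ := exists_primitive_root hpr hr
  have hγm : φ (Equiv.addRight 1) ∈ rotations Q₀ := by
    rcases map_perm_mem_rotations φ hφs (Equiv.addRight 1) with h | h
    · exact h.2
    · have := sign_addRight_one (p := p) ⟨r, hpr⟩
      rw [h.1] at this
      exact absurd this (by decide)
  set γ : rotations Q₀ := ⟨φ (Equiv.addRight 1), hγm⟩ with hγ
  have hcomm : ∀ ν : EuclideanSpace ℝ (J ⊕ ZMod p) ≃ₗᵢ[ℝ] EuclideanSpace ℝ (J ⊕ ZMod p),
      (ν = φ (Equiv.mulLeft₀ (a : ZMod p)⁻¹ (inv_ne_zero ha)) ∨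
        ν = φ (Equiv.mulLeft₀ (a : ZMod p)⁻¹ (inv_ne_zero ha)) * refl s) →
      φ (Equiv.addRight 1) * ν = ν * φ (Equiv.addRight 1) ^ a := by
    have h : φ (Equiv.addRight 1) * φ (Equiv.mulLeft₀ (a : ZMod p)⁻¹ (inv_ne_zero ha))
        = φ (Equiv.mulLeft₀ (a : ZMod p)⁻¹ (inv_ne_zero ha)) * φ (Equiv.addRight 1) ^ a := by
      rw [← map_pow, ← map_mul, ← map_mul]
      congr 1
      ext k
      simp [mul_add, ha]
    rintro ν (rfl | rfl)
    · exact h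
    · rw [← mul_assoc, h, mul_assoc, mul_assoc, ← map_pow, (refl_commute hs.1 (hφfix _)).eq]
  obtain ⟨ν, hνm, hν⟩ : ∃ ν ∈ rotations Q₀,
      φ (Equiv.addRight 1) * ν = ν * φ (Equiv.addRight 1) ^ a := by
    rcases map_perm_mem_rotations φ hφs (Equiv.mulLeft₀ (a : ZMod p)⁻¹ (inv_ne_zero ha)) with h | h
    · exact ⟨_, h.2, hcomm _ (.inl rfl)⟩
    · exact ⟨_, h.2 s hs, hcomm _ (.inr rfl)⟩
  obtain ⟨τ⟩ := Function.Embedding.nonempty_of_card_le (hJ.trans (ZMod.card p).ge)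
  obtain ⟨w, hwm, hw⟩ : ∃ w ∈ rotations (∅ : Set (EuclideanSpace ℝ (J ⊕ ZMod p))),
      ∀ j, w (V (.inl j)) = V (.inr (τ j)) := by
    set σ : Equiv.Perm (J ⊕ ZMod p) := Equiv.extendSubtype
      ((Equiv.ofInjective _ Sum.inl_injective).symm.trans
        (Equiv.ofInjective _ (Sum.inr_injective.comp τ.injective))) with hσ
    have hσj : ∀ j, σ (.inl j) = .inr (τ j) := fun j => by
      rw [hσ, Equiv.extendSubtype_apply_of_mem _ _ ⟨j, rfl⟩]
      simp
    have hj : ∀ j, permIsometry σ (V (.inl j)) = V (.inr (τ j)) := fun j => by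
      rw [hV, permIsometry_vertex, hσj]
    rcases map_perm_mem_rotations permIsometry hψs σ with h | h
    · exact ⟨_, h.2, hj⟩
    · refine ⟨_, h.2 s ⟨hs.1, by simp⟩, fun j => ?_⟩
      rw [LinearIsometryEquiv.coe_mul, Function.comp_apply, hsV, hj]
  obtain ⟨C, hC⟩ := (isCompact_sphere _ _).exists_bound_of_continuousOn hf
  have hmem : ∀ (g : EuclideanSpace ℝ (J ⊕ ZMod p) ≃ₗᵢ[ℝ] EuclideanSpace ℝ (J ⊕ ZMod p)) i,
      g (V i) ∈ Metric.sphere 0 1 := fun g i => by simp [hV1]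
  have hγp : orderOf γ = p := by
    refine orderOf_eq_prime (Subtype.ext ?_) fun h => ?_
    · change φ (Equiv.addRight 1) ^ p = 1
      rw [← map_pow, addRight_one_pow_self, map_one]
    · have h1 : φ (Equiv.addRight 1) = 1 := congrArg Subtype.val h
      have h2 := hφr (Equiv.addRight 1) 0
      rw [h1] at h2
      have h3 : V (.inr 0) = V (.inr 1) := by simpa using h2
      have h4 := congrArg (fun v : EuclideanSpace ℝ (J ⊕ ZMod p) => v (.inr 0)) h3
      simp only [hV, vertex_apply, if_true] at h4
      rw [if_neg (by simp)] at h4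
      linarith
  obtain ⟨g, hg1, hg2⟩ := exists_nearly_equal
    (G := rotations (∅ : Set (EuclideanSpace ℝ (J ⊕ ZMod p)))) (H := rotations Q₀)
    (chainConnected_rotations _) (chainConnected_rotations _)
    (Subgroup.inclusion (rotations_mono (Set.empty_subset Q₀))) (fun _ _ => rfl) hγp ha
    (ν := ⟨ν, hνm⟩) (Subtype.ext hν) hr hpr har ⟨w, hwm⟩
    (P := fun k g => f (g.1 (V (.inr k)))) (Q := fun j g => f (g.1 (V (.inl j)))) (σ := τ)
    (fun k g => congrArg (fun v => f (g.1 v)) (hφr _ k))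
    (fun j g h => congrArg (fun v => f (g.1 v)) (rotations_apply h.2 ⟨j, rfl⟩))
    (fun j g => congrArg (fun v => f (g.1 v)) (hw j))
    (fun η hη => by
      obtain ⟨ρ, hρ, h⟩ := exists_uniform_modulus hf hη
      exact ⟨ρ, hρ, fun k x y hxy => h _ (hV1 _) x.1 y.1 hxy⟩)
    (fun g => hC _ (hmem g.1 _)) hδ
  refine ⟨fun i => g.1 (V i), fun i => by simp [hV1], fun i j hij => ?_, ?_⟩
  · rw [LinearIsometryEquiv.inner_map_map, hVV i j hij]
  · rintro (j | k)
    · exact hg2 j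
    · exact hg1 k

lemma exists_equal_of_nearly_equal {ι E : Type*} [Fintype ι] [NormedAddCommGroup E]
    [InnerProductSpace ℝ E] [ProperSpace E] {f : E → ℝ} (hf : ContinuousOn f (Metric.sphere 0 1))
    (c : ℝ) (i₀ : ι)
    (h : ∀ δ > 0, ∃ q : ι → E, (∀ i, ‖q i‖ = 1) ∧ (∀ i j, i ≠ j → ⟪q i, q j⟫ = c) ∧
      ∀ i, |f (q i) - f (q i₀)| ≤ δ) :
    ∃ q : ι → E, (∀ i, ‖q i‖ = 1) ∧ (∀ i j, i ≠ j → ⟪q i, q j⟫ = c) ∧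
      ∀ i, f (q i) = f (q i₀) := by
  set K : Set (ι → E) := Set.univ.pi (fun _ => Metric.sphere 0 1) ∩
    {q | ∀ i j, i ≠ j → ⟪q i, q j⟫ = c} with hK
  have hmem : ∀ q, q ∈ K ↔ (∀ i, ‖q i‖ = 1) ∧ ∀ i j, i ≠ j → ⟪q i, q j⟫ = c := by
    simp [hK]
  have hKc : IsCompact K := by
    refine (isCompact_univ_pi fun _ => isCompact_sphere 0 1).inter_right ?_
    simp only [Set.ofPred_forall]
    exact isClosed_iInter fun i => isClosed_iInter fun j => isClosed_iInter fun _ =>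
      isClosed_eq (by fun_prop) continuous_const
  have hfc : ∀ i, ContinuousOn (fun q : ι → E => f (q i)) K := fun i =>
    hf.comp (continuous_apply i).continuousOn fun q hq => by simpa using ((hmem q).1 hq).1 i
  have hF : ContinuousOn (fun q : ι → E => ∑ i, |f (q i) - f (q i₀)|) K :=
    continuousOn_finsetSum _ fun i _ => ((hfc i).sub (hfc i₀)).abs
  obtain ⟨q₁, h1, h2, -⟩ := h 1 one_pos
  obtain ⟨q, hq, hmin⟩ := hKc.exists_isMinOn ⟨q₁, (hmem q₁).2 ⟨h1, h2⟩⟩ hF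
  have hle : ∑ i, |f (q i) - f (q i₀)| ≤ 0 := by
    refine le_of_forall_pos_le_add fun ε hε => ?_
    have hN : (0 : ℝ) < Fintype.card ι := by exact_mod_cast Fintype.card_pos_iff.2 ⟨i₀⟩
    obtain ⟨q', h1, h2, h3⟩ := h (ε / Fintype.card ι) (by positivity)
    refine (hmin ((hmem q').2 ⟨h1, h2⟩)).trans ((Finset.sum_le_sum fun i _ => h3 i).trans ?_)
    rw [Finset.sum_const, Finset.card_univ, nsmul_eq_mul, mul_div_cancel₀ _ hN.ne', zero_add]
  refine ⟨q, ((hmem q).1 hq).1, ((hmem q).1 hq).2, fun i => ?_⟩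
  have := (Finset.single_le_sum (fun i _ => abs_nonneg (f (q i) - f (q i₀)))
    (Finset.mem_univ i)).trans hle
  exact sub_eq_zero.1 (abs_nonpos_iff.1 this)

lemma exists_equal_on_circle {f : EuclideanSpace ℝ (Fin 2) → ℝ}
    (hf : ContinuousOn f (Metric.sphere 0 1)) :
    ∃ u v : EuclideanSpace ℝ (Fin 2), ‖u‖ = 1 ∧ ‖v‖ = 1 ∧ ⟪u, v⟫ = -1 / 2 ∧ f u = f v := by
  set q : ℝ → EuclideanSpace ℝ (Fin 2) := fun θ => !₂[Real.cos θ, Real.sin θ] with hq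
  have hinner : ∀ θ θ', ⟪q θ, q θ'⟫ = Real.cos (θ' - θ) := fun θ θ' => by
    simp [hq, PiLp.inner_apply, Real.cos_sub]
  have hq1 : ∀ θ, ‖q θ‖ = 1 := fun θ => by
    refine (pow_eq_one_iff_of_nonneg (norm_nonneg _) two_ne_zero).1 ?_
    rw [← real_inner_self_eq_norm_sq, hinner, sub_self, Real.cos_zero]
  have hqc : Continuous q := by
    refine (PiLp.continuous_toLp 2 _).comp (continuous_pi fun i => ?_)
    fin_cases i
    · exact Real.continuous_cos
    · exact Real.continuous_sin
  have hfq : Continuous fun θ => f (q θ) :=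
    hf.comp_continuous hqc fun θ => by simp [hq1]
  set c : ℝ := 2 * (Real.pi / 3) with hc
  set h : ℝ → ℝ := fun θ => f (q θ) - f (q (θ + c)) with hh
  have hhc : Continuous h := hfq.sub (hfq.comp (continuous_add_const c))
  have hsum : h 0 + h c + h (c + c) = 0 := by
    have h3 : q (c + c + c) = q 0 := by
      have : c + c + c = 2 * Real.pi := by rw [hc]; ring
      simp [hq, this]
    simp only [hh, h3, zero_add]
    ring
  have hcos : Real.cos c = -1 / 2 := by
    rw [hc, Real.cos_two_mul, Real.cos_pi_div_three]
    norm_num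
  obtain ⟨θ, hθ⟩ : ∃ θ, h θ = 0 := by
    refine mem_range_of_exists_le_of_exists_ge hhc ?_ ?_ <;> by_contra! hcon
    · linarith [hcon 0, hcon c, hcon (c + c)]
    · linarith [hcon 0, hcon c, hcon (c + c)]
  refine ⟨q θ, q (θ + c), hq1 _, hq1 _, ?_, sub_eq_zero.1 hθ⟩
  rw [hinner, add_sub_cancel_left, hcos]

lemma exists_odd_prime_between {n : ℕ} (hn : 3 ≤ n) :
    ∃ p, p.Prime ∧ 3 ≤ p ∧ p ≤ n ∧ n ≤ 2 * p := by
  rcases Nat.lt_or_ge n 6 with h | h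
  · exact ⟨3, Nat.prime_three, le_rfl, hn, by omega⟩
  · obtain ⟨p, hp, h1, h2⟩ := Nat.exists_prime_lt_and_le_two_mul (n / 2) (by omega)
    exact ⟨p, hp, by omega, by omega, by omega⟩

end Knaster

/-- **Knaster's conjecture for `n` vertices of a regular simplex** (Theorem 3 of the paper):
for any continuous real-valued function `f` on the unit sphere `S^{n-1} ⊆ ℝ^n`, there exist
`n` unit vectors with pairwise inner products `-1/n` (that is, `n` of the `n+1` vertices of a
regular simplex inscribed in the sphere) on which `f` takes a common value `f₀`. -/
theorem knaster_simplex (n : ℕ) (hn : 2 ≤ n)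
    (f : EuclideanSpace ℝ (Fin n) → ℝ)
    (hf : ContinuousOn f (Metric.sphere (0 : EuclideanSpace ℝ (Fin n)) 1)) :
    ∃ (p : Fin n → EuclideanSpace ℝ (Fin n)) (f₀ : ℝ),
      (∀ i, ‖p i‖ = 1) ∧
      (∀ i j, i ≠ j → ⟪p i, p j⟫ = -1 / n) ∧
      (∀ i, f (p i) = f₀) := by
  rcases hn.eq_or_lt with rfl | hn
  · obtain ⟨u, v, hu, hv, huv, hfe⟩ := Knaster.exists_equal_on_circle hf
    refine ⟨![u, v], f v, ?_, ?_, ?_⟩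
    · simp [Fin.forall_fin_two, hu, hv]
    · have hvu := huv
      rw [real_inner_comm] at hvu
      simp [Fin.forall_fin_two, huv, hvu]
    · simp [Fin.forall_fin_two, hfe]
  · obtain ⟨p, hp, h3, hpn, hnp⟩ := Knaster.exists_odd_prime_between hn
    have : Fact p.Prime := ⟨hp⟩
    obtain ⟨r, hpr⟩ := hp.odd_of_ne_two (by omega)
    have hcard : Fintype.card (Fin (n - p) ⊕ ZMod p) = n := by
      rw [Fintype.card_sum, Fintype.card_fin, ZMod.card]
      omega
    set e : Fin (n - p) ⊕ ZMod p ≃ Fin n := Fintype.equivFinOfCardEq hcard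
    set U := LinearIsometryEquiv.piLpCongrLeft 2 ℝ ℝ e
    have hfU : ContinuousOn (fun x => f (U x)) (Metric.sphere 0 1) :=
      hf.comp U.continuous.continuousOn fun x hx => by simpa using hx
    obtain ⟨q, h1, h2, h3⟩ := Knaster.exists_equal_of_nearly_equal hfU _ (Sum.inr 0) fun δ hδ =>
      Knaster.exists_nearly_equal_simplex (r := r) (by omega) hpr
        (by rw [Fintype.card_fin]; omega) hfU hδ
    refine ⟨fun i => U (q (e.symm i)), f (U (q (.inr 0))), fun i => ?_, fun i j hij => ?_,
      fun i => h3 _⟩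
    · rw [LinearIsometryEquiv.norm_map, h1]
    · rw [LinearIsometryEquiv.inner_map_map, h2 _ _ (e.symm.injective.ne hij), hcard]
end

section
/- Let n ≥ 2 and let p_1, p_2 be unit vectors in ℝ^n with ⟨p_1, p_2⟩ = -1/n. Set c = n/√(n²-1), p' = c(p_2 + p_1/n). Then ‖p'‖ = 1, ⟨p', p_1⟩ = 0, and for every unit vector x ∈ ℝ^n with ⟨x, p_1⟩ = -1/n, the vector q = c(x + p_1/n) satisfies ‖q‖ = 1 and ⟨q, p_1⟩ = 0, and moreover ⟨x, p_2⟩ = -1/n if and only if ⟨q, p'⟩ = -1/(n-1). -/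
open RealInnerProductSpace

section

variable {E : Type*} [NormedAddCommGroup E] [InnerProductSpace ℝ E]

/-- Adding `a • p` to a vector whose inner product with the unit vector `p` is `-a` gives a vector
orthogonal to `p`. -/
lemma inner_smul_add_smul_eq_zero {p x : E} {a : ℝ} (c : ℝ) (hp : ‖p‖ = 1) (hx : ⟪x, p⟫ = -a) :
    ⟪c • (x + a • p), p⟫ = 0 := by
  simp [inner_smul_left, inner_add_left, hx, hp]

/-- The inner product of two translated and rescaled vectors with the same component along the
unit vector `p`. -/
lemma inner_smul_add_smul_smul_add_smul {p x y : E} {a : ℝ} (c : ℝ) (hp : ‖p‖ = 1)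
    (hx : ⟪x, p⟫ = -a) (hy : ⟪y, p⟫ = -a) :
    ⟪c • (x + a • p), c • (y + a • p)⟫ = c ^ 2 * (⟪x, y⟫ - a ^ 2) := by
  have hy' : ⟪p, y⟫ = -a := by rw [real_inner_comm, hy]
  have hpp : ⟪p, p⟫ = 1 := by rw [real_inner_self_eq_norm_sq, hp, one_pow]
  simp only [inner_smul_left, inner_smul_right, inner_add_left, inner_add_right, hx, hy', hpp,
    conj_trivial]
  ring

/-- A unit vector whose component along the unit vector `p` is `-a` is carried to a unit vector
when the scaling factor `c` satisfies `c ^ 2 * (1 - a ^ 2) = 1`. -/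
lemma norm_smul_add_smul_eq_one {p x : E} {a c : ℝ} (hp : ‖p‖ = 1) (hx : ‖x‖ = 1)
    (hxp : ⟪x, p⟫ = -a) (hc : c ^ 2 * (1 - a ^ 2) = 1) : ‖c • (x + a • p)‖ = 1 := by
  have h := inner_smul_add_smul_smul_add_smul c hp hxp hxp
  rw [real_inner_self_eq_norm_sq, real_inner_self_eq_norm_sq, hx, one_pow, hc] at h
  exact (pow_eq_one_iff_of_nonneg (norm_nonneg _) two_ne_zero).mp h

end

/-- The reduction step in Lemma 2 of the paper: translating by `p₁/n` and rescaling by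
`c = n/√(n² - 1)` carries the subspace `J₃` to a set of the same form as `J₂` in one lower
dimension, the angular constant `-1/n` being replaced by `-1/(n-1)`. -/
theorem simplex_reduction_step (n : ℕ) (hn : 2 ≤ n)
    (p₁ p₂ : EuclideanSpace ℝ (Fin n)) (hp₁ : ‖p₁‖ = 1) (hp₂ : ‖p₂‖ = 1)
    (h12 : ⟪p₁, p₂⟫ = -1 / n) :
    let c : ℝ := n / Real.sqrt ((n : ℝ) ^ 2 - 1)
    let p' : EuclideanSpace ℝ (Fin n) := c • (p₂ + (n : ℝ)⁻¹ • p₁)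
    ‖p'‖ = 1 ∧ ⟪p', p₁⟫ = 0 ∧
      ∀ x : EuclideanSpace ℝ (Fin n), ‖x‖ = 1 → ⟪x, p₁⟫ = -1 / n →
        let q : EuclideanSpace ℝ (Fin n) := c • (x + (n : ℝ)⁻¹ • p₁)
        ‖q‖ = 1 ∧ ⟪q, p₁⟫ = 0 ∧ (⟪x, p₂⟫ = -1 / n ↔ ⟪q, p'⟫ = -1 / (n - 1 : ℝ)) := by
  intro c p'
  have hn' : (2 : ℝ) ≤ n := by exact_mod_cast hn
  have hn0 : (n : ℝ) ≠ 0 := by positivity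
  have hn1 : (n : ℝ) - 1 ≠ 0 := by linarith
  have hpos : (0 : ℝ) < (n : ℝ) ^ 2 - 1 := by nlinarith
  have hdiv : (-1 : ℝ) / n = -(n : ℝ)⁻¹ := by ring
  have hc2 : c ^ 2 = (n : ℝ) ^ 2 / ((n : ℝ) ^ 2 - 1) := by
    rw [div_pow, Real.sq_sqrt hpos.le]
  have hc : c ^ 2 * (1 - ((n : ℝ)⁻¹) ^ 2) = 1 := by
    rw [hc2]
    field_simp [hpos.ne']
  have hc0 : c ^ 2 ≠ 0 := left_ne_zero_of_mul_eq_one hc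
  have h21 : ⟪p₂, p₁⟫ = -(n : ℝ)⁻¹ := by rw [real_inner_comm, h12, hdiv]
  refine ⟨norm_smul_add_smul_eq_one hp₁ hp₂ h21 hc, inner_smul_add_smul_eq_zero c hp₁ h21, ?_⟩
  intro x hx hxp q
  rw [hdiv] at hxp
  refine ⟨norm_smul_add_smul_eq_one hp₁ hx hxp hc, inner_smul_add_smul_eq_zero c hp₁ hxp, ?_⟩
  have hval : (-1 : ℝ) / (n - 1) = c ^ 2 * (-1 / n - ((n : ℝ)⁻¹) ^ 2) := by
    rw [hc2]
    field_simp [hpos.ne']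
    ring
  rw [inner_smul_add_smul_smul_add_smul c hp₁ hxp h21, hval, mul_right_inj' hc0, sub_left_inj]
end

section
/- Let f : S^1 → ℝ be a continuous function on the unit circle in ℝ². Then there exist unit vectors p_1, p_2 ∈ ℝ² with ⟨p_1, p_2⟩ = -1/2 such that f(p_1) = f(p_2). -/
open RealInnerProductSpace

/-- The universal chord theorem for periodic functions: a continuous function with period `n * c`
takes the same value at two points at distance `c`. -/
theorem Function.Periodic.exists_add_eq_self {g : ℝ → ℝ} {c : ℝ} {n : ℕ} (hn : n ≠ 0)
    (hp : Function.Periodic g (n * c)) (hg : Continuous g) : ∃ t, g (t + c) = g t := by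
  let h : ℝ → ℝ := fun t ↦ g (t + c) - g t
  have hc : Continuous h := by fun_prop
  have hsum : ∑ k ∈ Finset.range n, h (k * c) = 0 := by
    have key := Finset.sum_range_sub (fun k : ℕ ↦ g (k * c)) n
    have hend : g (n * c) = g 0 := by simpa using hp 0
    simpa [h, hend, add_mul] using key
  have hne : (Finset.range n).Nonempty := Finset.nonempty_range_iff.mpr hn
  obtain ⟨a, -, ha⟩ := Finset.exists_le_of_sum_le (f := fun k : ℕ ↦ h (k * c)) (g := fun _ ↦ 0)
    hne (by simp [hsum])
  obtain ⟨b, -, hb⟩ := Finset.exists_le_of_sum_le (f := fun _ ↦ 0) (g := fun k : ℕ ↦ h (k * c))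
    hne (by simp [hsum])
  obtain ⟨t, ht⟩ := mem_range_of_exists_le_of_exists_ge hc ⟨_, ha⟩ ⟨_, hb⟩
  exact ⟨t, sub_eq_zero.mp ht⟩

/-- The point of the unit circle at angle `t`. -/
noncomputable def circlePoint (t : ℝ) : EuclideanSpace ℝ (Fin 2) :=
  !₂[Real.cos t, Real.sin t]

theorem continuous_circlePoint : Continuous circlePoint := by
  unfold circlePoint
  fun_prop

theorem norm_circlePoint (t : ℝ) : ‖circlePoint t‖ = 1 := by
  simp [circlePoint, EuclideanSpace.norm_eq]

theorem inner_circlePoint (s t : ℝ) : ⟪circlePoint s, circlePoint t⟫ = Real.cos (s - t) := by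
  simp [circlePoint, PiLp.inner_apply, Real.cos_sub]
  ring

theorem periodic_circlePoint : Function.Periodic circlePoint (2 * Real.pi) := by
  intro t
  simp [circlePoint]

/-- Base case of the induction in the paper's main theorem: every continuous real-valued
function on the unit circle `S¹ ⊆ ℝ²` takes the same value at two unit vectors subtending an
angle of `2π/3`, i.e. with inner product `-1/2`. -/
theorem knaster_circle (f : EuclideanSpace ℝ (Fin 2) → ℝ)
    (hf : ContinuousOn f (Metric.sphere (0 : EuclideanSpace ℝ (Fin 2)) 1)) :
    ∃ p₁ p₂ : EuclideanSpace ℝ (Fin 2),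
      ‖p₁‖ = 1 ∧ ‖p₂‖ = 1 ∧ ⟪p₁, p₂⟫ = -1 / 2 ∧ f p₁ = f p₂ := by
  have hg : Continuous (f ∘ circlePoint) :=
    hf.comp_continuous continuous_circlePoint fun t ↦ by simp [norm_circlePoint]
  have hp : Function.Periodic (f ∘ circlePoint) ((3 : ℕ) * (2 * Real.pi / 3)) := by
    have h3 : ((3 : ℕ) : ℝ) * (2 * Real.pi / 3) = 2 * Real.pi := by push_cast; ring
    rw [h3]
    exact periodic_circlePoint.comp f
  obtain ⟨t, ht⟩ := hp.exists_add_eq_self three_ne_zero hg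
  refine ⟨_, _, norm_circlePoint _, norm_circlePoint _, ?_, ht⟩
  rw [inner_circlePoint, add_sub_cancel_left,
    show 2 * Real.pi / 3 = Real.pi - Real.pi / 3 by ring, Real.cos_pi_sub, Real.cos_pi_div_three]
  norm_num
end

section
/- Let n ≥ 2 and let Π_1, …, Π_{n²} be n×n complex matrices that are pure states (Hermitian, Π_k² = Π_k, Tr Π_k = 1) with Tr(Π_j Π_k) = 1/(n+1) for all j ≠ k. Then ∑_{r=1}^{n²} ∑_{s=1}^{n²} ∑_{t=1}^{n²} Tr(Π_r Π_s Π_t) = n⁴. -/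
open Matrix

open scoped ComplexOrder in
/-- A Hermitian matrix `S` of size `n` is `n • 1` as soon as
`Tr S = n²` and `Tr S² = n³`. -/
lemma Matrix.IsHermitian.eq_natCast_smul_one_of_trace {n : ℕ} {S : Matrix (Fin n) (Fin n) ℂ}
    (hS : S.IsHermitian) (h₁ : S.trace = (n : ℂ) ^ 2) (h₂ : (S * S).trace = (n : ℂ) ^ 3) :
    S = (n : ℂ) • (1 : Matrix (Fin n) (Fin n) ℂ) := by
  have hH : (S - (n : ℂ) • (1 : Matrix (Fin n) (Fin n) ℂ))ᴴ = S - (n : ℂ) • 1 := by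
    simp [conjTranspose_sub, conjTranspose_smul, hS.eq]
  rw [← sub_eq_zero, ← trace_conjTranspose_mul_self_eq_zero_iff, hH]
  simp only [sub_mul, mul_sub, smul_mul_assoc, mul_smul_comm, one_mul, mul_one, trace_sub,
    trace_smul, trace_one, h₁, h₂, smul_eq_mul, Fintype.card_fin]
  ring

/-- The projectors of a SIC-POVM resolve `n` times the identity. -/
lemma sum_eq_natCast_smul_one_of_sic (n : ℕ)
    (P : Fin (n ^ 2) → Matrix (Fin n) (Fin n) ℂ)
    (hherm : ∀ k, (P k).IsHermitian)
    (hproj : ∀ k, P k * P k = P k)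
    (htr : ∀ k, (P k).trace = 1)
    (hover : ∀ j k, j ≠ k → (P j * P k).trace = 1 / ((n : ℂ) + 1)) :
    ∑ k, P k = (n : ℂ) • (1 : Matrix (Fin n) (Fin n) ℂ) := by
  refine Matrix.IsHermitian.eq_natCast_smul_one_of_trace ?_ ?_ ?_
  · simp [IsHermitian, conjTranspose_sum, fun k => (hherm k).eq]
  · simp [trace_sum, htr]
  · have hn : (n : ℂ) + 1 ≠ 0 := Nat.cast_add_one_ne_zero n
    have hpair : ∀ j k, (P j * P k).trace =
        1 / ((n : ℂ) + 1) + if j = k then 1 - 1 / ((n : ℂ) + 1) else 0 := by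
      intro j k
      split_ifs with h
      · rw [h, hproj, htr]; ring
      · rw [hover j k h, add_zero]
    simp only [Finset.sum_mul_sum, trace_sum, hpair, Finset.sum_add_distrib, Finset.sum_ite_eq,
      Finset.mem_univ, if_true, Finset.sum_const, Finset.card_univ, Fintype.card_fin,
      nsmul_eq_mul]
    push_cast
    field_simp
    ring


/-- Equation (24) of the paper (corollary 2 of Appleby–Flammia–Fuchs): for a SIC-POVM
`Π_1, …, Π_{n²}` in dimension `n`, the sum of `Tr(Π_r Π_s Π_t)` over all ordered triples of
indices equals `n⁴`. -/
theorem sic_triple_product_sum (n : ℕ) (hn : 2 ≤ n)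
    (P : Fin (n ^ 2) → Matrix (Fin n) (Fin n) ℂ)
    (hherm : ∀ k, (P k).IsHermitian)
    (hproj : ∀ k, P k * P k = P k)
    (htr : ∀ k, (P k).trace = 1)
    (hover : ∀ j k, j ≠ k → (P j * P k).trace = 1 / ((n : ℂ) + 1)) :
    ∑ r, ∑ s, ∑ t, (P r * P s * P t).trace = (n : ℂ) ^ 4 := by
  have hS := sum_eq_natCast_smul_one_of_sic n P hherm hproj htr hover
  simp only [← trace_sum, ← Finset.mul_sum, ← Finset.sum_mul, hS]
  simp only [mul_smul_comm, mul_one, trace_smul, trace_one, smul_eq_mul, Fintype.card_fin]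
  ring
end

section
/- Let n ≥ 2 and let ρ_a, ρ_b, ρ_c be n×n complex pure states (Hermitian, ρ² = ρ, Tr ρ = 1) with Tr(ρ_a ρ_b) = Tr(ρ_b ρ_c) = Tr(ρ_a ρ_c) = 1/(n+1). Let α = (n+1)^{3/2}·Re(Tr(ρ_a ρ_b ρ_c)). For θ ∈ ℝ define the Hermitian matrix M(θ) = ((2/3)cos θ + 1/3)ρ_a + (-(1/3)cos θ + (1/√3)sin θ + 1/3)ρ_b + (-(1/3)cos θ - (1/√3)sin θ + 1/3)ρ_c. Then Tr(M(θ)³) = (1/(9(n+1)^{3/2}))·( -4α + 2cos(3θ)·(2α + √(n+1)·(n-2)) + 7n√(n+1) + 13√(n+1) ). -/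
open Matrix Real

/-- The cubic trace of a linear combination of three idempotents, in terms of traces of products. -/
theorem trace_cube_of_idempotents {ι R : Type*} [Fintype ι] [DecidableEq ι] [CommRing R]
    (A B C : Matrix ι ι R) (hA : A * A = A) (hB : B * B = B) (hC : C * C = C) (x y z : R) :
    ((x • A + y • B + z • C) ^ 3).trace =
      x ^ 3 * A.trace + y ^ 3 * B.trace + z ^ 3 * C.trace +
      3 * (x ^ 2 * y + x * y ^ 2) * (A * B).trace +
      3 * (y ^ 2 * z + y * z ^ 2) * (B * C).trace +
      3 * (x ^ 2 * z + x * z ^ 2) * (A * C).trace +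
      3 * (x * y * z) * ((A * B * C).trace + (A * C * B).trace) := by
  have sandwich (P Q : Matrix ι ι R) (hP : P * P = P) : (P * Q * P).trace = (P * Q).trace := by
    rw [trace_mul_comm, ← Matrix.mul_assoc, hP]
  have hBCA : (B * C * A).trace = (A * B * C).trace := by
    rw [trace_mul_comm, ← Matrix.mul_assoc]
  have hCAB : (C * A * B).trace = (A * B * C).trace := by
    rw [Matrix.mul_assoc, trace_mul_comm]
  have hCBA : (C * B * A).trace = (A * C * B).trace := by
    rw [trace_mul_comm, ← Matrix.mul_assoc]
  have hBAC : (B * A * C).trace = (A * C * B).trace := by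
    rw [Matrix.mul_assoc, trace_mul_comm]
  have right (P Q : Matrix ι ι R) (hQ : Q * Q = Q) : P * Q * Q = P * Q := by
    rw [Matrix.mul_assoc, hQ]
  simp only [pow_three', Matrix.add_mul, Matrix.mul_add, Matrix.smul_mul, Matrix.mul_smul,
    trace_add, trace_smul, smul_eq_mul, hA, hB, hC, right _ _ hA, right _ _ hB, right _ _ hC,
    sandwich _ _ hA, sandwich _ _ hB, sandwich _ _ hC, hBCA, hCAB, hCBA, hBAC,
    trace_mul_comm B A, trace_mul_comm C B, trace_mul_comm C A]
  ring

/-- Reversing the order of a product of three Hermitian matrices conjugates its trace. -/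
theorem trace_mul_mul_add_trace_mul_mul_swap {ι : Type*} [Fintype ι] (A B C : Matrix ι ι ℂ)
    (hA : A.IsHermitian) (hB : B.IsHermitian) (hC : C.IsHermitian) :
    (A * B * C).trace + (A * C * B).trace = ((2 * (A * B * C).trace.re : ℝ) : ℂ) := by
  have h : (A * C * B).trace = star (A * B * C).trace := by
    rw [← trace_conjTranspose, conjTranspose_mul, conjTranspose_mul, hA.eq, hB.eq, hC.eq,
      ← Matrix.mul_assoc, trace_mul_comm (C * B) A, ← Matrix.mul_assoc]
  rw [h]
  exact Complex.add_conj _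

/-- The scalar identity behind the cubic trace, for three weights with sum one and vanishing
second elementary symmetric function. -/
theorem cubic_weights_identity (x y z t r : ℝ) (h₁ : x + y + z = 1)
    (h₂ : x * y + y * z + z * x = 0) :
    x ^ 3 + y ^ 3 + z ^ 3 + 3 * (x ^ 2 * y + x * y ^ 2) * t + 3 * (y ^ 2 * z + y * z ^ 2) * t +
      3 * (x ^ 2 * z + x * z ^ 2) * t + 3 * (x * y * z) * (2 * r) =
      1 + x * y * z * (3 - 9 * t + 6 * r) := by
  obtain rfl : z = 1 - x - y := by linarith
  linear_combination (-3 + 3 * t) * h₂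

/-- Equation (23) of the paper: along the circle `θ ↦ M(θ)` on the Bloch sphere through
three pure states `ρ_a, ρ_b, ρ_c` with pairwise overlaps `1/(n+1)`, the cubic trace is
`Tr(M(θ)³) = (1/(9(n+1)^{3/2}))·(-4α + 2cos(3θ)(2α + √(n+1)(n-2)) + 7n√(n+1) + 13√(n+1))`,
where `α = (n+1)^{3/2}·Re Tr(ρ_a ρ_b ρ_c)` is the cosine of the phase of the triple
product. -/
theorem trace_cube_on_circle (n : ℕ) (hn : 2 ≤ n)
    (ρa ρb ρc : Matrix (Fin n) (Fin n) ℂ)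
    (hah : ρa.IsHermitian) (ha2 : ρa * ρa = ρa) (hatr : ρa.trace = 1)
    (hbh : ρb.IsHermitian) (hb2 : ρb * ρb = ρb) (hbtr : ρb.trace = 1)
    (hch : ρc.IsHermitian) (hc2 : ρc * ρc = ρc) (hctr : ρc.trace = 1)
    (hab : (ρa * ρb).trace = 1 / ((n : ℂ) + 1))
    (hbc : (ρb * ρc).trace = 1 / ((n : ℂ) + 1))
    (hac : (ρa * ρc).trace = 1 / ((n : ℂ) + 1)) (θ : ℝ) :
    let α : ℝ := ((n : ℝ) + 1) ^ ((3 : ℝ) / 2) * ((ρa * ρb * ρc).trace.re)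
    let M : Matrix (Fin n) (Fin n) ℂ :=
      ((2 / 3 * cos θ + 1 / 3 : ℝ) : ℂ) • ρa +
      ((-(1 / 3) * cos θ + (1 / Real.sqrt 3) * sin θ + 1 / 3 : ℝ) : ℂ) • ρb +
      ((-(1 / 3) * cos θ - (1 / Real.sqrt 3) * sin θ + 1 / 3 : ℝ) : ℂ) • ρc
    (M ^ 3).trace =
      ((1 / (9 * ((n : ℝ) + 1) ^ ((3 : ℝ) / 2)) *
        (-4 * α + 2 * cos (3 * θ) * (2 * α + Real.sqrt ((n : ℝ) + 1) * ((n : ℝ) - 2)) +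
          7 * (n : ℝ) * Real.sqrt ((n : ℝ) + 1) + 13 * Real.sqrt ((n : ℝ) + 1)) : ℝ) : ℂ) := by
  intro α M
  set x : ℝ := 2 / 3 * cos θ + 1 / 3 with hx
  set y : ℝ := -(1 / 3) * cos θ + (1 / Real.sqrt 3) * sin θ + 1 / 3 with hy
  set z : ℝ := -(1 / 3) * cos θ - (1 / Real.sqrt 3) * sin θ + 1 / 3 with hz
  have hsqrt : (1 / Real.sqrt 3) ^ 2 = 1 / 3 := by
    rw [div_pow, Real.sq_sqrt (by norm_num)]
    norm_num
  have h₁ : x + y + z = 1 := by rw [hx, hy, hz]; ring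
  have hyz : y * z = (1 - cos θ) ^ 2 / 9 - sin θ ^ 2 / 3 := by
    rw [hy, hz]
    linear_combination (-sin θ ^ 2) * hsqrt
  have h₂ : x * y + y * z + z * x = 0 := by
    have hyz' : y + z = 1 - x := by linarith
    have : x * (1 - x) + y * z = 0 := by
      rw [hyz, hx]
      linear_combination (-1 / 3) * Real.sin_sq_add_cos_sq θ
    linear_combination this + x * hyz'
  have h₃ : x * y * z = 2 / 27 * (cos (3 * θ) - 1) := by
    rw [mul_assoc, hyz, hx, Real.cos_three_mul]
    linear_combination (-(2 * cos θ + 1) / 9) * Real.sin_sq_add_cos_sq θ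
  have hm : (0 : ℝ) < (n : ℝ) + 1 := by positivity
  have hpow : ((n : ℝ) + 1) ^ ((3 : ℝ) / 2) = ((n : ℝ) + 1) * Real.sqrt ((n : ℝ) + 1) := by
    rw [Real.sqrt_eq_rpow, show (3 : ℝ) / 2 = 1 + 1 / 2 by norm_num, Real.rpow_add hm,
      Real.rpow_one]
  have hs : Real.sqrt ((n : ℝ) + 1) ≠ 0 := (Real.sqrt_pos.2 hm).ne'
  have htrace : (M ^ 3).trace =
      ((1 + x * y * z * (3 - 9 * (1 / ((n : ℝ) + 1)) + 6 * (ρa * ρb * ρc).trace.re) : ℝ) : ℂ) := by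
    have hM : M = (x : ℂ) • ρa + (y : ℂ) • ρb + (z : ℂ) • ρc := rfl
    rw [hM, ← cubic_weights_identity x y z _ _ h₁ h₂, trace_cube_of_idempotents _ _ _ ha2 hb2 hc2,
      hatr, hbtr, hctr, hab, hbc, hac, trace_mul_mul_add_trace_mul_mul_swap _ _ _ hah hbh hch]
    push_cast
    ring
  rw [htrace, h₃]
  congr 1
  simp only [α, hpow]
  field_simp
  ring
end

section
/- Let ρ_a, ρ_b, ρ_c be 3×3 complex pure states (Hermitian, ρ² = ρ, Tr ρ = 1) with Tr(ρ_a ρ_b) = Tr(ρ_b ρ_c) = Tr(ρ_a ρ_c) = 1/4. For θ ∈ ℝ define M(θ) = ((2/3)cos θ + 1/3)ρ_a + (-(1/3)cos θ + (1/√3)sin θ + 1/3)ρ_b + (-(1/3)cos θ - (1/√3)sin θ + 1/3)ρ_c. If Tr(M(θ)³) = 1 for all θ ∈ ℝ, then Re(Tr(ρ_a ρ_b ρ_c)) = -1/8. -/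
open Matrix Real

/-- The trace of the cube of a linear combination of three idempotent matrices, in terms of traces
of products of distinct ones. -/
theorem Matrix.trace_cube_combination_of_idempotent {n R : Type*} [Fintype n] [DecidableEq n]
    [CommRing R] {A B C : Matrix n n R} (hA : A * A = A) (hB : B * B = B) (hC : C * C = C)
    (x y z : R) :
    ((x • A + y • B + z • C) ^ 3).trace =
      x ^ 3 * A.trace + y ^ 3 * B.trace + z ^ 3 * C.trace +
      3 * (x ^ 2 * y + x * y ^ 2) * (A * B).trace +
      3 * (y ^ 2 * z + y * z ^ 2) * (B * C).trace +
      3 * (x ^ 2 * z + x * z ^ 2) * (A * C).trace +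
      3 * x * y * z * ((A * B * C).trace + (C * B * A).trace) := by
  have sandwich {P Q : Matrix n n R} (hP : P * P = P) : (P * Q * P).trace = (P * Q).trace := by
    rw [trace_mul_comm, ← mul_assoc, hP]
  have absorb {P Q : Matrix n n R} (hQ : Q * Q = Q) : P * Q * Q = P * Q := by
    rw [mul_assoc, hQ]
  simp only [pow_succ, pow_zero, one_mul, add_mul, mul_add, smul_mul_assoc, mul_smul_comm,
    trace_add, trace_smul, smul_eq_mul, hA, hB, hC, absorb hA, absorb hB, absorb hC,
    sandwich hA, sandwich hB, sandwich hC]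
  rw [trace_mul_comm B A, trace_mul_comm C B, trace_mul_comm C A,
    ← trace_mul_cycle A B C, trace_mul_cycle B C A, ← trace_mul_cycle C B A,
    trace_mul_cycle B A C]
  ring

/-- For Hermitian matrices, reversing a triple product conjugates its trace. -/
theorem Matrix.IsHermitian.trace_mul_mul_reverse {n R : Type*} [Fintype n] [CommRing R]
    [StarRing R] {A B C : Matrix n n R} (hA : A.IsHermitian) (hB : B.IsHermitian)
    (hC : C.IsHermitian) : (C * B * A).trace = star (A * B * C).trace := by
  rw [← trace_conjTranspose, conjTranspose_mul, conjTranspose_mul, hA.eq, hB.eq, hC.eq, mul_assoc]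

/-- Dimension-3 case of Theorem 2 of the paper: if the cubic purity function is constantly `1`
along the circle `θ ↦ M(θ)` through three pure states with pairwise SIC overlaps `1/4`, then
the real part of the triple product `Tr(ρ_a ρ_b ρ_c)` equals `-1/8` (i.e. the cosine of the
triple-product phase is `-1`). -/
theorem trace_cube_constant_forces_phase (ρa ρb ρc : Matrix (Fin 3) (Fin 3) ℂ)
    (hah : ρa.IsHermitian) (ha2 : ρa * ρa = ρa) (hatr : ρa.trace = 1)
    (hbh : ρb.IsHermitian) (hb2 : ρb * ρb = ρb) (hbtr : ρb.trace = 1)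
    (hch : ρc.IsHermitian) (hc2 : ρc * ρc = ρc) (hctr : ρc.trace = 1)
    (hab : (ρa * ρb).trace = 1 / 4)
    (hbc : (ρb * ρc).trace = 1 / 4)
    (hac : (ρa * ρc).trace = 1 / 4)
    (hconst : ∀ θ : ℝ,
      ((((2 / 3 * cos θ + 1 / 3 : ℝ) : ℂ) • ρa +
        ((-(1 / 3) * cos θ + (1 / Real.sqrt 3) * sin θ + 1 / 3 : ℝ) : ℂ) • ρb +
        ((-(1 / 3) * cos θ - (1 / Real.sqrt 3) * sin θ + 1 / 3 : ℝ) : ℂ) • ρc) ^ 3).trace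
        = 1) :
    ((ρa * ρb * ρc).trace).re = -1 / 8 := by
  have h := hconst π
  rw [trace_cube_combination_of_idempotent ha2 hb2 hc2, hah.trace_mul_mul_reverse hbh hch,
    hatr, hbtr, hctr, hab, hbc, hac, cos_pi, sin_pi] at h
  have hre := congrArg Complex.re h
  rw [← starRingEnd_apply, Complex.add_conj] at hre
  norm_cast at hre
  norm_num at hre
  linarith
end

section
/- Let Π_1, …, Π_9 be 3×3 complex pure states (Hermitian, Π_k² = Π_k, Tr Π_k = 1) with Tr(Π_j Π_k) = 1/4 for all j ≠ k. Then there exist pairwise distinct indices r, s, t ∈ {1,…,9} such that Tr(Π_r Π_s Π_t) ≠ -1/8; equivalently, not all triple products of distinct SIC elements have phase π. -/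
open Matrix

/-- The elements of a SIC-POVM in dimension 3 sum to three times the identity. -/
theorem sum_sic_dim3_eq_three
    (P : Fin 9 → Matrix (Fin 3) (Fin 3) ℂ)
    (hherm : ∀ k, (P k).IsHermitian)
    (hproj : ∀ k, P k * P k = P k)
    (htr : ∀ k, (P k).trace = 1)
    (hover : ∀ j k, j ≠ k → (P j * P k).trace = 1 / 4) :
    ∑ k, P k = (3 : ℂ) • (1 : Matrix (Fin 3) (Fin 3) ℂ) := by
  open scoped ComplexOrder in
  have hS : (∑ k, P k)ᴴ = ∑ k, P k := by
    rw [conjTranspose_sum]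
    exact Finset.sum_congr rfl fun k _ => hherm k
  have hgram : ∀ j k, (P j * P k).trace = 1 / 4 + if j = k then 3 / 4 else 0 := by
    intro j k
    split_ifs with h
    · rw [h, hproj, htr]
      norm_num
    · rw [hover j k h, add_zero]
  have htrS : (∑ k, P k).trace = 9 := by
    simp [trace_sum, htr]
  have htrSS : ((∑ k, P k) * ∑ k, P k).trace = 27 := by
    simp only [Finset.sum_mul_sum, trace_sum, hgram, Finset.sum_add_distrib, Finset.sum_ite_eq,
      Finset.mem_univ, if_true, Finset.sum_const, Finset.card_univ, Fintype.card_fin]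
    norm_num
  rw [← sub_eq_zero, ← trace_conjTranspose_mul_self_eq_zero_iff, conjTranspose_sub, hS]
  simp only [conjTranspose_smul, conjTranspose_one, sub_mul, mul_sub, trace_sub, smul_mul_assoc,
    mul_smul_comm, one_mul, mul_one, trace_smul, htrS, htrSS, trace_one, Fintype.card_fin]
  norm_num

/-- For a SIC-POVM in dimension 3 (nine pure states with pairwise overlaps `1/4`), not all
triple products of distinct elements can have phase `π`: there are pairwise distinct indices
`r, s, t` with `Tr(Π_r Π_s Π_t) ≠ -1/8`. -/
theorem sic_dim3_triple_product_not_all_negative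
    (P : Fin 9 → Matrix (Fin 3) (Fin 3) ℂ)
    (hherm : ∀ k, (P k).IsHermitian)
    (hproj : ∀ k, P k * P k = P k)
    (htr : ∀ k, (P k).trace = 1)
    (hover : ∀ j k, j ≠ k → (P j * P k).trace = 1 / 4) :
    ∃ r s t : Fin 9, r ≠ s ∧ s ≠ t ∧ r ≠ t ∧
      (P r * P s * P t).trace ≠ -1 / 8 := by
  by_contra! hneg
  have h01 : (P 0 * P 1).trace = 1 / 4 := hover 0 1 (by decide)
  have hsum : ∑ t, (P 0 * P 1 * P t).trace = 3 / 4 := by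
    rw [← trace_sum, ← Finset.mul_sum, sum_sic_dim3_eq_three P hherm hproj htr hover,
      mul_smul_comm, mul_one, trace_smul, h01]
    norm_num
  have h0 : (P 0 * P 1 * P 0).trace = 1 / 4 := by
    rw [trace_mul_cycle, hproj, h01]
  have h1 : (P 0 * P 1 * P 1).trace = 1 / 4 := by
    rw [mul_assoc, hproj, h01]
  have hrest : ∀ t : Fin 7, (P 0 * P 1 * P t.succ.succ).trace = -1 / 8 := fun t =>
    hneg 0 1 t.succ.succ (by decide) (by revert t; decide) (by revert t; decide)
  rw [Fin.sum_univ_succ, Fin.sum_univ_succ, Fin.succ_zero_eq_one, h0, h1,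
    Finset.sum_congr rfl fun t _ => hrest t] at hsum
  norm_num at hsum
end

section
/- Let n ≥ 2. Then there exist n×n complex traceless Hermitian matrices A_1, …, A_{n²-1} and a real constant c such that Tr(A_k²) = (n-1)/n for all k, Tr(A_j A_k) = -1/(n(n+1)) for all j ≠ k, and Tr((I/n + A_k)³) = c for all k. -/
open Matrix

section SimplexOrbit

variable {n : ℕ} [NeZero n]

/-- The `a`-th cyclic diagonal of a Hermitian matrix on `ZMod n`, chosen so that its orbit under
the Weyl–Heisenberg group is a regular simplex: `j ↦ simplexDiagonal a j` has a flat spectrum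
for `a ≠ 0`, and is a centred delta function for `a = 0`. -/
noncomputable def simplexDiagonal (a j : ZMod n) : ℂ :=
  if a = 0 then (if j = 0 then 1 else 0) - (n : ℂ)⁻¹
  else if a + a = 0 then
    (if j = 0 then (1 + Complex.I) / 2 else 0) + (if j = a then (1 - Complex.I) / 2 else 0)
  else if j = (if a.val < (-a).val then 0 else -a) then 1 else 0

lemma simplexDiagonal_neg (a j : ZMod n) :
    simplexDiagonal (-a) (j + a) = star (simplexDiagonal a j) := by
  unfold simplexDiagonal
  by_cases ha : a = 0
  · subst ha
    by_cases hj : j = 0 <;> simp [hj]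
  by_cases ha2 : a + a = 0
  · have hneg : -a = a := neg_eq_of_add_eq_zero_left ha2
    have h0 : j + a = 0 ↔ j = a := by rw [add_eq_zero_iff_eq_neg, hneg]
    by_cases hj : j = 0
    · subst hj
      simp [ha, ha2, hneg, Ne.symm ha, sub_eq_add_neg]
    · by_cases hja : j = a
      · subst hja
        simp [ha, ha2, hneg, Ne.symm ha, sub_eq_add_neg]
      · simp [ha, ha2, hneg, h0, hj, hja]
  · have hna2 : -a + -a ≠ 0 := fun h => ha2 (by linear_combination -h)
    have hval : a.val ≠ (-a).val := fun h => ha2 (by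
      have := ZMod.val_injective n h
      linear_combination this)
    rcases lt_or_gt_of_ne hval with h | h
    · simp [ha, ha2, hna2, h, not_lt.mpr h.le]
    · have h0 : j + a = 0 ↔ j = -a := add_eq_zero_iff_eq_neg
      simp [ha, ha2, hna2, h, not_lt.mpr h.le, h0]

lemma sum_simplexDiagonal_mul_star (a s t : ZMod n) :
    ∑ j, simplexDiagonal a (j - s) * star (simplexDiagonal a (j - t)) =
      (if s = t then 1 else 0) - (if a = 0 then (n : ℂ)⁻¹ else 0) := by
  have hn : (n : ℂ) ≠ 0 := NeZero.ne _
  have hst : (t = s) = (s = t) := propext eq_comm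
  unfold simplexDiagonal
  by_cases ha : a = 0
  · simp [ha, sub_mul, mul_sub, Finset.sum_sub_distrib, sub_eq_zero, hst, hn, apply_ite star]
  by_cases ha2 : a + a = 0
  · have hts : s + a = t ↔ s = t + a :=
      ⟨fun h => by linear_combination h - ha2, fun h => by linear_combination h + ha2⟩
    simp [ha, ha2, sub_eq_iff_eq_add, add_mul, mul_add, Finset.sum_add_distrib, add_comm a, hts]
    have hI : Complex.I ^ 2 = -1 := Complex.I_sq
    by_cases hsa : s = t + a
    · simp [hsa, ha, Complex.conj_ofNat]
      linear_combination hI / 2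
    · by_cases h : s = t
      · subst h
        simp [ha, Complex.conj_ofNat]
        linear_combination -hI / 2
      · simp [hsa, h]
  · simp [ha, ha2, sub_eq_iff_eq_add, hst]

/-- The element indexed by `p` of the orbit of the Hermitian matrix with cyclic diagonals
`simplexDiagonal` under the Weyl–Heisenberg group. -/
noncomputable def simplexVertex (p : ZMod n × ZMod n) : Matrix (ZMod n) (ZMod n) ℂ :=
  Matrix.of fun j k => ZMod.stdAddChar (p.2 * (j - k)) * simplexDiagonal (k - j) (j - p.1)

lemma star_stdAddChar (x : ZMod n) :
    star (ZMod.stdAddChar x : ℂ) = ZMod.stdAddChar (-x) :=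
  (AddChar.map_neg_eq_conj _ x).symm

lemma simplexDiagonal_sub_swap (j k s : ZMod n) :
    simplexDiagonal (j - k) (k - s) = star (simplexDiagonal (k - j) (j - s)) := by
  rw [← simplexDiagonal_neg]
  congr 1 <;> ring

lemma isHermitian_simplexVertex (p : ZMod n × ZMod n) : (simplexVertex p).IsHermitian := by
  ext j k
  simp only [simplexVertex, Matrix.conjTranspose_apply, Matrix.of_apply, star_mul',
    star_stdAddChar, ← simplexDiagonal_sub_swap]
  congr 2
  ring

lemma trace_simplexVertex (p : ZMod n × ZMod n) : (simplexVertex p).trace = 0 := by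
  have hn : (n : ℂ) ≠ 0 := NeZero.ne _
  simp [Matrix.trace, simplexVertex, simplexDiagonal, sub_eq_zero, hn]

lemma trace_simplexVertex_mul (p q : ZMod n × ZMod n) :
    (simplexVertex p * simplexVertex q).trace = (if p = q then (n : ℂ) else 0) - (n : ℂ)⁻¹ := by
  calc (simplexVertex p * simplexVertex q).trace
      = ∑ j, ∑ k, ZMod.stdAddChar ((k - j) * (q.2 - p.2)) *
          (simplexDiagonal (k - j) (j - p.1) * star (simplexDiagonal (k - j) (j - q.1))) := by
        simp only [Matrix.trace, Matrix.diag_apply, Matrix.mul_apply, simplexVertex,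
          Matrix.of_apply]
        refine Finset.sum_congr rfl fun j _ => Finset.sum_congr rfl fun k _ => ?_
        rw [simplexDiagonal_sub_swap j k, mul_mul_mul_comm, ← AddChar.map_add_eq_mul]
        congr 2
        ring
    _ = ∑ j, ∑ a, ZMod.stdAddChar (a * (q.2 - p.2)) *
          (simplexDiagonal a (j - p.1) * star (simplexDiagonal a (j - q.1))) :=
        Finset.sum_congr rfl fun j _ => Fintype.sum_equiv (Equiv.subRight j) _ _ fun k => by
          rw [Equiv.subRight_apply]
    _ = ∑ a, ZMod.stdAddChar (a * (q.2 - p.2)) *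
          ((if p.1 = q.1 then 1 else 0) - (if a = 0 then (n : ℂ)⁻¹ else 0)) := by
        rw [Finset.sum_comm]
        simp only [← Finset.mul_sum, sum_simplexDiagonal_mul_star]
    _ = (if p = q then (n : ℂ) else 0) - (n : ℂ)⁻¹ := by
        have hpq : p = q ↔ p.1 = q.1 ∧ q.2 = p.2 := by rw [Prod.ext_iff, eq_comm (a := p.2)]
        simp only [mul_sub (ZMod.stdAddChar _), Finset.sum_sub_distrib, ← Finset.sum_mul,
          AddChar.sum_mulShift _ (ZMod.isPrimitive_stdAddChar n), sub_eq_zero, hpq]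
        by_cases h1 : p.1 = q.1 <;> by_cases h2 : q.2 = p.2 <;> simp [h1, h2]

lemma trace_simplexVertex_pow_three (p : ZMod n × ZMod n) :
    (simplexVertex p ^ 3).trace = (simplexVertex (0 : ZMod n × ZMod n) ^ 3).trace := by
  have expand (q : ZMod n × ZMod n) : (simplexVertex q ^ 3).trace =
      ∑ i, ∑ k, ∑ j, simplexDiagonal (j - i) (i - q.1) * simplexDiagonal (k - j) (j - q.1) *
        simplexDiagonal (i - k) (k - q.1) := by
    simp only [pow_three', Matrix.trace, Matrix.diag_apply, Matrix.mul_apply, Finset.sum_mul,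
      simplexVertex, Matrix.of_apply]
    refine Finset.sum_congr rfl fun i _ => Finset.sum_congr rfl fun k _ =>
      Finset.sum_congr rfl fun j _ => ?_
    have phase : ZMod.stdAddChar (q.2 * (i - j)) * ZMod.stdAddChar (q.2 * (j - k)) *
        ZMod.stdAddChar (q.2 * (k - i)) = (1 : ℂ) := by
      rw [← AddChar.map_add_eq_mul, ← AddChar.map_add_eq_mul,
        ← AddChar.map_zero_eq_one (ZMod.stdAddChar (N := n))]
      congr 1
      ring
    linear_combination (simplexDiagonal (j - i) (i - q.1) * simplexDiagonal (k - j) (j - q.1) *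
        simplexDiagonal (i - k) (k - q.1)) * phase
  rw [expand, expand]
  refine Fintype.sum_equiv (Equiv.subRight p.1) _ _ fun i =>
    Fintype.sum_equiv (Equiv.subRight p.1) _ _ fun k =>
    Fintype.sum_equiv (Equiv.subRight p.1) _ _ fun j => ?_
  simp

end SimplexOrbit

lemma Matrix.trace_submatrix_equiv {m l R : Type*} [Fintype m] [Fintype l] [AddCommMonoid R]
    (M : Matrix m m R) (e : l ≃ m) : (M.submatrix e e).trace = M.trace :=
  e.sum_comp fun i => M i i

lemma Matrix.trace_smul_one_add_pow_three {m R : Type*} [Fintype m] [DecidableEq m] [CommRing R]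
    (a : R) (M : Matrix m m R) :
    ((a • (1 : Matrix m m R) + M) ^ 3).trace =
      a ^ 3 * Fintype.card m + 3 * a ^ 2 * M.trace + 3 * a * (M ^ 2).trace + (M ^ 3).trace := by
  have h : (a • (1 : Matrix m m R) + M) ^ 3 =
      a ^ 3 • (1 : Matrix m m R) + (3 * a ^ 2) • M + (3 * a) • M ^ 2 + M ^ 3 := by
    simp only [pow_succ, pow_zero, one_mul, add_mul, mul_add, smul_mul_assoc, mul_smul_comm,
      mul_one]
    module
  rw [h]
  simp

/-- Corollary of the paper's main theorem applied to the cubic trace polynomial on the Bloch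
sphere: in every dimension `n ≥ 2` there exist `n² - 1` traceless Hermitian matrices forming
`n² - 1` vertices of the regular simplex a SIC-POVM would form
(`Tr(A_k²) = (n-1)/n`, `Tr(A_j A_k) = -1/(n(n+1))` for `j ≠ k`), all of whose corresponding
states `I/n + A_k` share a common value `c` of the cubic trace `Tr((I/n + A_k)³)`. -/
theorem exists_generalized_sic_vertices (n : ℕ) (hn : 2 ≤ n) :
    ∃ (A : Fin (n ^ 2 - 1) → Matrix (Fin n) (Fin n) ℂ) (c : ℝ),
      (∀ k, (A k).IsHermitian) ∧
      (∀ k, (A k).trace = 0) ∧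
      (∀ k, ((A k) ^ 2).trace = ((n : ℂ) - 1) / n) ∧
      (∀ j k, j ≠ k → (A j * A k).trace = -1 / ((n : ℂ) * ((n : ℂ) + 1))) ∧
      (∀ k, (((n : ℂ)⁻¹ • (1 : Matrix (Fin n) (Fin n) ℂ) + A k) ^ 3).trace = (c : ℂ)) := by
  have : NeZero n := ⟨by omega⟩
  have hn0 : (n : ℂ) ≠ 0 := NeZero.ne _
  have hn1 : (n : ℂ) + 1 ≠ 0 := Nat.cast_add_one_ne_zero n
  obtain ⟨f⟩ : Nonempty (Fin (n ^ 2 - 1) ↪ ZMod n × ZMod n) :=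
    Function.Embedding.nonempty_of_card_le (by simp [ZMod.card, ← sq])
  let e : Fin n ≃ ZMod n := (ZMod.finEquiv n).toEquiv
  let r : ℂ := ((√(n + 1) : ℝ) : ℂ)⁻¹
  have hr : r ^ 2 = ((n : ℂ) + 1)⁻¹ := by
    rw [inv_pow, ← Complex.ofReal_pow, Real.sq_sqrt (by positivity)]
    push_cast
    rfl
  let A (k : Fin (n ^ 2 - 1)) : Matrix (Fin n) (Fin n) ℂ :=
    r • (simplexVertex (f k)).submatrix e e
  have herm (k) : (A k).IsHermitian := by
    have hstar : star r = r := by simp [r]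
    rw [Matrix.IsHermitian, Matrix.conjTranspose_smul, hstar,
      ((isHermitian_simplexVertex (f k)).submatrix e).eq]
  have htrace (k) : (A k).trace = 0 := by
    rw [Matrix.trace_smul, Matrix.trace_submatrix_equiv, trace_simplexVertex, smul_zero]
  have hmul (j k) : (A j * A k).trace =
      ((n : ℂ) + 1)⁻¹ * ((if j = k then (n : ℂ) else 0) - (n : ℂ)⁻¹) := by
    rw [Matrix.smul_mul, Matrix.mul_smul, smul_smul, ← sq, hr, Matrix.submatrix_mul_equiv,
      Matrix.trace_smul, Matrix.trace_submatrix_equiv, trace_simplexVertex_mul, smul_eq_mul]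
    simp only [f.injective.eq_iff]
  have hsq (k) : ((A k) ^ 2).trace = ((n : ℂ) - 1) / n := by
    rw [sq, hmul, if_pos rfl]
    field_simp
    ring
  have hcube (k) : ((A k) ^ 3).trace =
      r ^ 3 * (simplexVertex (0 : ZMod n × ZMod n) ^ 3).trace := by
    rw [smul_pow, Matrix.trace_smul, smul_eq_mul, pow_three' (Matrix.submatrix _ _ _),
      Matrix.submatrix_mul_equiv, Matrix.submatrix_mul_equiv, ← pow_three',
      Matrix.trace_submatrix_equiv, trace_simplexVertex_pow_three]
  let k₀ : Fin (n ^ 2 - 1) := ⟨0, Nat.sub_pos_of_lt (Nat.one_lt_pow two_ne_zero hn)⟩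
  let B (k : Fin (n ^ 2 - 1)) : Matrix (Fin n) (Fin n) ℂ := (n : ℂ)⁻¹ • 1 + A k
  have hB (k) : ((B k) ^ 3).trace = ((B k₀) ^ 3).trace := by
    simp only [B, Matrix.trace_smul_one_add_pow_three, htrace, hsq, hcube]
  have hreal : ((((B k₀) ^ 3).trace.re : ℝ) : ℂ) = ((B k₀) ^ 3).trace := by
    have hBherm : (B k₀).IsHermitian := by
      refine Matrix.IsHermitian.add ?_ (herm k₀)
      simp [Matrix.IsHermitian, Matrix.conjTranspose_smul]
    rw [← Complex.conj_eq_iff_re, starRingEnd_apply, ← Matrix.trace_conjTranspose,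
      (hBherm.pow 3).eq]
  refine ⟨A, ((B k₀) ^ 3).trace.re, herm, htrace, hsq, fun j k hjk => ?_, fun k => ?_⟩
  · rw [hmul, if_neg hjk]
    field_simp
    ring
  · rw [hreal, ← hB k]
end

section
/- Let n ≥ 1 and let ρ be an n×n complex Hermitian matrix. Then Tr ρ = 1, Tr(ρ²) = 1 and Tr(ρ³) = 1 hold simultaneously if and only if ρ is a pure state, i.e., ρ² = ρ and Tr ρ = 1 (equivalently ρ is a rank-one orthogonal projection). -/
open Matrix

namespace Matrix.IsHermitian

variable {𝕜 m : Type*} [RCLike 𝕜] [Fintype m] [DecidableEq m] {A : Matrix m m 𝕜}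

theorem pow_eq_conj_diagonal (hA : A.IsHermitian) (k : ℕ) :
    A ^ k = Unitary.conjStarAlgAut 𝕜 _ hA.eigenvectorUnitary
      (diagonal fun i => ((hA.eigenvalues i ^ k : ℝ) : 𝕜)) := by
  conv_lhs => rw [hA.spectral_theorem, ← map_pow, diagonal_pow]
  congr 2
  ext i
  simp

theorem trace_pow_eq_sum_eigenvalues_pow (hA : A.IsHermitian) (k : ℕ) :
    (A ^ k).trace = ((∑ i, hA.eigenvalues i ^ k : ℝ) : 𝕜) := by
  rw [hA.pow_eq_conj_diagonal, Unitary.conjStarAlgAut_apply, trace_mul_cycle,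
    Unitary.coe_star_mul_self, one_mul, trace_diagonal]
  push_cast
  rfl

theorem sq_eq_self_of_eigenvalues (hA : A.IsHermitian)
    (h : ∀ i, hA.eigenvalues i ^ 2 = hA.eigenvalues i) : A ^ 2 = A := by
  conv_rhs => rw [← pow_one A]
  simp only [hA.pow_eq_conj_diagonal, h, pow_one]

end Matrix.IsHermitian

theorem sq_eq_self_of_sum_sq_eq_one_of_sum_cube_eq_one {ι : Type*} [Fintype ι] {x : ι → ℝ}
    (h2 : ∑ i, x i ^ 2 = 1) (h3 : ∑ i, x i ^ 3 = 1) (i : ι) : x i ^ 2 = x i := by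
  have hle (j : ι) : x j ≤ 1 := by
    have : x j ^ 2 ≤ 1 :=
      h2 ▸ Finset.single_le_sum (fun l _ => sq_nonneg (x l)) (Finset.mem_univ j)
    nlinarith
  have hsum : ∑ j, x j ^ 2 * (1 - x j) = 0 := by
    calc ∑ j, x j ^ 2 * (1 - x j) = ∑ j, (x j ^ 2 - x j ^ 3) :=
          Finset.sum_congr rfl fun j _ => by ring
      _ = 0 := by rw [Finset.sum_sub_distrib, h2, h3, sub_self]
  have hzero := (Finset.sum_eq_zero_iff_of_nonneg fun j _ =>
    mul_nonneg (sq_nonneg (x j)) (sub_nonneg.2 (hle j))).1 hsum i (Finset.mem_univ i)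
  rcases mul_eq_zero.1 hzero with h | h
  · rw [h, pow_eq_zero_iff two_ne_zero |>.1 h]
  · rw [← sub_eq_zero.1 h, one_pow]

/-- The trace characterization of purity used throughout the paper: a Hermitian matrix `ρ`
satisfies `Tr ρ = Tr(ρ²) = Tr(ρ³) = 1` if and only if it is a pure state, i.e. a rank-one
orthogonal projection (`ρ² = ρ` and `Tr ρ = 1`). -/
theorem pure_state_iff_traces (n : ℕ) (hn : 1 ≤ n)
    (ρ : Matrix (Fin n) (Fin n) ℂ) (hρ : ρ.IsHermitian) :
    (ρ.trace = 1 ∧ (ρ ^ 2).trace = 1 ∧ (ρ ^ 3).trace = 1) ↔ (ρ ^ 2 = ρ ∧ ρ.trace = 1) := by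
  constructor
  · rintro ⟨h1, h2, h3⟩
    rw [hρ.trace_pow_eq_sum_eigenvalues_pow] at h2 h3
    exact ⟨hρ.sq_eq_self_of_eigenvalues <| sq_eq_self_of_sum_sq_eq_one_of_sum_cube_eq_one
      (Complex.ofReal_eq_one.1 h2) (Complex.ofReal_eq_one.1 h3), h1⟩
  · rintro ⟨h, h1⟩
    have h3 : ρ ^ 3 = ρ := by rw [pow_succ, h, ← sq, h]
    exact ⟨h1, by rw [h, h1], by rw [h3, h1]⟩
end
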